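/- arXiv:2101.06899 — 3 statements merged into one kernel-verified Lean document; each statement's English description precedes it below -/
import Mathlib

section
/- Let k be a positive integer and let p be a k-radius prime, i.e., a prime satisfying p ≡ 1 (mod 2k) such that the elements 1^{(p-1)/k}, 2^{(p-1)/k}, ..., k^{(p-1)/k} of Z_p^* are pairwise distinct. Then both the set [1,k] = {1,2,...,k} and the set [-k,k]* = {-k,...,-1,1,...,k} split Z_p. -/
/-- `M` splits `ℤ_n`: there is a splitter set `S ⊆ ℤ_n` such that every nonzero
element of `ℤ_n` has a unique representation `m * s` with `m ∈ M`, `s ∈ S`,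
while `0` has no such representation. -/
def Splits (M : Set ℤ) (n : ℕ) : Prop :=
  ∃ S : Set (ZMod n),
    (∀ g : ZMod n, g ≠ 0 → ∃! ms : ℤ × ZMod n,
      ms.1 ∈ M ∧ ms.2 ∈ S ∧ (ms.1 : ZMod n) * ms.2 = g) ∧
    ¬ ∃ m ∈ M, ∃ s ∈ S, (m : ZMod n) * s = 0

/-- If the `n`-th powers of `1, …, k` are distinct nonzero elements of a field in which
every nonzero `x` satisfies `x ^ (n * k) = 1`, then they exhaust the `n`-th powers. -/
theorem exists_pow_eq_of_injOn_pow {F : Type*} [Field F] {k n : ℕ} (hk : 0 < k)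
    (hpow : ∀ x : F, x ≠ 0 → x ^ (n * k) = 1)
    (hne : ∀ i ∈ Set.Icc 1 k, (i : F) ≠ 0)
    (hinj : Set.InjOn (fun i : ℕ => (i : F) ^ n) (Set.Icc 1 k)) {g : F} (hg : g ≠ 0) :
    ∃ i ∈ Set.Icc 1 k, (i : F) ^ n = g ^ n := by
  classical
  have mem_roots : ∀ x : F, x ≠ 0 → x ^ n ∈ Polynomial.nthRootsFinset k (1 : F) := fun x hx => by
    rw [Polynomial.mem_nthRootsFinset hk, ← pow_mul, hpow x hx]
  have hsurj := Finset.surj_on_of_inj_on_of_card_le (s := Finset.Icc 1 k)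
    (t := Polynomial.nthRootsFinset k (1 : F)) (fun i _ => (i : F) ^ n)
    (fun i hi => mem_roots _ (hne i (by simpa using hi)))
    (fun i j hi hj h => hinj (by simpa using hi) (by simpa using hj) h)
    (by
      rw [Nat.card_Icc, Nat.add_sub_cancel, Polynomial.nthRootsFinset_def]
      exact (Multiset.toFinset_card_le _).trans (Polynomial.card_nthRoots k 1))
  obtain ⟨i, hi, h⟩ := hsurj _ (mem_roots g hg)
  exact ⟨i, by simpa using hi, h.symm⟩

/-- If `p` is a `k`-radius prime, then both `[1, k]` and `[-k, k]*` split `ℤ_p`. -/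
theorem splits_of_k_radius_prime (k : ℕ) (hk : 0 < k)
    (p : ℕ) (hp : p.Prime) (hmod : p % (2 * k) = 1)
    (hdist : Set.InjOn (fun i : ℕ => (i : ZMod p) ^ ((p - 1) / k)) (Set.Icc 1 k)) :
    Splits (Set.Icc (1 : ℤ) (k : ℤ)) p ∧
    Splits (Set.Icc (-(k : ℤ)) (k : ℤ) \ {0}) p := by
  have : Fact p.Prime := ⟨hp⟩
  obtain ⟨q, hq⟩ : ∃ q, p = 2 * k * q + 1 := ⟨p / (2 * k), by
    have := Nat.div_add_mod p (2 * k); omega⟩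
  have hn : (p - 1) / k = 2 * q := by
    rw [hq, Nat.add_sub_cancel, mul_comm 2 k, mul_assoc, Nat.mul_div_cancel_left _ hk]
  rw [hn] at hdist
  have hq0 : 0 < q := by
    rcases Nat.eq_zero_or_pos q with rfl | h
    · exact absurd hq (by simpa using hp.one_lt.ne')
    · exact h
  have hkp : k < p := by nlinarith
  have hne : ∀ i ∈ Set.Icc 1 k, (i : ZMod p) ≠ 0 := fun i hi h =>
    absurd (Nat.le_of_dvd hi.1 ((ZMod.natCast_eq_zero_iff i p).1 h)) (by have := hi.2; omega)
  have natAbs_pow (m : ℤ) : ((m.natAbs : ℕ) : ZMod p) ^ (2 * q) = (m : ZMod p) ^ (2 * q) := by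
    rcases Int.natAbs_eq m with h | h <;> nth_rw 2 [h] <;> simp [(even_two_mul q).neg_pow]
  have hneZ : ∀ m : ℤ, m.natAbs ∈ Set.Icc 1 k → (m : ZMod p) ≠ 0 := fun m hm h => by
    have := natAbs_pow m
    rw [h, zero_pow (by omega)] at this
    exact hne _ hm (eq_zero_of_pow_eq_zero this)
  have rep {g : ZMod p} (hg : g ≠ 0) :
      ∃ i ∈ Set.Icc 1 k, ∃ s : ZMod p, s ^ (2 * q) = 1 ∧ (i : ZMod p) * s = g := by
    obtain ⟨i, hi, h⟩ := exists_pow_eq_of_injOn_pow hk (fun x hx => by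
      rw [← ZMod.pow_card_sub_one_eq_one hx]
      congr 1
      rw [hq, Nat.add_sub_cancel]
      ring) hne hdist hg
    exact ⟨i, hi, g / i, by rw [div_pow, h, div_self (pow_ne_zero _ hg)],
      mul_div_cancel₀ _ (hne i hi)⟩
  have natAbs_unique {m m' : ℤ} {s s' : ZMod p} (hm : m.natAbs ∈ Set.Icc 1 k)
      (hm' : m'.natAbs ∈ Set.Icc 1 k) (hs : s ^ (2 * q) = 1) (hs' : s' ^ (2 * q) = 1)
      (h : (m : ZMod p) * s = m' * s') : m.natAbs = m'.natAbs := by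
    apply hdist hm hm'
    have := congrArg (· ^ (2 * q)) h
    simpa only [mul_pow, hs, hs', mul_one, natAbs_pow] using this
  have ne_zero {s : ZMod p} (hs : s ^ (2 * q) = 1) : s ≠ 0 := by
    rintro rfl
    rw [zero_pow (by omega)] at hs
    exact zero_ne_one hs
  have valMinAbs_neg (s : ZMod p) : (-s).valMinAbs = -s.valMinAbs :=
    ZMod.valMinAbs_neg_of_ne_half fun h => by
      have : 2 * (k * q) = 2 * k * q := by ring
      omega
  constructor
  · refine ⟨{s | s ^ (2 * q) = 1}, fun g hg => ?_, ?_⟩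
    · obtain ⟨i, hi, s, hs, h⟩ := rep hg
      simp only [Set.mem_Icc] at hi
      refine ⟨(i, s), ⟨by simp only [Set.mem_Icc]; omega, hs, by simpa using h⟩, ?_⟩
      rintro ⟨m, t⟩ ⟨hm, ht, h'⟩
      simp only [Set.mem_Icc] at hm
      have hab : m.natAbs = (i : ℤ).natAbs := natAbs_unique
        (by simp only [Set.mem_Icc]; omega) (by simp only [Set.mem_Icc]; omega) ht hs
        (by simpa [h] using h')
      obtain rfl : m = i := by omega
      have hi0 := hne i hi
      simp only [Int.cast_natCast] at h'
      rw [mul_left_cancel₀ hi0 (h'.trans h.symm)]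
    · rintro ⟨m, hm, s, hs, h⟩
      simp only [Set.mem_Icc] at hm
      exact mul_ne_zero (hneZ m (by simp only [Set.mem_Icc]; omega)) (ne_zero hs) h
  · have mem_iff (m : ℤ) : m ∈ Set.Icc (-(k : ℤ)) k \ {0} ↔ m.natAbs ∈ Set.Icc 1 k := by
      simp only [Set.mem_sdiff, Set.mem_Icc, Set.mem_singleton_iff]
      omega
    simp only [Splits, mem_iff]
    refine ⟨{s | s ^ (2 * q) = 1 ∧ 0 < s.valMinAbs}, fun g hg => ?_, ?_⟩
    · obtain ⟨m, hm, s, hs, hpos, h⟩ : ∃ m : ℤ, m.natAbs ∈ Set.Icc 1 k ∧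
          ∃ s : ZMod p, s ^ (2 * q) = 1 ∧ 0 < s.valMinAbs ∧ (m : ZMod p) * s = g := by
        obtain ⟨i, hi, s, hs, h⟩ := rep hg
        have hs0 : s.valMinAbs ≠ 0 := (ZMod.valMinAbs_eq_zero s).not.2 (ne_zero hs)
        rcases lt_or_gt_of_ne hs0 with hlt | hgt
        · exact ⟨-i, by simpa using hi, -s, by rwa [(even_two_mul q).neg_pow],
            by rw [valMinAbs_neg]; omega, by simpa using h⟩
        · exact ⟨i, by simpa using hi, s, hs, hgt, by simpa using h⟩
      refine ⟨(m, s), ⟨hm, ⟨hs, hpos⟩, h⟩, ?_⟩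
      rintro ⟨m', t⟩ ⟨hm', ⟨ht, htpos⟩, h'⟩
      have hm0 := hneZ m hm
      have heq := h'.trans h.symm
      rcases Int.natAbs_eq_natAbs_iff.1 (natAbs_unique hm' hm ht hs heq) with hmm | hmm <;>
        dsimp only at hmm htpos heq <;> subst hmm
      · rw [mul_left_cancel₀ hm0 heq]
      · have hts : -t = s := mul_left_cancel₀ hm0 (by simpa using heq)
        rw [← hts, valMinAbs_neg] at hpos
        omega
    · rintro ⟨m, hm, s, ⟨hs, -⟩, h⟩
      exact mul_ne_zero (hneZ m hm) (ne_zero hs) h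
end

section
/- Let k₁ and k₂ be non-negative integers with k₁ ≤ k₂ and k₁ + k₂ = k ≥ 3. Then the following are equivalent: (a) [-k₁,k₂]* splits Z_p for some prime p with p ≡ 1 (mod k); (b) there are infinitely many primes p such that [-k₁,k₂]* splits Z_p; (c) there is a direct logarithm from [-k₁,k₂]* to Z_{k'} for some positive integer k' divisible by k. -/
/-- The set of integers `[-k₁, k₂]* = {-k₁, …, k₂} \ {0}`. -/
def Iset (k₁ k₂ : ℕ) : Set ℤ := Set.Icc (-(k₁ : ℤ)) (k₂ : ℤ) \ {0}

/-- There is a direct logarithm from `M` to `ℤ_{k'}`: an injective function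
`f : M → ℤ_{k'}` with `f(xy) = f(x) + f(y)` whenever `x, y, xy ∈ M`, such that
`f(M)` is a direct factor of `ℤ_{k'}`. -/
def HasDirectLogarithm (M : Set ℤ) (k' : ℕ) : Prop :=
  ∃ f : ℤ → ZMod k', Set.InjOn f M ∧
    (∀ x ∈ M, ∀ y ∈ M, x * y ∈ M → f (x * y) = f x + f y) ∧
    ∃ B : Set (ZMod k'), ∀ g : ZMod k',
      ∃! mb : ℤ × ZMod k', mb.1 ∈ M ∧ mb.2 ∈ B ∧ f mb.1 + mb.2 = g

section

open scoped nonZeroDivisors NumberField Topology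
open Filter IsDedekindDomain

section IdealZeta
variable (K : Type*) [Field K] [NumberField K]

theorem NumberField.hasSum_absNorm_rpow_neg {s : ℝ} (hs : 1 < s) :
    Summable (fun I : Ideal (𝓞 K) ↦ (Ideal.absNorm I : ℝ) ^ (-s)) ∧
      (NumberField.dedekindZeta K s) =
        ((∑' I : Ideal (𝓞 K), (Ideal.absNorm I : ℝ) ^ (-s) : ℝ) : ℂ) := by
  set a : ℕ → ℝ := fun n ↦ Nat.card {I : Ideal (𝓞 K) // Ideal.absNorm I = n} with ha
  have hfin : ∀ n : ℕ, Finite {I : Ideal (𝓞 K) // Ideal.absNorm I = n} := fun n ↦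
    Ideal.finite_setOfPred_absNorm_eq n
  have hL : LSeriesSummable (fun n ↦ (a n : ℂ)) (s : ℂ) := by
    refine LSeriesSummable_of_sum_norm_bigO_and_nonneg (r := 1) (f := a) ?_
      (fun _ ↦ Nat.cast_nonneg _) zero_le_one (by simpa using hs)
    have h := ((Ideal.tendsto_norm_le_div_atTop₀ K).comp tendsto_natCast_atTop_atTop).isBigO_one ℝ
    have h2 : (fun n : ℕ ↦ ∑ k ∈ Finset.Icc 1 n, a k) =ᶠ[atTop] fun n : ℕ ↦
      (((fun s : ℝ ↦ (Nat.card {I : (Ideal (𝓞 K))⁰ // Ideal.absNorm (I : Ideal (𝓞 K)) ≤ s} : ℝ) / s) ∘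
        (Nat.cast : ℕ → ℝ)) n) * (n : ℝ) := by
      filter_upwards [eventually_gt_atTop 0] with n hn
      have hn' : (n : ℝ) ≠ 0 := by positivity
      simp only [Function.comp_apply]
      rw [div_mul_cancel₀ _ hn', ha]
      simp only [Nat.cast_le, ← Nat.cast_sum]
      congr 1
      rw [← add_left_inj 1, ← Ideal.card_norm_le_eq_card_norm_le_add_one,
        show Finset.Icc 1 n = Finset.Ioc 0 n from Finset.Icc_succ_left_eq_Ioc _ _,
        show 1 = Nat.card {I : Ideal (𝓞 K) // Ideal.absNorm I = 0} by
          simp [Ideal.absNorm_eq_zero_iff],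
        Finset.sum_Ioc_add_eq_sum_Icc (n.zero_le),
        ← Finset.card_preimage_eq_sum_card_image_eq (fun k _ ↦ Ideal.finite_setOfPred_absNorm_eq k)]
      simp [Set.coe_eq_subtype]
    refine h2.trans_isBigO ?_
    simpa using h.mul (Asymptotics.isBigO_refl (fun n : ℕ ↦ (n : ℝ)) atTop)
  have hterm : ∀ n : ℕ, LSeries.term (fun n ↦ (a n : ℂ)) s n = ((a n * (n : ℝ) ^ (-s) : ℝ) : ℂ) := by
    intro n
    rcases eq_or_ne n 0 with rfl | hn
    · simp [Real.zero_rpow (show -s ≠ 0 by linarith)]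
    · rw [LSeries.term_of_ne_zero hn]
      rw [Complex.ofReal_mul, Complex.ofReal_cpow (by positivity), Complex.ofReal_neg,
        Complex.cpow_neg, div_eq_mul_inv]
      simp
  have hS : Summable (fun n : ℕ ↦ a n * (n : ℝ) ^ (-s)) := by
    have := hL
    unfold LSeriesSummable at this
    rw [funext hterm] at this
    exact_mod_cast this
  let e := Equiv.sigmaFiberEquiv (fun I : Ideal (𝓞 K) ↦ Ideal.absNorm I)
  have hfib : ∀ n : ℕ, HasSum (fun I : {I : Ideal (𝓞 K) // Ideal.absNorm I = n} ↦
      (Ideal.absNorm I.1 : ℝ) ^ (-s)) (a n * (n : ℝ) ^ (-s)) := by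
    intro n
    have := Fintype.ofFinite {I : Ideal (𝓞 K) // Ideal.absNorm I = n}
    have h := hasSum_fintype (fun I : {I : Ideal (𝓞 K) // Ideal.absNorm I = n} ↦
      (Ideal.absNorm I.1 : ℝ) ^ (-s))
    convert h using 1
    rw [Finset.sum_congr rfl (fun I _ ↦ by rw [I.2])]
    simp [ha, Nat.card_eq_fintype_card]
  have hsum : Summable (fun x : (Σ n : ℕ, {I : Ideal (𝓞 K) // Ideal.absNorm I = n}) ↦
      (Ideal.absNorm x.2.1 : ℝ) ^ (-s)) := by
    rw [summable_sigma_of_nonneg (fun _ ↦ by positivity)]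
    exact ⟨fun n ↦ (hfib n).summable, by simpa only [(hfib _).tsum_eq] using hS⟩
  have hsum' : Summable (fun I : Ideal (𝓞 K) ↦ (Ideal.absNorm I : ℝ) ^ (-s)) := by
    rw [← e.summable_iff]; exact hsum
  refine ⟨hsum', ?_⟩
  rw [← e.tsum_eq]
  have : ∑' x, (Ideal.absNorm (e x) : ℝ) ^ (-s) = ∑' n : ℕ, a n * (n : ℝ) ^ (-s) := by
    refine (hsum.tsum_sigma' (fun n ↦ (hfib n).summable)).trans ?_
    exact tsum_congr fun n ↦ (hfib n).tsum_eq
  rw [this, Complex.ofReal_tsum]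
  unfold NumberField.dedekindZeta LSeries
  refine tsum_congr fun n ↦ ?_
  rw [← hterm]
  simp [ha]

end IdealZeta

section PrimeIdealSum
variable (K : Type*) [Field K] [NumberField K]

theorem Ideal.exists_prod_mul_sq (I : Ideal (𝓞 K)) :
    ∃ (t : Finset (HeightOneSpectrum (𝓞 K))) (A : Ideal (𝓞 K)),
      I = (∏ P ∈ t, P.asIdeal) * A ^ 2 := by
  classical
  induction I using UniqueFactorizationMonoid.induction_on_prime with
  | h₁ => exact ⟨∅, 0, by simp⟩
  | h₂ x hx => exact ⟨∅, 1, by simpa [← Ideal.one_eq_top] using hx⟩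
  | h₃ J P hJ hP ih =>
    obtain ⟨t, A, rfl⟩ := ih
    let Q : HeightOneSpectrum (𝓞 K) := ⟨P, Ideal.isPrime_of_prime hP, hP.ne_zero⟩
    by_cases hQ : Q ∈ t
    · refine ⟨t.erase Q, P * A, ?_⟩
      rw [← Finset.mul_prod_erase t _ hQ]
      ring
    · refine ⟨insert Q t, A, ?_⟩
      rw [Finset.prod_insert hQ]
      ring

theorem Ideal.prod_heightOneSpectrum_injective :
    Function.Injective (fun t : Finset (HeightOneSpectrum (𝓞 K)) ↦ ∏ P ∈ t, P.asIdeal) := by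
  have key : ∀ (t : Finset (HeightOneSpectrum (𝓞 K))) (P : HeightOneSpectrum (𝓞 K)),
      P ∈ t ↔ P.asIdeal ∣ ∏ P ∈ t, P.asIdeal := by
    intro t P
    refine ⟨fun h ↦ Finset.dvd_prod_of_mem _ h, fun h ↦ ?_⟩
    obtain ⟨Q, hQ, hd⟩ := (Prime.dvd_finsetProd_iff P.prime _).1 h
    rw [Prime.dvd_prime_iff_associated P.prime Q.prime, associated_iff_eq] at hd
    rwa [HeightOneSpectrum.ext hd]
  intro t u h
  ext P
  rw [key t P, key u P]
  simp only at h
  rw [h]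

theorem Real.exp_sub_sq_le_one_add {x : ℝ} (h0 : 0 ≤ x) :
    Real.exp (x - x ^ 2) ≤ 1 + x := by
  have h := Real.one_sub_inv_le_log_of_pos (show 0 < 1 + x by linarith)
  rw [← Real.le_log_iff_exp_le (by linarith)]
  refine le_trans ?_ h
  have : 1 - (1 + x)⁻¹ = x / (1 + x) := by field_simp; ring
  rw [this, le_div_iff₀ (by linarith)]
  nlinarith [pow_nonneg h0 3]

theorem NumberField.summable_heightOneSpectrum_absNorm_rpow_neg {s : ℝ} (hs : 1 < s) :
    Summable (fun P : HeightOneSpectrum (𝓞 K) ↦ (Ideal.absNorm P.asIdeal : ℝ) ^ (-s)) :=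
  (NumberField.hasSum_absNorm_rpow_neg K hs).1.comp_injective
    (i := fun P : HeightOneSpectrum (𝓞 K) ↦ P.asIdeal) (fun _ _ h ↦ HeightOneSpectrum.ext h)

theorem NumberField.two_le_absNorm (P : HeightOneSpectrum (𝓞 K)) :
    2 ≤ Ideal.absNorm P.asIdeal := by
  have h0 : Ideal.absNorm P.asIdeal ≠ 0 := by
    rw [Ne, Ideal.absNorm_eq_zero_iff]; exact P.ne_bot
  have h1 : Ideal.absNorm P.asIdeal ≠ 1 := by
    rw [Ne, Ideal.absNorm_eq_one_iff]; exact P.isPrime.ne_top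
  omega

theorem tsum_le_tsum_mul_tsum {α β γ : Type*} {f : γ → ℝ} {u : α → ℝ} {v : β → ℝ}
    (hu : Summable u) (hv : Summable v) (hu0 : ∀ a, 0 ≤ u a) (hv0 : ∀ b, 0 ≤ v b)
    (i : γ → α) (j : γ → β) (hij : ∀ c d, i c = i d → j c = j d → c = d)
    (h : ∀ c, f c = u (i c) * v (j c)) : ∑' c, f c ≤ (∑' a, u a) * ∑' b, v b := by
  have hmul : Summable (fun y : α × β ↦ u y.1 * v y.2) := hu.mul_of_nonneg hv hu0 hv0
  rw [hu.tsum_mul_tsum hv hmul]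
  have hinj : Function.Injective (fun c ↦ (i c, j c)) := fun c d hcd ↦
    hij c d (congrArg Prod.fst hcd) (congrArg Prod.snd hcd)
  rw [tsum_congr h]
  exact tsum_comp_le_tsum_of_inj hmul (fun y ↦ mul_nonneg (hu0 _) (hv0 _)) hinj

theorem NumberField.abs_sum_sub_log_zeta_le {s : ℝ} (hs : 1 < s) :
    |(∑' P : HeightOneSpectrum (𝓞 K), (Ideal.absNorm P.asIdeal : ℝ) ^ (-s)) -
      Real.log (∑' I : Ideal (𝓞 K), (Ideal.absNorm I : ℝ) ^ (-s))| ≤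
      ∑' I : Ideal (𝓞 K), (Ideal.absNorm I : ℝ) ^ (-(2 : ℝ)) := by
  classical
  set x : HeightOneSpectrum (𝓞 K) → ℝ := fun P ↦ (Ideal.absNorm P.asIdeal : ℝ) ^ (-s) with hx
  set N : Ideal (𝓞 K) → ℝ := fun I ↦ (Ideal.absNorm I : ℝ) ^ (-s) with hN
  set N2 : Ideal (𝓞 K) → ℝ := fun I ↦ (Ideal.absNorm I : ℝ) ^ (-(2 : ℝ)) with hN2
  have hNs : Summable N := (hasSum_absNorm_rpow_neg K hs).1
  have hN2s : Summable N2 := (hasSum_absNorm_rpow_neg K one_lt_two).1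
  have hN2s' : Summable (fun A ↦ N (A ^ 2)) := by
    refine Summable.of_nonneg_of_le (fun _ ↦ by positivity) (fun A ↦ ?_) hN2s
    simp only [hN, hN2, map_pow]
    push_cast
    rcases eq_or_ne (Ideal.absNorm A) 0 with h0 | h0
    · simp [h0, Real.zero_rpow (show -s ≠ 0 by linarith)]
    · have h1 : (1 : ℝ) ≤ Ideal.absNorm A := by exact_mod_cast Nat.one_le_iff_ne_zero.2 h0
      rw [← Real.rpow_natCast, ← Real.rpow_mul (by positivity)]
      exact Real.rpow_le_rpow_of_exponent_le h1 (by push_cast; linarith)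
  have hxs : Summable x := summable_heightOneSpectrum_absNorm_rpow_neg K hs
  have hx0 : ∀ P, 0 ≤ x P := fun P ↦ by positivity
  have hx1 : ∀ P, x P ≤ 1 := fun P ↦
    Real.rpow_le_one_of_one_le_of_nonpos
      (by exact_mod_cast (two_le_absNorm K P).trans' one_le_two) (by linarith)
  have hprod : ∀ t : Finset (HeightOneSpectrum (𝓞 K)),
      ∏ P ∈ t, x P = N (∏ P ∈ t, P.asIdeal) := by
    intro t
    simp only [hN, hx, map_prod]
    push_cast
    rw [Real.finsetProd_rpow _ _ (fun _ _ ↦ by positivity)]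
  have hNmul : ∀ I J, N (I * J) = N I * N J := by
    intro I J
    simp only [hN, map_mul]
    push_cast
    rw [Real.mul_rpow (by positivity) (by positivity)]
  have hWs : Summable (fun t : Finset (HeightOneSpectrum (𝓞 K)) ↦ ∏ P ∈ t, x P) := by
    simp_rw [hprod]
    exact hNs.comp_injective (Ideal.prod_heightOneSpectrum_injective K)
  set W := ∑' t : Finset (HeightOneSpectrum (𝓞 K)), ∏ P ∈ t, x P with hW
  have hWlim := hasProd_one_add_of_hasSum_prod hWs.hasSum
  have hx2s : Summable (fun P ↦ x P ^ 2) :=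
    Summable.of_nonneg_of_le (fun _ ↦ by positivity)
      (fun P ↦ by nlinarith [hx0 P, hx1 P]) hxs
  have hWle : W ≤ Real.exp (∑' P, x P) := by
    refine hasProd_le_of_prod_le hWlim fun F ↦ ?_
    exact (Real.prod_one_add_le_exp_sum F hx0).trans
      (Real.exp_le_exp.2 (hxs.sum_le_tsum _ fun _ _ ↦ hx0 _))
  have hleW : Real.exp (∑' P, x P - ∑' P, x P ^ 2) ≤ W := by
    rw [← hxs.tsum_sub hx2s]
    refine le_of_tendsto_of_tendsto
      ((Real.continuous_exp.tendsto _).comp (hxs.sub hx2s).hasSum) hWlim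
      (Eventually.of_forall fun F ↦ ?_)
    simp only [Function.comp_apply, Real.exp_sum]
    exact Finset.prod_le_prod (fun _ _ ↦ by positivity)
      (fun P _ ↦ Real.exp_sub_sq_le_one_add (hx0 P))
  have hWZ : W ≤ ∑' I, N I := by
    rw [hW]
    simp_rw [hprod]
    exact tsum_comp_le_tsum_of_inj hNs (fun _ ↦ by positivity)
      (Ideal.prod_heightOneSpectrum_injective K)
  have hN2le : ∑' A, N (A ^ 2) ≤ ∑' A, N2 A := by
    refine hN2s'.tsum_le_tsum (fun A ↦ ?_) hN2s
    simp only [hN, hN2, map_pow]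
    push_cast
    rcases eq_or_ne (Ideal.absNorm A) 0 with h0 | h0
    · simp [h0, Real.zero_rpow (show -s ≠ 0 by linarith)]
    · have h1 : (1 : ℝ) ≤ Ideal.absNorm A := by exact_mod_cast Nat.one_le_iff_ne_zero.2 h0
      rw [← Real.rpow_natCast, ← Real.rpow_mul (by positivity)]
      exact Real.rpow_le_rpow_of_exponent_le h1 (by push_cast; linarith)
  have hx2le : ∑' P, x P ^ 2 ≤ ∑' A, N2 A := by
    refine le_trans ?_ hN2le
    have : ∀ P, x P ^ 2 = N (P.asIdeal ^ 2) := by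
      intro P
      simp only [hN, hx, map_pow]
      push_cast
      rw [← Real.rpow_natCast, ← Real.rpow_mul (by positivity), ← Real.rpow_natCast,
        ← Real.rpow_mul (by positivity), mul_comm]
    simp_rw [this]
    exact tsum_comp_le_tsum_of_inj hN2s' (fun _ ↦ by positivity)
      (i := fun P : HeightOneSpectrum (𝓞 K) ↦ P.asIdeal) (fun _ _ h ↦ HeightOneSpectrum.ext h)
  have hZW : ∑' I, N I ≤ W * ∑' A, N (A ^ 2) := by
    choose t A htA using Ideal.exists_prod_mul_sq K
    refine tsum_le_tsum_mul_tsum (v := fun A ↦ N (A ^ 2)) hWs hN2s'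
      (fun t ↦ Finset.prod_nonneg fun P _ ↦ hx0 P) (fun _ ↦ by positivity) t A ?_ fun I ↦ ?_
    · intro I J h1 h2
      rw [htA I, htA J, h1, h2]
    · rw [hprod, ← hNmul, ← htA I]
  have hWpos : 0 < W := (Real.exp_pos _).trans_le hleW
  have hZpos : 0 < ∑' I, N I := hWpos.trans_le hWZ
  have hlogle : Real.log (∑' A, N (A ^ 2)) ≤ ∑' A, N2 A := by
    have : 0 < ∑' A, N (A ^ 2) := by
      by_contra! h
      nlinarith
    exact ((Real.log_le_sub_one_of_pos this).trans (by linarith))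
  have e1 : Real.log (∑' I, N I) ≤ Real.log W + Real.log (∑' A, N (A ^ 2)) := by
    have : 0 < ∑' A, N (A ^ 2) := by
      by_contra! h
      nlinarith
    rw [← Real.log_mul hWpos.ne' this.ne']
    exact Real.log_le_log hZpos hZW
  have e2 : Real.log W ≤ ∑' P, x P := (Real.log_le_iff_le_exp hWpos).2 hWle
  have e3 : ∑' P, x P - ∑' P, x P ^ 2 ≤ Real.log W := (Real.le_log_iff_exp_le hWpos).2 hleW
  have e4 : Real.log W ≤ Real.log (∑' I, N I) := Real.log_le_log hWpos hWZ
  rw [abs_le]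
  constructor <;> linarith

theorem NumberField.exists_abs_sum_add_log_le :
    ∃ C : ℝ, ∀ᶠ s : ℝ in 𝓝[>] 1,
      |(∑' P : HeightOneSpectrum (𝓞 K), (Ideal.absNorm P.asIdeal : ℝ) ^ (-s)) +
        Real.log (s - 1)| ≤ C := by
  set Z : ℝ → ℝ := fun s ↦ ∑' I : Ideal (𝓞 K), (Ideal.absNorm I : ℝ) ^ (-s) with hZ
  have hlim : Tendsto (fun s : ℝ ↦ (s - 1) * Z s) (𝓝[>] 1) (𝓝 (dedekindZeta_residue K)) := by
    have h := (Complex.continuous_re.tendsto _).comp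
      (tendsto_sub_one_mul_dedekindZeta_nhdsGT K)
    simp only [Complex.ofReal_re] at h
    refine h.congr' ?_
    filter_upwards [self_mem_nhdsWithin] with s hs
    simp only [Function.comp_apply]
    rw [(hasSum_absNorm_rpow_neg K hs).2]
    have : ((s : ℂ) - 1) = ((s - 1 : ℝ) : ℂ) := by push_cast; rfl
    rw [this, ← Complex.ofReal_mul, Complex.ofReal_re]
  have hpos := dedekindZeta_residue_pos K
  have hlog := ((Real.continuousAt_log hpos.ne').tendsto.comp hlim).abs
  refine ⟨|Real.log (dedekindZeta_residue K)| + 1 +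
    ∑' I : Ideal (𝓞 K), (Ideal.absNorm I : ℝ) ^ (-(2 : ℝ)), ?_⟩
  filter_upwards [self_mem_nhdsWithin, hlog.eventually_le_const (lt_add_one _),
    hlim.eventually_const_lt hpos] with s hs h1 h2
  have hs' : 0 < s - 1 := sub_pos.2 hs
  have hZs : 0 < Z s := by
    by_contra! h
    nlinarith
  have h3 := abs_sum_sub_log_zeta_le K hs
  simp only [Function.comp_apply] at h1
  rw [Real.log_mul hs'.ne' hZs.ne'] at h1
  have : (∑' P : HeightOneSpectrum (𝓞 K), (Ideal.absNorm P.asIdeal : ℝ) ^ (-s)) +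
      Real.log (s - 1) = ((∑' P : HeightOneSpectrum (𝓞 K), (Ideal.absNorm P.asIdeal : ℝ) ^ (-s)) -
      Real.log (Z s)) + (Real.log (s - 1) + Real.log (Z s)) := by ring
  rw [this]
  exact (abs_add_le _ _).trans (by linarith)

end PrimeIdealSum

section

open _root_.Ideal

namespace NumberField

variable {K : Type*} [Field K] [NumberField K]

/-- The rational prime below a prime of a number field. -/
noncomputable def primeBelow (Q : HeightOneSpectrum (𝓞 K)) : ℕ :=
  absNorm (Q.asIdeal.under ℤ)

lemma primeBelow_prime (Q : HeightOneSpectrum (𝓞 K)) : (primeBelow Q).Prime :=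
  Nat.absNorm_under_prime Q.asIdeal

instance liesOver_primeBelow (Q : HeightOneSpectrum (𝓞 K)) :
    Q.asIdeal.LiesOver (span {(primeBelow Q : ℤ)}) :=
  Int.liesOver_span_absNorm Q.asIdeal

lemma isMaximal_span_of_prime {p : ℕ} (hp : p.Prime) : (span {(p : ℤ)}).IsMaximal :=
  PrincipalIdealRing.isMaximal_of_irreducible (Nat.prime_iff_prime_int.mp hp).irreducible

lemma absNorm_eq_primeBelow_pow (Q : HeightOneSpectrum (𝓞 K)) :
    absNorm Q.asIdeal = primeBelow Q ^ Q.asIdeal.inertiaDeg ℤ := by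
  have hp := primeBelow_prime Q
  have := isMaximal_span_of_prime hp
  have : Q.asIdeal.IsMaximal := Q.isMaximal
  rw [absNorm_eq_pow_inertiaDeg' Q.asIdeal hp,
    inertiaDeg'_eq_inertiaDeg (span {(primeBelow Q : ℤ)})]

lemma card_fiber_primeBelow_mul [IsGalois ℚ K] (Q : HeightOneSpectrum (𝓞 K)) :
    Nat.card {Q' : HeightOneSpectrum (𝓞 K) // primeBelow Q' = primeBelow Q} *
      Nat.card (Q.asIdeal.inertia Gal(K/ℚ)) * Q.asIdeal.inertiaDeg ℤ = Module.finrank ℚ K := by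
  have hp := primeBelow_prime Q
  have := isMaximal_span_of_prime hp
  have hfin : Finite (ℤ ⧸ span {(primeBelow Q : ℤ)}) :=
    Ideal.finiteQuotientOfFreeOfNeBot _ (by simpa using hp.ne_zero)
  have : Finite (span {(primeBelow Q : ℤ)}).ResidueField :=
    Finite.of_surjective _ (Ideal.bijective_algebraMap_quotient_residueField _).2
  rw [← IsGalois.card_aut_eq_finrank, ← ncard_primesOver_mul_card_inertia_mul_finrank
    (span {(primeBelow Q : ℤ)}) Q.asIdeal (G := Gal(K/ℚ))]
  congr 2
  rw [← Nat.card_coe_set_eq]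
  refine Nat.card_congr (Equiv.ofBijective (fun Q' ↦ ⟨Q'.1.asIdeal, Q'.1.isPrime, ?_⟩) ⟨?_, ?_⟩)
  · have h := liesOver_primeBelow Q'.1
    rwa [Q'.2] at h
  · intro Q₁ Q₂ h
    simpa [Subtype.ext_iff, HeightOneSpectrum.ext_iff] using h
  · rintro ⟨I, hI, hl⟩
    have h : absNorm (I.under ℤ) = primeBelow Q := by
      rw [← hl.over]; simp
    refine ⟨⟨⟨I, hI, ?_⟩, h⟩, rfl⟩
    rintro rfl
    rw [Ideal.under_bot] at h
    simp at h
    exact hp.ne_zero h.symm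

variable (K) in
lemma finite_setOf_nontrivial_inertia [IsGalois ℚ K] :
    {p : ℕ | ∃ Q : HeightOneSpectrum (𝓞 K), primeBelow Q = p ∧
      Q.asIdeal.inertia Gal(K/ℚ) ≠ ⊥}.Finite := by
  have hx : ∀ g : Gal(K/ℚ), ∃ x : 𝓞 K, g ≠ 1 → g • x - x ≠ 0 := by
    intro g
    by_contra! h
    have : FaithfulSMul Gal(K/ℚ) (𝓞 K) := IsGaloisGroup.faithful ℤ
    refine (h 0).1 (FaithfulSMul.eq_of_smul_eq_smul (α := 𝓞 K) fun x ↦ ?_)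
    rw [one_smul]
    exact sub_eq_zero.mp (h x).2
  choose x hx using hx
  classical
  set D : 𝓞 K := ∏ g ∈ Finset.univ.filter (fun g : Gal(K/ℚ) ↦ g ≠ 1), (g • x g - x g)
  have hD : D ≠ 0 := Finset.prod_ne_zero_iff.mpr fun g hg ↦ hx g (Finset.mem_filter.mp hg).2
  have hn : absNorm (span {D}) ≠ 0 := by simpa [absNorm_eq_zero_iff] using hD
  refine (Nat.divisors (absNorm (span {D}))).finite_toSet.subset ?_
  rintro _ ⟨Q, rfl, hQ⟩
  obtain ⟨⟨g, hg⟩, hg1⟩ := Subgroup.ne_bot_iff_exists_ne_one.mp hQ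
  have hmem : D ∈ Q.asIdeal :=
    Ideal.mem_of_dvd _ (Finset.dvd_prod_of_mem _ (a := g)
      (by simpa [Subtype.ext_iff] using hg1)) (hg (x g))
  simp only [Finset.mem_coe, Nat.mem_divisors]
  exact ⟨(Int.absNorm_under_dvd_absNorm Q.asIdeal).trans (absNorm_dvd_absNorm_of_le
    ((span_singleton_le_iff_mem _).mpr hmem)), hn⟩

variable (K) in
/-- The rational primes below a prime of residue degree one. -/
def degreeOnePrimes : Set ℕ :=
  {p | ∃ Q : HeightOneSpectrum (𝓞 K), primeBelow Q = p ∧ absNorm Q.asIdeal = p}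

lemma prime_of_mem_degreeOnePrimes {p : ℕ} (hp : p ∈ degreeOnePrimes K) : p.Prime := by
  obtain ⟨Q, rfl, -⟩ := hp
  exact primeBelow_prime Q

lemma inertiaDeg_ne_zero [IsGalois ℚ K] (Q : HeightOneSpectrum (𝓞 K)) :
    Q.asIdeal.inertiaDeg ℤ ≠ 0 := by
  intro h
  have := card_fiber_primeBelow_mul Q
  rw [h, mul_zero] at this
  exact Module.finrank_pos.ne this

open Classical in
lemma abs_sum_fiber_sub_le [IsGalois ℚ K] (p : ℕ) {s : ℝ} (hs : 1 < s) :
    |(∑' Q : {Q : HeightOneSpectrum (𝓞 K) // primeBelow Q = p},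
        (absNorm Q.1.asIdeal : ℝ) ^ (-s)) -
      Module.finrank ℚ K * (degreeOnePrimes K).indicator (fun p ↦ (p : ℝ) ^ (-s)) p| ≤
    Module.finrank ℚ K * ((p : ℝ) ^ 2)⁻¹ + {p : ℕ | ∃ Q : HeightOneSpectrum (𝓞 K),
      primeBelow Q = p ∧ Q.asIdeal.inertia Gal(K/ℚ) ≠ ⊥}.indicator
        (fun _ ↦ (Module.finrank ℚ K : ℝ)) p := by
  set d := Module.finrank ℚ K
  have hd : 0 < d := Module.finrank_pos
  set B := {p : ℕ | ∃ Q : HeightOneSpectrum (𝓞 K),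
      primeBelow Q = p ∧ Q.asIdeal.inertia Gal(K/ℚ) ≠ ⊥}
  have hB : 0 ≤ B.indicator (fun _ ↦ (d : ℝ)) p := Set.indicator_nonneg (by simp) p
  by_cases hne : ∃ Q : HeightOneSpectrum (𝓞 K), primeBelow Q = p
  swap
  · have : IsEmpty {Q : HeightOneSpectrum (𝓞 K) // primeBelow Q = p} :=
      ⟨fun Q ↦ hne ⟨Q.1, Q.2⟩⟩
    have hp : p ∉ degreeOnePrimes K := fun ⟨Q, h, _⟩ ↦ hne ⟨Q, h⟩
    rw [tsum_empty, Set.indicator_of_notMem hp]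
    simp only [mul_zero, sub_zero, abs_zero]
    positivity
  obtain ⟨Q₀, hQ₀⟩ := hne
  have hp : p.Prime := hQ₀ ▸ primeBelow_prime Q₀
  have hp1 : (1 : ℝ) < p := by exact_mod_cast hp.one_lt
  set F := {Q : HeightOneSpectrum (𝓞 K) // primeBelow Q = p}
  have hcard (Q : F) : Nat.card F * Nat.card (Q.1.asIdeal.inertia Gal(K/ℚ)) *
      Q.1.asIdeal.inertiaDeg ℤ = d := by
    have := card_fiber_primeBelow_mul Q.1
    rwa [Q.2] at this
  have hF : Finite F := by
    refine Nat.finite_of_card_ne_zero fun h ↦ ?_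
    have := hcard ⟨Q₀, hQ₀⟩
    rw [h] at this
    omega
  have hFd : Nat.card F ≤ d := by
    rw [← hcard ⟨Q₀, hQ₀⟩, mul_assoc]
    exact Nat.le_mul_of_pos_right _ (Nat.mul_pos Nat.card_pos
      (Nat.pos_of_ne_zero (inertiaDeg_ne_zero _)))
  have hterm (Q : F) : absNorm Q.1.asIdeal = p ^ Q.1.asIdeal.inertiaDeg ℤ := by
    rw [absNorm_eq_primeBelow_pow, Q.2]
  have := Fintype.ofFinite F
  rw [Nat.card_eq_fintype_card] at hFd
  rw [tsum_fintype]
  have hsum0 : 0 ≤ ∑ Q : F, (absNorm Q.1.asIdeal : ℝ) ^ (-s) :=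
    Finset.sum_nonneg fun _ _ ↦ by positivity
  have hbound (c : ℝ) (h : ∀ Q : F, (absNorm Q.1.asIdeal : ℝ) ^ (-s) ≤ c) (hc : 0 ≤ c) :
      ∑ Q : F, (absNorm Q.1.asIdeal : ℝ) ^ (-s) ≤ d * c :=
    (Finset.sum_le_card_nsmul _ _ c fun Q _ ↦ h Q).trans (by
      rw [nsmul_eq_mul, Finset.card_univ]
      gcongr)
  by_cases hSpl : p ∈ degreeOnePrimes K
  swap
  · rw [Set.indicator_of_notMem hSpl, mul_zero, sub_zero, abs_of_nonneg hsum0]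
    refine (hbound ((p : ℝ) ^ 2)⁻¹ (fun Q ↦ ?_) (by positivity)).trans (by linarith)
    have hf : 2 ≤ Q.1.asIdeal.inertiaDeg ℤ := by
      have h0 := inertiaDeg_ne_zero Q.1
      have h1 : Q.1.asIdeal.inertiaDeg ℤ ≠ 1 := fun h ↦
        hSpl ⟨Q.1, Q.2, by rw [hterm, h, pow_one]⟩
      omega
    rw [hterm, Real.rpow_neg (by positivity)]
    refine inv_anti₀ (by positivity) ?_
    calc (p : ℝ) ^ 2 ≤ (p : ℝ) ^ Q.1.asIdeal.inertiaDeg ℤ := pow_le_pow_right₀ hp1.le hf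
      _ ≤ _ := by
        push_cast
        exact Real.self_le_rpow_of_one_le (one_le_pow₀ hp1.le) hs.le
  rw [Set.indicator_of_mem hSpl]
  have hps : (p : ℝ) ^ (-s) ≤ 1 := Real.rpow_le_one_of_one_le_of_nonpos hp1.le (by linarith)
  have hps0 : 0 ≤ (p : ℝ) ^ (-s) := by positivity
  have hsq : 0 ≤ (d : ℝ) * ((p : ℝ) ^ 2)⁻¹ := by positivity
  by_cases hpB : p ∈ B
  · rw [Set.indicator_of_mem hpB]
    have := hbound ((p : ℝ) ^ (-s)) (fun Q ↦ by
      rw [hterm, Real.rpow_neg (by positivity), Real.rpow_neg (by positivity)]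
      refine inv_anti₀ (by positivity) ?_
      refine Real.rpow_le_rpow (by positivity) ?_ (by linarith)
      push_cast
      exact le_self_pow₀ hp1.le (inertiaDeg_ne_zero Q.1)) hps0
    have hd0 : (0 : ℝ) ≤ d := by positivity
    have := mul_le_mul_of_nonneg_left hps hd0
    rw [abs_le]
    constructor <;> linarith
  · obtain ⟨Q₁, hQ₁, hn⟩ := hSpl
    have hin (Q : F) : Nat.card F * Q.1.asIdeal.inertiaDeg ℤ = d := by
      have h := hcard Q
      have : Q.1.asIdeal.inertia Gal(K/ℚ) = ⊥ := by
        by_contra h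
        exact hpB ⟨Q.1, Q.2, h⟩
      rwa [this, Subgroup.card_bot, mul_one] at h
    have hf₁ : Q₁.asIdeal.inertiaDeg ℤ = 1 := by
      have := hterm ⟨Q₁, hQ₁⟩
      rw [hn] at this
      exact Nat.pow_right_injective hp.two_le (this.symm.trans (pow_one p).symm)
    have hFd' : Nat.card F = d := by
      have := hin ⟨Q₁, hQ₁⟩
      rwa [hf₁, mul_one] at this
    have hN (Q : F) : absNorm Q.1.asIdeal = p := by
      have := hin Q
      rw [hFd'] at this
      rw [hterm, (Nat.mul_eq_left hd.ne').mp this, pow_one]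
    simp_rw [hN]
    rw [Finset.sum_const, Finset.card_univ, ← Nat.card_eq_fintype_card, hFd', nsmul_eq_mul,
      sub_self, abs_zero]
    linarith

variable (K) in
theorem exists_abs_sum_sub_le [IsGalois ℚ K] :
    ∃ C : ℝ, ∀ s : ℝ, 1 < s →
      |(∑' Q : HeightOneSpectrum (𝓞 K), (absNorm Q.asIdeal : ℝ) ^ (-s)) - Module.finrank ℚ K *
        ∑' p, (degreeOnePrimes K).indicator (fun p : ℕ ↦ (p : ℝ) ^ (-s)) p| ≤ C := by
  classical
  set d := Module.finrank ℚ K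
  set B := {p : ℕ | ∃ Q : HeightOneSpectrum (𝓞 K),
      primeBelow Q = p ∧ Q.asIdeal.inertia Gal(K/ℚ) ≠ ⊥} with hBdef
  have hB : B.Finite := finite_setOf_nontrivial_inertia K
  have h1 : Summable fun p : ℕ ↦ (d : ℝ) * ((p : ℝ) ^ 2)⁻¹ :=
    (Real.summable_nat_pow_inv.mpr one_lt_two).mul_left _
  have h2 : Summable (B.indicator (fun _ ↦ (d : ℝ))) :=
    summable_of_hasFiniteSupport (hB.subset Set.support_indicator_subset)
  refine ⟨∑' p : ℕ, ((d : ℝ) * ((p : ℝ) ^ 2)⁻¹ + B.indicator (fun _ ↦ (d : ℝ)) p),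
    fun s hs ↦ ?_⟩
  have hQ := summable_heightOneSpectrum_absNorm_rpow_neg K hs
  have hp : Summable ((degreeOnePrimes K).indicator fun p : ℕ ↦ (p : ℝ) ^ (-s)) :=
    (Real.summable_nat_rpow.mpr (by linarith)).indicator _
  have hfib : HasSum (fun p : ℕ ↦ ∑' Q : {Q : HeightOneSpectrum (𝓞 K) // primeBelow Q = p},
      (absNorm Q.1.asIdeal : ℝ) ^ (-s))
      (∑' Q : HeightOneSpectrum (𝓞 K), (absNorm Q.asIdeal : ℝ) ^ (-s)) :=
    ((Equiv.sigmaFiberEquiv primeBelow).hasSum_iff.mpr hQ.hasSum).sigma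
      fun p ↦ ((Equiv.sigmaFiberEquiv primeBelow).summable_iff.mpr hQ |>.sigma_factor p).hasSum
  have hdiff := hfib.sub (hp.hasSum.mul_left (d : ℝ))
  rw [← Real.norm_eq_abs, ← hdiff.tsum_eq]
  exact tsum_of_norm_bounded (h1.add h2).hasSum fun p ↦ abs_sum_fiber_sub_le (K := K) p hs

variable (K) in
/-- The logarithmic singularity of the sum over the primes of residue degree one. -/
theorem exists_abs_degreeOnePrimes_add_log_le [IsGalois ℚ K] :
    ∃ C : ℝ, ∀ᶠ s in 𝓝[>] (1 : ℝ), |Module.finrank ℚ K *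
        (∑' p, (degreeOnePrimes K).indicator (fun p : ℕ ↦ (p : ℝ) ^ (-s)) p) +
          Real.log (s - 1)| ≤ C := by
  obtain ⟨C₁, h₁⟩ := exists_abs_sum_sub_le K
  obtain ⟨C₂, h₂⟩ := exists_abs_sum_add_log_le K
  refine ⟨C₁ + C₂, ?_⟩
  filter_upwards [h₂, self_mem_nhdsWithin] with s hs hs1
  have := h₁ s hs1
  rw [abs_le] at *
  constructor <;> linarith

end NumberField

end

section

open _root_.Ideal

namespace NumberField

section

variable {K : Type*} [Field K] [NumberField K]

lemma absNorm_eq_primeBelow_iff [IsGalois ℚ K] (Q : HeightOneSpectrum (𝓞 K)) :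
    absNorm Q.asIdeal = primeBelow Q ↔ ∀ x : 𝓞 K, x ^ primeBelow Q - x ∈ Q.asIdeal := by
  have hp := primeBelow_prime Q
  have : Q.asIdeal.IsMaximal := Q.isMaximal
  let := Ideal.Quotient.field Q.asIdeal
  have : Finite (𝓞 K ⧸ Q.asIdeal) := Ideal.finiteQuotientOfFreeOfNeBot _ Q.ne_bot
  have := Fintype.ofFinite (𝓞 K ⧸ Q.asIdeal)
  have hcard : absNorm Q.asIdeal = Fintype.card (𝓞 K ⧸ Q.asIdeal) := by
    rw [absNorm_apply, Submodule.cardQuot_apply, Nat.card_eq_fintype_card]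
  have hx (x : 𝓞 K) : x ^ primeBelow Q - x ∈ Q.asIdeal ↔
      (Ideal.Quotient.mk Q.asIdeal x) ^ primeBelow Q = Ideal.Quotient.mk Q.asIdeal x := by
    rw [← Ideal.Quotient.eq_zero_iff_mem, map_sub, map_pow, sub_eq_zero]
  simp_rw [hx]
  rw [← (Ideal.Quotient.mk_surjective (I := Q.asIdeal)).forall
    (p := fun x ↦ x ^ primeBelow Q = x), hcard]
  constructor
  · intro h x
    rw [← h, FiniteField.pow_card]
  · intro h
    have h1 : Fintype.card (𝓞 K ⧸ Q.asIdeal) - 1 ∣ primeBelow Q - 1 := by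
      rw [← FiniteField.forall_pow_eq_one_iff]
      intro x
      have := h x
      rw [← Nat.sub_add_cancel hp.one_le, pow_succ] at this
      ext
      exact mul_right_cancel₀ x.ne_zero (by simpa using this)
    have h2 := Nat.le_of_dvd (Nat.sub_pos_of_lt hp.one_lt) h1
    have h3 : primeBelow Q ≤ absNorm Q.asIdeal := by
      rw [absNorm_eq_primeBelow_pow]
      exact Nat.le_self_pow (inertiaDeg_ne_zero Q) _
    have := hp.one_lt
    omega

lemma mem_degreeOnePrimes_iff_absNorm [IsGalois ℚ K] (Q : HeightOneSpectrum (𝓞 K))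
    (hQ : primeBelow Q ∉ {p : ℕ | ∃ Q : HeightOneSpectrum (𝓞 K),
      primeBelow Q = p ∧ Q.asIdeal.inertia Gal(K/ℚ) ≠ ⊥}) :
    primeBelow Q ∈ degreeOnePrimes K ↔ absNorm Q.asIdeal = primeBelow Q := by
  refine ⟨?_, fun h ↦ ⟨Q, rfl, h⟩⟩
  rintro ⟨Q', hQ', hn⟩
  have hin (R : HeightOneSpectrum (𝓞 K)) (hR : primeBelow R = primeBelow Q) :
      R.asIdeal.inertia Gal(K/ℚ) = ⊥ := by
    by_contra h
    exact hQ ⟨R, hR, h⟩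
  have h1 := card_fiber_primeBelow_mul Q
  have h2 := card_fiber_primeBelow_mul Q'
  rw [hin Q rfl, Subgroup.card_bot, mul_one] at h1
  rw [hin Q' hQ', Subgroup.card_bot, mul_one, hQ', ← h1] at h2
  have h0 : Nat.card {R : HeightOneSpectrum (𝓞 K) // primeBelow R = primeBelow Q} ≠ 0 := by
    intro h
    rw [h, zero_mul] at h1
    exact Module.finrank_pos.ne h1
  rw [absNorm_eq_primeBelow_pow, ← Nat.eq_of_mul_eq_mul_left (Nat.pos_of_ne_zero h0) h2,
    ← hQ', ← absNorm_eq_primeBelow_pow, hn, hQ']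

end

variable {L : Type*} [Field L] [NumberField L]

/-- `φ` is a Frobenius automorphism at the prime `P`. -/
def IsFrob (φ : Gal(L/ℚ)) (P : HeightOneSpectrum (𝓞 L)) : Prop :=
  ∀ x : 𝓞 L, φ • x - x ^ primeBelow P ∈ P.asIdeal

lemma exists_isFrob [IsGalois ℚ L] (P : HeightOneSpectrum (𝓞 L)) : ∃ φ, IsFrob φ P := by
  have : Finite (𝓞 L ⧸ P.asIdeal) := Ideal.finiteQuotientOfFreeOfNeBot _ P.ne_bot
  obtain ⟨φ, hφ⟩ := IsArithFrobAt.exists_of_isInvariant ℤ Gal(L/ℚ) P.asIdeal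
  refine ⟨φ, fun x ↦ ?_⟩
  have := hφ x
  rwa [← Submodule.cardQuot_apply, ← absNorm_apply] at this

lemma exists_primeBelow_eq {p : ℕ} (hp : p.Prime) :
    ∃ P : HeightOneSpectrum (𝓞 L), primeBelow P = p := by
  have := isMaximal_span_of_prime hp
  obtain ⟨P, hP, hPl⟩ :=
    exists_maximal_ideal_liesOver_of_isIntegral (S := 𝓞 L) (span {(p : ℤ)})
  have h : absNorm (P.under ℤ) = p := by
    rw [← hPl.over]; simp
  refine ⟨⟨P, hP.isPrime, ?_⟩, h⟩
  rintro rfl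
  rw [Ideal.under_bot] at h
  simp at h
  exact hp.ne_zero h.symm

lemma mem_degreeOnePrimes_iff_mem_fixingSubgroup [IsGalois ℚ L] (K : IntermediateField ℚ L)
    [IsGalois ℚ K] {P : HeightOneSpectrum (𝓞 L)} {φ : Gal(L/ℚ)} (hφ : IsFrob φ P)
    (hP : primeBelow P ∉ {p : ℕ | ∃ Q : HeightOneSpectrum (𝓞 K),
      primeBelow Q = p ∧ Q.asIdeal.inertia Gal(K/ℚ) ≠ ⊥}) :
    primeBelow P ∈ degreeOnePrimes K ↔ φ ∈ K.fixingSubgroup := by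
  let Q : HeightOneSpectrum (𝓞 K) :=
    ⟨P.asIdeal.under (𝓞 K), inferInstance, Ideal.IsIntegral.comap_ne_bot _ P.ne_bot⟩
  have hQP : primeBelow Q = primeBelow P := by
    simp only [primeBelow, Q]
    rw [Ideal.under_under]
  have hmem (x : 𝓞 K) : x ∈ Q.asIdeal ↔ algebraMap (𝓞 K) (𝓞 L) x ∈ P.asIdeal := Iff.rfl
  rw [← hQP] at hP ⊢
  rw [mem_degreeOnePrimes_iff_absNorm Q hP, absNorm_eq_primeBelow_iff]
  set ψ : Gal(K/ℚ) := φ.restrictNormal K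
  have hψ (x : 𝓞 K) : algebraMap (𝓞 K) (𝓞 L) (ψ • x) = φ • algebraMap (𝓞 K) (𝓞 L) x := by
    ext
    exact AlgEquiv.restrictNormal_commutes φ K x
  have hin : Q.asIdeal.inertia Gal(K/ℚ) = ⊥ := by
    by_contra h
    exact hP ⟨Q, rfl, h⟩
  have hψ1 : φ ∈ K.fixingSubgroup ↔ ψ = 1 := by
    rw [IntermediateField.mem_fixingSubgroup_iff, AlgEquiv.ext_iff]
    constructor
    · intro h x
      refine (algebraMap K L).injective ((AlgEquiv.restrictNormal_commutes φ K x).trans ?_)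
      exact h x x.2
    · intro h x hx
      have := AlgEquiv.restrictNormal_commutes φ K ⟨x, hx⟩
      rw [show φ.restrictNormal K ⟨x, hx⟩ = ⟨x, hx⟩ from h _] at this
      exact this.symm
  rw [hψ1, ← Subgroup.mem_bot, ← hin]
  change _ ↔ ∀ x : 𝓞 K, ψ • x - x ∈ Q.asIdeal
  refine forall_congr' fun x ↦ ?_
  have h1 : ψ • x - x ^ primeBelow Q ∈ Q.asIdeal := by
    rw [hmem, map_sub, hψ, map_pow, hQP]
    exact hφ _
  constructor
  · intro h
    simpa using add_mem h1 h
  · intro h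
    simpa using sub_mem h h1

end NumberField

section

open ArithmeticFunction

open Classical in
lemma sum_moebius_mem_zpowers {G : Type*} [Group G] [Finite G] (σ φ : G) :
    (∑ d ∈ (orderOf σ).divisors, if φ ∈ Subgroup.zpowers (σ ^ d) then moebius d else 0) =
      if Subgroup.zpowers φ = Subgroup.zpowers σ then 1 else 0 := by
  have hc : 0 < orderOf σ := orderOf_pos σ
  by_cases hφ : φ ∈ Subgroup.zpowers σ
  swap
  · rw [if_neg fun h : Subgroup.zpowers φ = Subgroup.zpowers σ ↦
      hφ (h ▸ Subgroup.mem_zpowers φ)]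
    refine Finset.sum_eq_zero fun d _ ↦ if_neg fun h ↦ hφ ?_
    exact (Subgroup.zpowers_le.mpr (pow_mem (Subgroup.mem_zpowers σ) d)) h
  obtain ⟨j, rfl⟩ := mem_powers_iff_mem_zpowers.mpr hφ
  have hmem {d : ℕ} (hd : d ∈ (orderOf σ).divisors) :
      (fun x ↦ σ ^ x) j ∈ Subgroup.zpowers (σ ^ d) ↔ d ∣ (orderOf σ).gcd j := by
    have hd := Nat.dvd_of_mem_divisors hd
    rw [Nat.dvd_gcd_iff, and_iff_right hd, ← mem_powers_iff_mem_zpowers]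
    constructor
    · rintro ⟨i, hi⟩
      simp only [← pow_mul] at hi
      have := (pow_eq_pow_iff_modEq.mp hi).of_dvd hd
      exact (Nat.modEq_zero_iff_dvd.mp (this.symm.trans (Nat.modEq_zero_iff_dvd.mpr ⟨i, rfl⟩)))
    · rintro ⟨i, rfl⟩
      exact ⟨i, (pow_mul _ _ _).symm⟩
  have hgen : Subgroup.zpowers ((fun x ↦ σ ^ x) j) = Subgroup.zpowers σ ↔
      (orderOf σ).gcd j = 1 := by
    constructor
    · intro h
      have := congrArg (fun H : Subgroup G ↦ Nat.card H) h
      simp only [Nat.card_zpowers, orderOf_pow] at this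
      have hg := Nat.div_mul_cancel (Nat.gcd_dvd_left (orderOf σ) j)
      rw [this] at hg
      exact (Nat.mul_eq_left hc.ne').mp hg
    · intro h
      refine Subgroup.eq_of_le_of_card_ge (Subgroup.zpowers_le.mpr hφ) ?_
      simp [Nat.card_zpowers, orderOf_pow, h]
  rw [Finset.sum_congr rfl fun d hd ↦ if_congr (hmem hd) rfl rfl, ← Finset.sum_filter,
    if_congr hgen rfl rfl]
  have hfil : (orderOf σ).divisors.filter (· ∣ (orderOf σ).gcd j) =
      ((orderOf σ).gcd j).divisors := by
    ext d
    simp only [Finset.mem_filter, Nat.mem_divisors]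
    constructor
    · rintro ⟨-, h⟩
      exact ⟨h, (Nat.gcd_pos_of_pos_left _ hc).ne'⟩
    · rintro ⟨h, -⟩
      exact ⟨⟨h.trans (Nat.gcd_dvd_left _ _), hc.ne'⟩, h⟩
  rw [hfil, ← coe_mul_zeta_apply, moebius_mul_coe_zeta, one_apply]

lemma sum_moebius_mul_div_pos {c : ℕ} (hc : 0 < c) :
    (0 : ℝ) < ∑ d ∈ c.divisors, (moebius d : ℝ) * ((c / d : ℕ) : ℝ) := by
  have h : (∑ d ∈ c.divisors, moebius d * ((c / d : ℕ) : ℤ)) = (Nat.totient c : ℤ) := by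
    have := (sum_eq_iff_sum_mul_moebius_eq (f := fun n ↦ (Nat.totient n : ℤ))
      (g := fun n ↦ (n : ℤ))).mp (fun n _ ↦ by exact_mod_cast Nat.sum_totient n) c hc
    rw [← this]
    simpa using (Nat.sum_divisorsAntidiagonal (fun x y ↦ moebius x * (y : ℤ))).symm
  have h' := Nat.totient_pos.mpr hc
  have : (∑ d ∈ c.divisors, (moebius d : ℝ) * ((c / d : ℕ) : ℝ)) = (Nat.totient c : ℝ) := by
    have := congrArg (Int.cast : ℤ → ℝ) h
    push_cast at this ⊢
    exact this
  rw [this]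
  exact_mod_cast h'

end

end

section

open _root_.Ideal

lemma Subgroup.normal_zpowers_pow {G : Type*} [Group G] (σ : G) [h : (Subgroup.zpowers σ).Normal]
    (d : ℕ) : (Subgroup.zpowers (σ ^ d)).Normal := by
  refine ⟨fun x hx g ↦ ?_⟩
  obtain ⟨i, rfl⟩ := Subgroup.mem_zpowers_iff.mp hx
  obtain ⟨a, ha⟩ := Subgroup.mem_zpowers_iff.mp
    (h.conj_mem σ (Subgroup.mem_zpowers σ) g)
  refine Subgroup.mem_zpowers_iff.mpr ⟨a * i, ?_⟩
  rw [← conj_zpow, ← conj_pow, ← ha, ← zpow_natCast, ← zpow_natCast, ← zpow_mul, ← zpow_mul,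
    ← zpow_mul]
  ring_nf

namespace NumberField

variable {L : Type*} [Field L] [NumberField L]

/-- A weak form of the Frobenius density theorem, for an automorphism generating a normal
subgroup. -/
theorem exists_isFrob_zpowers_eq [IsGalois ℚ L] (σ : Gal(L/ℚ)) [(Subgroup.zpowers σ).Normal]
    (n : ℕ) : ∃ P : HeightOneSpectrum (𝓞 L), n < primeBelow P ∧
      ∃ φ : Gal(L/ℚ), IsFrob φ P ∧ Subgroup.zpowers φ = Subgroup.zpowers σ := by
  classical
  by_contra! H
  have hc : 0 < orderOf σ := orderOf_pos σ
  set c := orderOf σ with hcdef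
  set K : ℕ → IntermediateField ℚ L :=
    fun d ↦ IntermediateField.fixedField (Subgroup.zpowers (σ ^ d)) with hK
  have hGal (d : ℕ) : IsGalois ℚ (K d) := by
    have := Subgroup.normal_zpowers_pow σ d
    exact IsGalois.of_fixedField_normal_subgroup _
  set B : ℕ → Set ℕ := fun d ↦ {p : ℕ | ∃ Q : HeightOneSpectrum (𝓞 (K d)),
      primeBelow Q = p ∧ Q.asIdeal.inertia Gal(K d/ℚ) ≠ ⊥} with hB
  have hBfin (d : ℕ) : (B d).Finite := finite_setOf_nontrivial_inertia (K d)
  have hEfin : ((⋃ d ∈ c.divisors, B d) ∪ Set.Iic n).Finite :=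
    (Set.Finite.biUnion (Finset.finite_toSet _) fun d _ ↦ hBfin d).union (Set.finite_Iic n)
  set E := hEfin.toFinset with hE
  set S : ℕ → ℝ → ℝ := fun d s ↦
    ∑' p, (degreeOnePrimes (K d)).indicator (fun p : ℕ ↦ (p : ℝ) ^ (-s)) p with hS
  set w : ℕ → ℝ := fun p ↦ ∑ d ∈ c.divisors, (ArithmeticFunction.moebius d : ℝ) *
    (degreeOnePrimes (K d)).indicator (fun _ ↦ 1) p with hw
  have hw0 (p : ℕ) (hp : p ∉ E) : w p = 0 := by
    simp only [hE, Set.Finite.mem_toFinset, Set.mem_union, Set.mem_iUnion, Set.mem_Iic, not_or,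
      not_exists, not_le] at hp
    by_cases hpp : p.Prime
    swap
    · refine Finset.sum_eq_zero fun d _ ↦ ?_
      rw [Set.indicator_of_notMem fun h ↦ hpp (prime_of_mem_degreeOnePrimes h), mul_zero]
    obtain ⟨P, rfl⟩ := exists_primeBelow_eq (L := L) hpp
    obtain ⟨φ, hφ⟩ := exists_isFrob P
    have key := sum_moebius_mem_zpowers σ φ
    rw [if_neg (H P hp.2 φ hφ)] at key
    have := congrArg (Int.cast : ℤ → ℝ) key
    push_cast at this
    rw [← this]
    refine Finset.sum_congr rfl fun d hd ↦ ?_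
    rw [Set.indicator_apply, if_congr
      (mem_degreeOnePrimes_iff_mem_fixingSubgroup (K d) hφ (hp.1 d hd)) rfl rfl,
      IntermediateField.fixingSubgroup_fixedField]
    simp
  have hsummable (d : ℕ) {s : ℝ} (hs : 1 < s) :
      Summable ((degreeOnePrimes (K d)).indicator fun p : ℕ ↦ (p : ℝ) ^ (-s)) :=
    (Real.summable_nat_rpow.mpr (by linarith)).indicator _
  have hT {s : ℝ} (hs : 1 < s) :
      ∑ d ∈ c.divisors, (ArithmeticFunction.moebius d : ℝ) * S d s ≤ ∑ p ∈ E, |w p| := by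
    have h1 : HasSum (fun p : ℕ ↦ w p * (p : ℝ) ^ (-s))
        (∑ d ∈ c.divisors, (ArithmeticFunction.moebius d : ℝ) * S d s) := by
      have := hasSum_sum (s := c.divisors) fun d _ ↦
        (hsummable d hs).hasSum.mul_left (ArithmeticFunction.moebius d : ℝ)
      convert! this using 2 with p
      rw [hw, Finset.sum_mul]
      refine Finset.sum_congr rfl fun d _ ↦ ?_
      by_cases h : p ∈ degreeOnePrimes (K d) <;> simp [h]
    have h2 : HasSum (fun p : ℕ ↦ w p * (p : ℝ) ^ (-s)) (∑ p ∈ E, w p * (p : ℝ) ^ (-s)) :=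
      hasSum_sum_of_ne_finset_zero fun p hp ↦ by rw [hw0 p hp, zero_mul]
    rw [h1.unique h2]
    refine Finset.sum_le_sum fun p _ ↦ ?_
    have hp1 : (p : ℝ) ^ (-s) ≤ 1 := by
      rcases Nat.eq_zero_or_pos p with rfl | hp
      · rw [Nat.cast_zero, Real.zero_rpow (by linarith)]
        exact zero_le_one
      · exact Real.rpow_le_one_of_one_le_of_nonpos (by exact_mod_cast hp) (by linarith)
    have hp0 : 0 ≤ (p : ℝ) ^ (-s) := by positivity
    calc w p * (p : ℝ) ^ (-s) ≤ |w p| * (p : ℝ) ^ (-s) := by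
          gcongr; exact le_abs_self _
      _ ≤ |w p| * 1 := by gcongr
      _ = _ := mul_one _
  set g : ℕ := Module.finrank ℚ L
  have hdeg {d : ℕ} (hd : d ∈ c.divisors) : Module.finrank ℚ (K d) * (c / d) = g := by
    rw [show g = _ from (Module.finrank_mul_finrank ℚ (K d) L).symm,
      IntermediateField.finrank_fixedField_eq_card,
      Nat.card_zpowers, orderOf_pow, Nat.gcd_eq_right (Nat.dvd_of_mem_divisors hd)]
  choose C hC using fun d ↦ exists_abs_degreeOnePrimes_add_log_le (K d)
  set A : ℝ := ∑ d ∈ c.divisors, (ArithmeticFunction.moebius d : ℝ) * ((c / d : ℕ) : ℝ)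
  have hA : 0 < A := sum_moebius_mul_div_pos hc
  have hev : ∀ᶠ s in 𝓝[>] (1 : ℝ), A * (-Real.log (s - 1)) ≤ g * ∑ p ∈ E, |w p| +
      ∑ d ∈ c.divisors, |(ArithmeticFunction.moebius d : ℝ) * ((c / d : ℕ) : ℝ)| * C d := by
    have hall : ∀ᶠ s in 𝓝[>] (1 : ℝ), ∀ d ∈ c.divisors,
        |Module.finrank ℚ (K d) * S d s + Real.log (s - 1)| ≤ C d :=
      (Filter.eventually_all_finset _).mpr fun d _ ↦ hC d
    filter_upwards [hall, self_mem_nhdsWithin] with s hs hs1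
    have e1 : A * (-Real.log (s - 1)) =
        g * (∑ d ∈ c.divisors, (ArithmeticFunction.moebius d : ℝ) * S d s) -
          ∑ d ∈ c.divisors, ((ArithmeticFunction.moebius d : ℝ) * ((c / d : ℕ) : ℝ)) *
            (Module.finrank ℚ (K d) * S d s + Real.log (s - 1)) := by
      rw [Finset.mul_sum, ← Finset.sum_sub_distrib, Finset.sum_mul]
      refine Finset.sum_congr rfl fun d hd ↦ ?_
      rw [← hdeg hd, Nat.cast_mul]
      ring
    rw [e1]
    have e2 := mul_le_mul_of_nonneg_left (hT hs1) (Nat.cast_nonneg (α := ℝ) g)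
    have e3 : -∑ d ∈ c.divisors, ((ArithmeticFunction.moebius d : ℝ) * ((c / d : ℕ) : ℝ)) *
            (Module.finrank ℚ (K d) * S d s + Real.log (s - 1)) ≤
        ∑ d ∈ c.divisors, |(ArithmeticFunction.moebius d : ℝ) * ((c / d : ℕ) : ℝ)| * C d := by
      rw [← Finset.sum_neg_distrib]
      refine Finset.sum_le_sum fun d hd ↦ (neg_le_abs _).trans ?_
      rw [abs_mul]
      gcongr
      exact hs d hd
    linarith
  have hlim : Tendsto (fun s : ℝ ↦ A * (-Real.log (s - 1))) (𝓝[>] 1) atTop := by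
    refine Tendsto.const_mul_atTop hA (tendsto_neg_atBot_atTop.comp
      (Real.tendsto_log_nhdsGT_zero.comp ?_))
    refine tendsto_nhdsWithin_iff.mpr ⟨?_, ?_⟩
    · have : Tendsto (fun s : ℝ ↦ s - 1) (𝓝 1) (𝓝 (1 - 1)) :=
        (continuous_id.sub continuous_const).tendsto 1
      rw [sub_self] at this
      exact this.mono_left nhdsWithin_le_nhds
    · filter_upwards [self_mem_nhdsWithin] with s hs
      simpa using hs
  obtain ⟨s, hs1, hs2⟩ := (hev.and (hlim.eventually_gt_atTop _)).exists
  exact absurd hs1 (not_le.mpr hs2)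

end NumberField

end

section

variable {L : Type*} [Field L] [NumberField L] [IsGalois ℚ L] {N : ℕ} {ζ : L}

lemma IsPrimitiveRoot.exists_algEquiv_apply_eq_pow (hN : 0 < N) (hζ : IsPrimitiveRoot ζ N) {c : ℕ}
    (hc : c.Coprime N) : ∃ h : Gal(L/ℚ), h ζ = ζ ^ c := by
  have : IsConjRoot ℚ (ζ ^ c) ζ := by
    rw [IsConjRoot, ← Polynomial.cyclotomic_eq_minpoly_rat hζ hN,
      ← Polynomial.cyclotomic_eq_minpoly_rat (hζ.pow_of_coprime c hc) hN]
  obtain ⟨σ, hσ⟩ := isConjRoot_iff_exists_algEquiv.mp this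
  exact ⟨σ, hσ⟩

lemma exists_rat_eq_pow_half (h8 : 8 ∣ N) (hN : 0 < N) (hζ : IsPrimitiveRoot ζ N) {z : L}
    (hz : z ≠ 0) {u : ℚ} (hu : z ^ N = algebraMap ℚ L u)
    (hfix : ∀ τ : Gal(L/ℚ), τ ζ = ζ → τ z = z) : ∃ y : ℚ, u = y ^ (N / 2) := by
  have : NeZero N := ⟨hN.ne'⟩
  have hζ0 : ζ ≠ 0 := hζ.ne_zero hN.ne'
  have hfix' (f g : Gal(L/ℚ)) (h : f ζ = g ζ) : f z = g z := by
    have := hfix (g⁻¹ * f) (by simp [AlgEquiv.mul_apply, h, AlgEquiv.aut_inv])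
    rw [AlgEquiv.mul_apply, AlgEquiv.aut_inv, AlgEquiv.symm_apply_eq] at this
    exact this
  have hroot (x : L) (hx : x ^ N = 1) : ∃ i, ζ ^ i = x := by
    obtain ⟨i, -, hi⟩ := hζ.eq_pow_of_pow_eq_one hx
    exact ⟨i, hi⟩
  have hzimg (h : Gal(L/ℚ)) : ∃ i, h z = ζ ^ i * z := by
    obtain ⟨i, hi⟩ := hroot (h z / z) (by
      rw [div_pow, ← map_pow, hu, AlgEquiv.commutes, div_self]
      rw [← hu]
      exact pow_ne_zero _ hz)
    exact ⟨i, by rw [hi, div_mul_cancel₀ _ hz]⟩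
  have hζimg (h : Gal(L/ℚ)) : ∃ i, h ζ = ζ ^ i := by
    obtain ⟨i, hi⟩ := hroot (h ζ) (by rw [← map_pow, hζ.pow_eq_one, map_one])
    exact ⟨i, hi.symm⟩
  obtain ⟨κ, hκ⟩ := hζ.exists_algEquiv_apply_eq_pow hN (c := N - 1)
    ((Nat.coprime_self_sub_left hN).mpr (Nat.coprime_one_left N))
  have hκ' : κ ζ = ζ⁻¹ := by
    rw [hκ]
    refine eq_inv_of_mul_eq_one_left ?_
    rw [← pow_succ, Nat.sub_add_cancel hN, hζ.pow_eq_one]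
  obtain ⟨a, ha⟩ := hzimg κ
  have hw : z * κ z ∈ Set.range (algebraMap ℚ L) := by
    rw [IsGalois.mem_range_algebraMap_iff_fixed]
    intro h
    obtain ⟨c, hc⟩ := hζimg h
    obtain ⟨b, hb⟩ := hzimg h
    have hcomm : (h * κ) z = (κ * h) z := hfix' _ _ (by
      simp [AlgEquiv.mul_apply, hκ', hc])
    rw [AlgEquiv.mul_apply, AlgEquiv.mul_apply, ha, hb, map_mul, map_mul, map_pow, map_pow, hκ',
      ha, hb, hc, ← mul_assoc, ← mul_assoc] at hcomm
    have h1 := mul_right_cancel₀ hz hcomm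
    rw [inv_pow] at h1
    have h2 : (ζ ^ c) ^ a * ζ ^ b * ζ ^ b = ζ ^ a := by
      rw [h1, mul_comm, mul_inv_cancel_left₀ (pow_ne_zero _ hζ0)]
    rw [ha, map_mul, map_mul, map_pow, hc, hb, ← h2]
    ring
  obtain ⟨y, hy⟩ := hw
  have hy0 : y ≠ 0 := by
    rintro rfl
    rw [map_zero] at hy
    exact mul_ne_zero hz ((map_ne_zero κ).mpr hz) hy.symm
  have hyN : y ^ N = u ^ 2 := by
    apply (algebraMap ℚ L).injective
    rw [map_pow, map_pow, hy, mul_pow, ← map_pow, hu, AlgEquiv.commutes, sq]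
  obtain ⟨M, rfl⟩ := h8
  have hM : 0 < M := by omega
  have hhalf : 8 * M / 2 = 4 * M := by omega
  rw [hhalf]
  have hsq : u ^ 2 = (y ^ (4 * M)) ^ 2 := by rw [← hyN]; ring
  rcases sq_eq_sq_iff_eq_or_eq_neg.mp hsq with h | h
  · exact ⟨y, h⟩
  exfalso
  have hhalfζ : ζ ^ (4 * M) = -1 := by
    have h2 : (ζ ^ (4 * M)) ^ 2 = 1 := by
      rw [← pow_mul, ← hζ.pow_eq_one]; ring_nf
    rcases mul_self_eq_one_iff.mp ((sq _).symm.trans h2) with h1 | h1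
    · exact absurd h1 (hζ.pow_ne_one_of_pos_of_lt (by omega) (by omega))
    · exact h1
  obtain ⟨g, hg⟩ := hζ.exists_algEquiv_apply_eq_pow hN (c := 1 + 4 * M) (by
    rw [Nat.coprime_iff_gcd_eq_one, ← Nat.dvd_one]
    have h1 := Nat.gcd_dvd_left (1 + 4 * M) (8 * M)
    have h2 := Nat.gcd_dvd_right (1 + 4 * M) (8 * M)
    have hodd : Odd (Nat.gcd (1 + 4 * M) (8 * M)) :=
      Odd.of_dvd_nat ⟨2 * M, by ring⟩ h1
    have h3 : Nat.gcd (1 + 4 * M) (8 * M) ∣ 2 := by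
      have := Nat.dvd_sub (h1.mul_left 2) h2
      rwa [show 2 * (1 + 4 * M) - 8 * M = 2 by omega] at this
    rcases (Nat.dvd_prime Nat.prime_two).mp h3 with h4 | h4
    · rw [h4]
    · rw [h4] at hodd
      exact absurd hodd (by decide))
  have hg' : g ζ = -ζ := by rw [hg, pow_add, pow_one, hhalfζ]; ring
  have hyL : algebraMap ℚ L y ≠ 0 := (map_ne_zero _).mpr hy0
  set η : L := z ^ 2 / algebraMap ℚ L y with hη
  have hηhalf : η ^ (4 * M) = -1 := by
    rw [hη, div_pow, ← pow_mul, show 2 * (4 * M) = 8 * M by ring, hu, h, map_neg, map_pow,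
      neg_div, div_self (pow_ne_zero _ hyL)]
  obtain ⟨j, hj⟩ := hroot η (by
    rw [show 8 * M = 4 * M * 2 by ring, pow_mul, hηhalf]; norm_num)
  have hjodd : Odd j := by
    by_contra hj'
    obtain ⟨i, rfl⟩ := Nat.not_odd_iff_even.mp hj'
    have : η ^ (4 * M) = 1 := by
      rw [← hj, ← pow_mul, show (i + i) * (4 * M) = 8 * M * i by ring, pow_mul, hζ.pow_eq_one,
        one_pow]
    rw [hηhalf] at this
    norm_num at this
  have hgz2 : g (z ^ 2) = -z ^ 2 := by
    have : g η = -η := by rw [← hj, map_pow, hg', hjodd.neg_pow]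
    rw [hη, map_div₀, AlgEquiv.commutes, ← neg_div] at this
    exact (div_left_inj' hyL).mp this
  obtain ⟨i, hi⟩ := hzimg g
  have hi2 : (ζ ^ i) ^ 2 = -1 := by
    rw [map_pow, hi, mul_pow] at hgz2
    exact mul_right_cancel₀ (pow_ne_zero 2 hz) (by rw [hgz2]; ring)
  have hieven : Even i := by
    have h1 : ζ ^ (i * 2 + 4 * M) = 1 := by
      rw [pow_add, pow_mul, hi2, hhalfζ]; norm_num
    obtain ⟨q, hq⟩ := (hζ.pow_eq_one_iff_dvd _).mp h1
    have : i + 2 * M = 2 * (2 * M * q) := by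
      have : 8 * M * q = 2 * (2 * (2 * M * q)) := by ring
      omega
    exact (Nat.even_add.mp (this ▸ even_two_mul _)).mpr (even_two_mul _)
  have hgg : (g * g) z = z := hfix _ (by simp [AlgEquiv.mul_apply, hg'])
  rw [AlgEquiv.mul_apply, hi, map_mul, map_pow, hg', hieven.neg_pow, hi, ← mul_assoc, ← sq, hi2,
    neg_one_mul, neg_eq_iff_add_eq_zero, ← two_mul] at hgg
  exact hz ((mul_eq_zero.mp hgg).resolve_left two_ne_zero)

/-- Simultaneous Kummer theory: if the prescribed values satisfy the relations forced by
rational powers, some automorphism multiplies each radical by the prescribed root of unity. -/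
lemma exists_algEquiv_apply_radical_eq {ι : Type*} [Fintype ι] (h8 : 8 ∣ N) (hN : 0 < N)
    (hζ : IsPrimitiveRoot ζ N) {t : ι → ℚ} (ht : ∀ i, t i ≠ 0) {r : ι → L}
    (hr : ∀ i, r i ^ N = algebraMap ℚ L (t i)) (a : ι → ℕ)
    (hrel : ∀ (e : ι → ℕ) (y : ℚ), ∏ i, t i ^ e i = y ^ (N / 2) → N ∣ ∑ i, a i * e i) :
    ∃ σ : Gal(L/ℚ), σ ζ = ζ ∧ ∀ i, σ (r i) = ζ ^ a i * r i := by
  classical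
  have : NeZero N := ⟨hN.ne'⟩
  have hζu : IsUnit ζ := hζ.isUnit hN.ne'
  have hr0 (i : ι) : r i ≠ 0 := by
    intro h
    have := hr i
    rw [h, zero_pow hN.ne', eq_comm, map_eq_zero] at this
    exact ht i this
  let G₀ : Subgroup Gal(L/ℚ) := MulAction.stabilizer Gal(L/ℚ) ζ
  have hG₀ (τ : G₀) : (τ : Gal(L/ℚ)) ζ = ζ := τ.2
  have hfixroot (τ : G₀) (x : L) (hx : x ^ N = 1) : (τ : Gal(L/ℚ)) x = x := by
    obtain ⟨i, -, rfl⟩ := hζ.eq_pow_of_pow_eq_one hx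
    rw [map_pow, hG₀]
  have hquot (τ : Gal(L/ℚ)) (i : ι) : (τ (r i) / r i) ^ N = 1 := by
    rw [div_pow, ← map_pow, hr, AlgEquiv.commutes, div_self]
    exact (map_ne_zero _).mpr (ht i)
  let Ψ : G₀ →* (ι → rootsOfUnity N L) :=
    { toFun := fun τ i ↦ rootsOfUnity.mkOfPowEq ((τ : Gal(L/ℚ)) (r i) / r i) (hquot τ i)
      map_one' := by
        ext i
        simp [hr0 i]
      map_mul' := by
        intro τ τ'
        ext i
        simp only [rootsOfUnity.coe_mkOfPowEq, Pi.mul_apply, Subgroup.coe_mul, Units.val_mul]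
        have := hfixroot τ _ (hquot τ' i)
        rw [map_div₀] at this
        have h0 : (τ : Gal(L/ℚ)) (r i) ≠ 0 := (map_ne_zero _).mpr (hr0 i)
        rw [AlgEquiv.mul_apply, ← this]
        field_simp }
  let v : ι → rootsOfUnity N L := fun i ↦ rootsOfUnity.mkOfPowEq (ζ ^ a i) (by
    rw [← pow_mul, mul_comm, pow_mul, hζ.pow_eq_one, one_pow])
  suffices hv : v ∈ Ψ.range by
    obtain ⟨τ, hτ⟩ := hv
    refine ⟨τ, hG₀ τ, fun i ↦ ?_⟩
    have := congrArg (fun x : ι → rootsOfUnity N L ↦ ((x i : Lˣ) : L)) hτ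
    simp only [Ψ, v, MonoidHom.coe_mk, OneHom.coe_mk, rootsOfUnity.coe_mkOfPowEq] at this
    rw [← this, div_mul_cancel₀ _ (hr0 i)]
  by_contra hv
  have henough : HasEnoughRootsOfUnity L N := ⟨⟨ζ, hζ⟩, inferInstance⟩
  let A := (ι → rootsOfUnity N L) ⧸ Ψ.range
  have hexp : Monoid.exponent A ∣ N := by
    refine Monoid.exponent_dvd_of_forall_pow_eq_one fun x ↦ ?_
    obtain ⟨x, rfl⟩ := QuotientGroup.mk_surjective x
    rw [← QuotientGroup.mk_pow]
    have : x ^ N = 1 := by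
      ext i
      have := (mem_rootsOfUnity N _).mp (x i).2
      simpa using congrArg Units.val this
    rw [this, QuotientGroup.mk_one]
  have := HasEnoughRootsOfUnity.of_dvd L hexp
  have hv1 : (QuotientGroup.mk v : A) ≠ 1 := by
    rwa [Ne, QuotientGroup.eq_one_iff]
  obtain ⟨χ', hχ'⟩ := CommGroup.exists_apply_ne_one_of_hasEnoughRootsOfUnity A L hv1
  let χ : (ι → rootsOfUnity N L) →* Lˣ := χ'.comp (QuotientGroup.mk' _)
  have hχΨ (τ : G₀) : χ (Ψ τ) = 1 := by
    have : (QuotientGroup.mk (Ψ τ) : A) = 1 := (QuotientGroup.eq_one_iff _).mpr ⟨τ, rfl⟩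
    exact (congrArg χ' this).trans (map_one χ')
  let ζ' : rootsOfUnity N L := hζ.toRootsOfUnity
  have hζ'val : ((ζ' : Lˣ) : L) = ζ := rfl
  have hζ'pow (x : rootsOfUnity N L) : ∃ i : ℕ, x = ζ' ^ i := by
    have := congrArg Units.val ((mem_rootsOfUnity N _).mp x.2)
    obtain ⟨i, -, hi⟩ := hζ.eq_pow_of_pow_eq_one (ξ := ((x : Lˣ) : L)) (by simpa using this)
    refine ⟨i, ?_⟩
    ext
    simp [hζ'val, hi]
  have hsingle (i : ι) : ∃ e : ℕ, ((χ (Pi.mulSingle i ζ') : Lˣ) : L) = ζ ^ e := by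
    obtain ⟨e, -, he⟩ := hζ.eq_pow_of_pow_eq_one (ξ := ((χ (Pi.mulSingle i ζ') : Lˣ) : L)) (by
      rw [← Units.val_pow_eq_pow_val, ← map_pow, ← Pi.mulSingle_pow]
      have : ζ' ^ N = 1 := by ext; simp [hζ'val, hζ.pow_eq_one]
      rw [this, Pi.mulSingle_one, map_one, Units.val_one])
    exact ⟨e, he.symm⟩
  choose e he using hsingle
  have hχ (x : ι → rootsOfUnity N L) :
      ((χ x : Lˣ) : L) = ∏ i, (((x i : Lˣ) : L)) ^ e i := by
    conv_lhs => rw [← Finset.univ_prod_mulSingle x]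
    rw [map_prod, Units.coe_prod]
    refine Finset.prod_congr rfl fun i _ ↦ ?_
    obtain ⟨k, hk⟩ := hζ'pow (x i)
    rw [hk, Pi.mulSingle_pow, map_pow, Units.val_pow_eq_pow_val, he]
    simp only [SubmonoidClass.coe_pow, Units.val_pow_eq_pow_val, hζ'val]
    ring
  set z : L := ∏ i, r i ^ e i with hz
  have hz0 : z ≠ 0 := Finset.prod_ne_zero_iff.mpr fun i _ ↦ pow_ne_zero _ (hr0 i)
  have hzN : z ^ N = algebraMap ℚ L (∏ i, t i ^ e i) := by
    rw [hz, ← Finset.prod_pow, map_prod]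
    refine Finset.prod_congr rfl fun i _ ↦ ?_
    rw [map_pow, ← hr]
    ring
  obtain ⟨y, hy⟩ := exists_rat_eq_pow_half h8 hN hζ hz0 hzN fun τ hτ ↦ by
    have h1 := congrArg Units.val (hχΨ ⟨τ, hτ⟩)
    rw [hχ, Units.val_one] at h1
    simp only [Ψ, MonoidHom.coe_mk, OneHom.coe_mk, rootsOfUnity.coe_mkOfPowEq, div_pow,
      Finset.prod_div_distrib] at h1
    rw [hz, map_prod]
    simp_rw [map_pow]
    exact eq_of_div_eq_one h1
  have hdvd := hrel e y hy
  apply hχ'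
  have : χ v = 1 := by
    ext
    rw [hχ, Units.val_one]
    simp only [v, rootsOfUnity.coe_mkOfPowEq, ← pow_mul]
    rw [Finset.prod_pow_eq_pow_sum]
    exact (hζ.pow_eq_one_iff_dvd _).mpr hdvd
  exact this

end

section

lemma exists_isSplittingField_rat (F : Polynomial ℚ) :
    ∃ (L : Type) (_ : Field L) (_ : NumberField L), F.IsSplittingField ℚ L := by
  have hnf : NumberField F.SplittingField :=
    { to_charZero := charZero_of_injective_algebraMap (algebraMap ℚ F.SplittingField).injective
      to_finiteDimensional := inferInstance }
  refine ⟨F.SplittingField, inferInstance, hnf, ?_⟩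
  convert Polynomial.IsSplittingField.splittingField F
  exact Subsingleton.elim _ _

lemma exists_isGalois_adjoin_radicals {ι : Type*} [Fintype ι] {N : ℕ} (hN : 0 < N) {t : ι → ℚ}
    (ht : ∀ i, t i ≠ 0) :
    ∃ (L : Type) (_ : Field L) (_ : NumberField L), IsGalois ℚ L ∧ ∃ (ζ : L) (r : ι → L),
      IsPrimitiveRoot ζ N ∧ (∀ i, r i ^ N = algebraMap ℚ L (t i)) ∧
      Algebra.adjoin ℚ (insert ζ (Set.range r)) = ⊤ := by
  classical
  let F : Polynomial ℚ := Polynomial.cyclotomic N ℚ * ∏ i, (Polynomial.X ^ N - Polynomial.C (t i))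
  have hX (i : ι) : (Polynomial.X ^ N - Polynomial.C (t i) : Polynomial ℚ).Monic :=
    Polynomial.monic_X_pow_sub_C _ hN.ne'
  have hF : F ≠ 0 := mul_ne_zero (Polynomial.cyclotomic_ne_zero N ℚ)
    (Polynomial.monic_prod_of_monic _ _ fun i _ ↦ hX i).ne_zero
  have : NeZero N := ⟨hN.ne'⟩
  obtain ⟨L, _, hnf, hL⟩ := exists_isSplittingField_rat F
  have hgal : IsGalois ℚ L :=
    isGalois_iff.mpr ⟨inferInstance, Normal.of_isSplittingField F⟩
  have hsplit : (F.map (algebraMap ℚ L)).Splits := Polynomial.IsSplittingField.splits L F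
  have hroot (G : Polynomial ℚ) (hG : G ∣ F) (hd : G.degree ≠ 0) :
      ∃ x : L, Polynomial.aeval x G = 0 := by
    have h1 : (G.map (algebraMap ℚ L)).Splits :=
      hsplit.of_dvd ((Polynomial.map_ne_zero_iff (algebraMap ℚ L).injective).mpr hF)
        (Polynomial.map_dvd _ hG)
    obtain ⟨x, hx⟩ := h1.exists_eval_eq_zero (by rwa [Polynomial.degree_map])
    exact ⟨x, by rwa [Polynomial.eval_map_algebraMap] at hx⟩
  obtain ⟨ζ, hζ⟩ := hroot (Polynomial.cyclotomic N ℚ) (dvd_mul_right _ _)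
    (Polynomial.degree_cyclotomic_pos N ℚ hN).ne'
  have hζ : IsPrimitiveRoot ζ N := by
    rw [← Polynomial.isRoot_cyclotomic_iff, Polynomial.IsRoot,
      ← Polynomial.map_cyclotomic N (algebraMap ℚ L), Polynomial.eval_map_algebraMap, hζ]
  have hr (i : ι) : ∃ x : L, x ^ N = algebraMap ℚ L (t i) := by
    obtain ⟨x, hx⟩ := hroot (Polynomial.X ^ N - Polynomial.C (t i))
      ((Finset.dvd_prod_of_mem _ (Finset.mem_univ i)).mul_left _)
      (by rw [Polynomial.degree_X_pow_sub_C hN]; exact_mod_cast hN.ne')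
    exact ⟨x, by simpa [sub_eq_zero] using hx⟩
  choose r hr using hr
  refine ⟨L, inferInstance, hnf, hgal, ζ, r, hζ, hr, ?_⟩
  rw [eq_top_iff, ← Polynomial.IsSplittingField.adjoin_rootSet L F, Algebra.adjoin_le_iff]
  intro x hx
  have hζmem : ζ ∈ Algebra.adjoin ℚ (insert ζ (Set.range r)) :=
    Algebra.subset_adjoin (Set.mem_insert _ _)
  have hx := (Polynomial.mem_rootSet.mp hx).2
  rw [map_mul, mul_eq_zero, map_prod, Finset.prod_eq_zero_iff] at hx
  rcases hx with hx | ⟨i, -, hx⟩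
  · have : IsPrimitiveRoot x N := by
      rw [← Polynomial.isRoot_cyclotomic_iff, Polynomial.IsRoot,
        ← Polynomial.map_cyclotomic N (algebraMap ℚ L), Polynomial.eval_map_algebraMap, hx]
    obtain ⟨i, -, rfl⟩ := hζ.eq_pow_of_pow_eq_one this.pow_eq_one
    exact pow_mem hζmem i
  · have hxN : x ^ N = algebraMap ℚ L (t i) := by simpa [sub_eq_zero] using hx
    have hr0 : r i ≠ 0 := by
      intro h
      have := hr i
      rw [h, zero_pow hN.ne', eq_comm, map_eq_zero] at this
      exact ht i this
    obtain ⟨j, -, hj⟩ := hζ.eq_pow_of_pow_eq_one (ξ := x / r i) (by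
      rw [div_pow, hxN, hr, div_self ((map_ne_zero _).mpr (ht i))])
    rw [← div_mul_cancel₀ x hr0, ← hj]
    exact mul_mem (pow_mem hζmem j) (Algebra.subset_adjoin (Set.mem_insert_of_mem _ ⟨i, rfl⟩))

lemma exists_coprime_pow_eq_of_zpowers_eq {G : Type*} [Group G] {σ φ : G} {N : ℕ} (hN : 0 < N)
    (hσ : σ ^ N = 1) (h : Subgroup.zpowers φ = Subgroup.zpowers σ) :
    ∃ j : ℕ, j.Coprime N ∧ φ = σ ^ j := by
  have hd : orderOf σ ∣ N := orderOf_dvd_of_pow_eq_one hσ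
  have hfin : IsOfFinOrder σ := isOfFinOrder_iff_pow_eq_one.mpr ⟨N, hN, hσ⟩
  have : NeZero N := ⟨hN.ne'⟩
  obtain ⟨j, hj⟩ : ∃ j : ℕ, σ ^ j = φ :=
    hfin.mem_powers_iff_mem_zpowers.mpr (h ▸ Subgroup.mem_zpowers φ)
  have hord : orderOf φ = orderOf σ := by
    rw [← Nat.card_zpowers, h, Nat.card_zpowers]
  have hcop : j.Coprime (orderOf σ) := by
    rw [← hj, hfin.orderOf_pow] at hord
    have hpos := hfin.orderOf_pos
    have h1 := Nat.div_mul_cancel (Nat.gcd_dvd_left (orderOf σ) j)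
    rw [hord] at h1
    rw [Nat.coprime_comm]
    exact Nat.eq_of_mul_eq_mul_left hpos (by rw [h1, mul_one])
  obtain ⟨u, hu⟩ := ZMod.unitsMap_surjective hd (ZMod.unitOfCoprime j hcop)
  refine ⟨(u : ZMod N).val, ZMod.val_coe_unit_coprime u, ?_⟩
  rw [← hj, pow_eq_pow_iff_modEq, ← ZMod.natCast_eq_natCast_iff]
  have := congrArg Units.val hu
  rw [ZMod.unitsMap_def, Units.coe_map, ZMod.coe_unitOfCoprime] at this
  rw [← this, MonoidHom.coe_coe, ZMod.castHom_apply, ZMod.natCast_val]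

lemma exists_isFrob_radicals {ι : Type*} [Fintype ι] {N : ℕ} (h8 : 8 ∣ N) (hN : 0 < N) {t : ι → ℚ}
    (ht : ∀ i, t i ≠ 0) (a : ι → ℕ)
    (hrel : ∀ (e : ι → ℕ) (y : ℚ), ∏ i, t i ^ e i = y ^ (N / 2) → N ∣ ∑ i, a i * e i) (n : ℕ) :
    ∃ (L : Type) (_ : Field L) (_ : NumberField L) (ζ : L) (r : ι → L)
      (P : HeightOneSpectrum (𝓞 L)) (φ : Gal(L/ℚ)) (j : ℕ), IsPrimitiveRoot ζ N ∧
      (∀ i, r i ^ N = algebraMap ℚ L (t i)) ∧ n < NumberField.primeBelow P ∧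
      NumberField.IsFrob φ P ∧ φ ζ = ζ ∧ j.Coprime N ∧ ∀ i, φ (r i) = ζ ^ (j * a i) * r i := by
  obtain ⟨L, _, _, _, ζ, r, hζ, hr, htop⟩ := exists_isGalois_adjoin_radicals hN ht
  have : NeZero N := ⟨hN.ne'⟩
  obtain ⟨σ, hσζ, hσr⟩ := exists_algEquiv_apply_radical_eq h8 hN hζ ht hr a hrel
  have hr0 (i : ι) : r i ≠ 0 := by
    intro h
    have := hr i
    rw [h, zero_pow hN.ne', eq_comm, map_eq_zero] at this
    exact ht i this
  have hext (f g : Gal(L/ℚ)) (h1 : f ζ = g ζ) (h2 : ∀ i, f (r i) = g (r i)) : f = g := by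
    have : (f : L →ₐ[ℚ] L) = g := by
      refine AlgHom.ext_of_adjoin_eq_top htop ?_
      rintro x (rfl | ⟨i, rfl⟩)
      · exact h1
      · exact h2 i
    exact AlgEquiv.ext fun x ↦ DFunLike.congr_fun this x
  have hσpow (c : ℕ) : (σ ^ c) ζ = ζ ∧ ∀ i, (σ ^ c) (r i) = ζ ^ (c * a i) * r i := by
    induction c with
    | zero => simp
    | succ c ih =>
      refine ⟨by rw [pow_succ, AlgEquiv.mul_apply, hσζ, ih.1], fun i ↦ ?_⟩
      rw [pow_succ, AlgEquiv.mul_apply, hσr, map_mul, map_pow, ih.1, ih.2]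
      ring
  have hσN : σ ^ N = 1 := hext _ _ (hσpow N).1 fun i ↦ by
    rw [(hσpow N).2, pow_mul, hζ.pow_eq_one, one_pow, one_mul, AlgEquiv.one_apply]
  have hnormal : (Subgroup.zpowers σ).Normal := by
    have hconj (g : Gal(L/ℚ)) : g * σ * g⁻¹ ∈ Subgroup.zpowers σ := by
      obtain ⟨c, -, hc⟩ := hζ.eq_pow_of_pow_eq_one (ξ := g ζ)
        (by rw [← map_pow, hζ.pow_eq_one, map_one])
      have hσfix (x : L) (hx : x ^ N = 1) : σ x = x := by
        obtain ⟨i, -, rfl⟩ := hζ.eq_pow_of_pow_eq_one hx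
        rw [map_pow, hσζ]
      have hgg (x : L) : g (g⁻¹ x) = x := by rw [← AlgEquiv.mul_apply, mul_inv_cancel]; rfl
      have : g * σ * g⁻¹ = σ ^ c := by
        refine hext _ _ ?_ fun i ↦ ?_
        · rw [AlgEquiv.mul_apply, AlgEquiv.mul_apply, hσfix, hgg, (hσpow c).1]
          rw [← map_pow, hζ.pow_eq_one, map_one]
        · have h1 : σ (g⁻¹ (r i) / r i) = g⁻¹ (r i) / r i := hσfix _ (by
            rw [div_pow, ← map_pow, hr, AlgEquiv.commutes, div_self]
            exact (map_ne_zero _).mpr (ht i))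
          have h2 : σ (g⁻¹ (r i)) = ζ ^ a i * g⁻¹ (r i) := by
            conv_lhs => rw [← div_mul_cancel₀ (g⁻¹ (r i)) (hr0 i)]
            rw [map_mul, h1, hσr]
            field_simp [hr0 i]
          rw [AlgEquiv.mul_apply, AlgEquiv.mul_apply, h2, map_mul, hgg, map_pow, ← hc,
            (hσpow c).2, pow_mul]
      rw [this]
      exact pow_mem (Subgroup.mem_zpowers σ) c
    refine ⟨fun x hx g ↦ ?_⟩
    obtain ⟨k, rfl⟩ := Subgroup.mem_zpowers_iff.mp hx
    rw [← conj_zpow]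
    exact zpow_mem (hconj g) k
  obtain ⟨P, hP, φ, hφ, hφσ⟩ := NumberField.exists_isFrob_zpowers_eq σ n
  obtain ⟨j, hj, rfl⟩ := exists_coprime_pow_eq_of_zpowers_eq hN hσN hφσ
  exact ⟨L, inferInstance, inferInstance, ζ, r, P, σ ^ j, j, hζ, hr, hP, hφ, (hσpow j).1, hj,
    (hσpow j).2⟩

end

section

/-- A power residue character of `ZMod p` written additively, with prescribed values. -/
lemma exists_log_of_radicals {κ : Type*} [Field κ] {p : ℕ} [Fact p.Prime] [CharP κ p] {N : ℕ}
    (hN : 0 < N) {z : κ} (hz : IsPrimitiveRoot z N) (hzp : z ^ p = z) {ι : Type*} {t : ι → ℤ}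
    (ht : ∀ i, (t i : κ) ≠ 0) {r : ι → κ} (hr : ∀ i, r i ^ N = t i) {j : ℕ} (hj : j.Coprime N)
    (a : ι → ℕ) (hrp : ∀ i, r i ^ p = z ^ (j * a i) * r i) :
    ∃ l : ZMod p → ZMod N, (∀ x y, x ≠ 0 → y ≠ 0 → l (x * y) = l x + l y) ∧
      ∀ i, l (t i) = a i := by
  have hp : p.Prime := Fact.out
  have : NeZero N := ⟨hN.ne'⟩
  have hp1 : p = p - 1 + 1 := (Nat.sub_one_add_one hp.ne_zero).symm
  have hz0 : z ≠ 0 := hz.ne_zero hN.ne'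
  have hdvd : N ∣ p - 1 := by
    rw [← hz.pow_eq_one_iff_dvd]
    refine mul_right_cancel₀ hz0 ?_
    rw [← pow_succ, ← hp1, hzp, one_mul]
  obtain ⟨M, hM⟩ := hdvd
  let c : ZMod p →+* κ := ZMod.castHom dvd_rfl κ
  have hexists (x : ZMod p) : ∃ k : ℕ, x ≠ 0 → z ^ k = c x ^ M := by
    by_cases hx : x = 0
    · exact ⟨0, fun h ↦ absurd hx h⟩
    obtain ⟨k, -, hk⟩ := hz.eq_pow_of_pow_eq_one (ξ := c x ^ M) (by
      rw [← pow_mul, mul_comm, ← hM, ← map_pow, ZMod.pow_card_sub_one_eq_one hx, map_one])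
    exact ⟨k, fun _ ↦ hk⟩
  choose k hk using hexists
  have hinj (m n : ℕ) (h : z ^ m = z ^ n) : (m : ZMod N) = n := by
    have h1 : z ^ ((n : ℤ) - m) = 1 := by
      rw [zpow_sub₀ hz0, zpow_natCast, zpow_natCast, h, div_self (pow_ne_zero _ hz0)]
    rw [ZMod.natCast_eq_natCast_iff]
    exact Nat.modEq_iff_dvd.mpr ((hz.zpow_eq_one_iff_dvd _).mp h1)
  refine ⟨fun x ↦ (j : ZMod N)⁻¹ * k x, fun x y hx hy ↦ ?_, fun i ↦ ?_⟩
  · have : (k (x * y) : ZMod N) = (k x + k y : ℕ) := hinj _ _ (by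
      rw [hk _ (mul_ne_zero hx hy), map_mul, mul_pow, pow_add, hk x hx, hk y hy])
    simp only [this, Nat.cast_add, mul_add]
  · have hr0 : r i ≠ 0 := by
      intro h
      have := hr i
      rw [h, zero_pow hN.ne'] at this
      exact ht i this.symm
    have hc : c (t i : ZMod p) = t i := map_intCast c _
    have ht0 : (t i : ZMod p) ≠ 0 := by
      intro h
      rw [h, map_zero] at hc
      exact ht i hc.symm
    have : (k (t i : ZMod p) : ZMod N) = (j * a i : ℕ) := hinj _ _ (by
      rw [hk _ ht0, hc, ← hr, ← pow_mul, ← hM]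
      refine mul_right_cancel₀ hr0 ?_
      rw [← pow_succ, ← hp1, hrp])
    simp only [this, Nat.cast_mul]
    rw [← mul_assoc, mul_comm (j : ZMod N)⁻¹, ZMod.coe_mul_inv_eq_one j hj, one_mul]

lemma exists_prime_log {ι : Type*} [Fintype ι] {N : ℕ} (h8 : 8 ∣ N) (hN : 0 < N) {t : ι → ℤ}
    (ht : ∀ i, t i ≠ 0) (a : ι → ℕ)
    (hrel : ∀ (e : ι → ℕ) (y : ℚ), ∏ i, (t i : ℚ) ^ e i = y ^ (N / 2) → N ∣ ∑ i, a i * e i)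
    (n : ℕ) :
    ∃ p : ℕ, p.Prime ∧ n < p ∧ ∃ l : ZMod p → ZMod N,
      (∀ x y, x ≠ 0 → y ≠ 0 → l (x * y) = l x + l y) ∧ ∀ i, l (t i) = a i := by
  obtain ⟨L, _, _, ζ, r, P, φ, j, hζ, hr, hP, hφ, hφζ, hj, hφr⟩ :=
    exists_isFrob_radicals (t := fun i ↦ (t i : ℚ)) h8 hN (fun i ↦ Int.cast_ne_zero.mpr (ht i)) a
      hrel (n + N + ∑ i, (t i).natAbs)
  set p := NumberField.primeBelow P with hpdef
  have hp : p.Prime := NumberField.primeBelow_prime P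
  refine ⟨p, hp, by omega, ?_⟩
  have : Fact p.Prime := ⟨hp⟩
  have : NeZero N := ⟨hN.ne'⟩
  have hmax : P.asIdeal.IsMaximal := P.isMaximal
  let _ : Field (𝓞 L ⧸ P.asIdeal) := Ideal.Quotient.field _
  let π := Ideal.Quotient.mk P.asIdeal
  have hpmem : (p : 𝓞 L ⧸ P.asIdeal) = 0 := by
    rw [← map_natCast π, Ideal.Quotient.eq_zero_iff_mem]
    exact_mod_cast Int.absNorm_under_mem P.asIdeal
  have hchar : CharP (𝓞 L ⧸ P.asIdeal) p := by
    obtain ⟨q, hq⟩ := CharP.exists (𝓞 L ⧸ P.asIdeal)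
    have hqp : q ∣ p := (CharP.cast_eq_zero_iff _ q p).mp hpmem
    rcases (Nat.dvd_prime hp).mp hqp with rfl | rfl
    · exact absurd rfl (CharP.char_ne_one (𝓞 L ⧸ P.asIdeal) 1)
    · exact hq
  have hcast (m : ℤ) (hm : m ≠ 0) (hmp : m.natAbs < p) : (m : 𝓞 L ⧸ P.asIdeal) ≠ 0 := by
    rw [Ne, CharP.intCast_eq_zero_iff _ p]
    intro h
    exact absurd (Nat.le_of_dvd (Int.natAbs_pos.mpr hm) (Int.natCast_dvd.mp h)) (by omega)
  obtain ⟨ζ', rfl⟩ : ∃ x : 𝓞 L, (x : L) = ζ := ⟨⟨ζ, hζ.isIntegral hN⟩, rfl⟩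
  have hrint (i : ι) : ∃ x : 𝓞 L, (x : L) = r i := by
    refine ⟨⟨r i, IsIntegral.of_pow hN ?_⟩, rfl⟩
    rw [hr, map_intCast]
    exact isIntegral_algebraMap (R := ℤ) (x := t i)
  choose r' hr' using hrint
  have hζ' : IsPrimitiveRoot ζ' N := hζ.of_map_of_injective NumberField.RingOfIntegers.coe_injective
  have hfrob (x y : 𝓞 L) (h : φ x = y) : π x ^ p = π y := by
    have h1 : φ • x = y := NumberField.RingOfIntegers.coe_injective h
    have h2 := hφ x
    rw [h1, ← Ideal.Quotient.eq_zero_iff_mem, map_sub, map_pow, sub_eq_zero] at h2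
    exact h2.symm
  refine exists_log_of_radicals (κ := 𝓞 L ⧸ P.asIdeal) hN (z := π ζ') (r := fun i ↦ π (r' i)) ?_
    (hfrob _ _ hφζ) (fun i ↦ hcast _ (ht i) ?_) (fun i ↦ ?_) hj a fun i ↦ ?_
  · have hNne : NeZero (N : 𝓞 L ⧸ P.asIdeal) := ⟨by
      have := hcast N (by exact_mod_cast hN.ne') (by simp only [Int.natAbs_natCast]; omega)
      exact_mod_cast this⟩
    rw [← Polynomial.isRoot_cyclotomic_iff, ← Polynomial.map_cyclotomic N π]
    exact (hζ'.isRoot_cyclotomic hN).map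
  · have := Finset.single_le_sum (f := fun i ↦ (t i).natAbs) (fun _ _ ↦ Nat.zero_le _)
      (Finset.mem_univ i)
    omega
  · rw [← map_pow, ← map_intCast π]
    congr 1
    apply NumberField.RingOfIntegers.coe_injective
    change (r' i : L) ^ N = _
    rw [hr', hr]
    simp
  · rw [hfrob (r' i) (ζ' ^ (j * a i) * r' i) (by
      change _ = (ζ' : L) ^ (j * a i) * (r' i : L)
      rw [hr', hφr]), map_mul,
      map_pow]

end

section

lemma mem_Iset {k₁ k₂ : ℕ} {x : ℤ} : x ∈ Iset k₁ k₂ ↔ (-(k₁ : ℤ) ≤ x ∧ x ≤ k₂) ∧ x ≠ 0 := Iff.rfl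

lemma ZMod.intCast_ne_zero_of_mem_Iset {k₁ k₂ p : ℕ} (h12 : k₁ ≤ k₂) (hp : k₂ < p) {x : ℤ}
    (hx : x ∈ Iset k₁ k₂) : (x : ZMod p) ≠ 0 := by
  rw [Ne, ZMod.intCast_zmod_eq_zero_iff_dvd]
  intro h
  obtain ⟨⟨h1, h2⟩, h0⟩ := mem_Iset.mp hx
  have := Nat.le_of_dvd (Int.natAbs_pos.mpr h0) (Int.natCast_dvd.mp h)
  omega

lemma splits_of_log {M : Set ℤ} {p N k' : ℕ} [Fact p.Prime] (hM : ∀ m ∈ M, (m : ZMod p) ≠ 0)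
    {f : ℤ → ZMod k'} {B : Set (ZMod k')}
    (hB : ∀ g : ZMod k', ∃! mb : ℤ × ZMod k', mb.1 ∈ M ∧ mb.2 ∈ B ∧ f mb.1 + mb.2 = g)
    {l : ZMod p → ZMod N} (hl : ∀ x y, x ≠ 0 → y ≠ 0 → l (x * y) = l x + l y)
    {θ : ZMod k' → ZMod N} {π : ZMod N → ZMod k'} (hπ : ∀ u c, π (θ c + u) = c + π u)
    (hlf : ∀ m ∈ M, l m = θ (f m)) : Splits M p := by
  have key (m : ℤ) (hm : m ∈ M) (s : ZMod p) (hs : s ≠ 0) : π (l (m * s)) = f m + π (l s) := by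
    rw [hl _ _ (hM m hm) hs, hlf m hm, hπ]
  refine ⟨{s | s ≠ 0 ∧ π (l s) ∈ B}, fun g hg ↦ ?_, ?_⟩
  · obtain ⟨⟨m, b⟩, ⟨hm, hb, hmb⟩, huniq⟩ := hB (π (l g))
    have hm0 := hM m hm
    have hms : (m : ZMod p) * (g / m) = g := mul_div_cancel₀ g hm0
    have hs0 : g / (m : ZMod p) ≠ 0 := div_ne_zero hg hm0
    refine ⟨(m, g / m), ⟨hm, ⟨hs0, ?_⟩, hms⟩, ?_⟩
    · have := key m hm _ hs0
      rw [hms] at this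
      have : b = π (l (g / m)) := add_left_cancel (hmb.trans this)
      exact this ▸ hb
    · rintro ⟨m', s'⟩ ⟨hm', ⟨hs', hsB⟩, hms'⟩
      have h1 := key m' hm' s' hs'
      simp only at hms'
      rw [hms'] at h1
      have := huniq (m', π (l s')) ⟨hm', hsB, h1.symm⟩
      obtain rfl : m' = m := congrArg Prod.fst this
      exact Prod.ext rfl (eq_div_of_mul_eq hm0 (by rw [mul_comm]; exact hms'))
  · rintro ⟨m, hm, s, ⟨hs, -⟩, h0⟩
    exact (mul_ne_zero (hM m hm) hs) h0

lemma dvd_of_prod_primes_pow_eq_pow {s : Finset ℕ} (hs : ∀ q ∈ s, q.Prime) (e : s → ℕ) {y : ℚ}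
    {K : ℕ} (hK : Even K) {c : ℕ} (h : (-1) ^ c * ∏ q : s, ((q : ℕ) : ℚ) ^ e q = y ^ K) :
    Even c ∧ ∀ q, K ∣ e q := by
  have hpos : 0 < ∏ q : s, ((q : ℕ) : ℚ) ^ e q :=
    Finset.prod_pos fun q _ ↦ pow_pos (by exact_mod_cast (hs q q.2).pos) _
  have hc : Even c := by
    by_contra hc
    have h1 := hK.pow_nonneg y
    rw [← h, (Nat.not_even_iff_odd.mp hc).neg_one_pow] at h1
    linarith
  refine ⟨hc, fun q ↦ ?_⟩
  rw [hc.neg_one_pow, one_mul] at h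
  have hq := hs q q.2
  have : Fact (q : ℕ).Prime := ⟨hq⟩
  have hy : y ^ K ≠ 0 := by rw [← h]; exact hpos.ne'
  set R : ℕ := ∏ x ∈ Finset.univ.erase q, (x : ℕ) ^ e x with hR
  have hRq : ¬ (q : ℕ) ∣ R := by
    rw [hR, hq.prime.dvd_finsetProd_iff]
    rintro ⟨x, hx, hd⟩
    have := (Nat.prime_dvd_prime_iff_eq hq (hs x x.2)).mp (hq.dvd_of_dvd_pow hd)
    exact (Finset.mem_erase.mp hx).1 (Subtype.ext this.symm)
  have hR0 : R ≠ 0 := fun h ↦ hRq (h ▸ dvd_zero _)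
  have h2 : ((q : ℕ) : ℚ) ^ e q * (R : ℚ) = y ^ K := by
    rw [← h, ← Finset.mul_prod_erase _ _ (Finset.mem_univ q), hR]
    push_cast
    rfl
  have h3 := congrArg (padicValRat q) h2
  rw [padicValRat.mul (pow_ne_zero _ (by exact_mod_cast hq.ne_zero)) (by exact_mod_cast hR0),
    padicValRat.pow, padicValRat.pow, padicValRat.self hq.one_lt,
    padicValRat.of_nat, padicValNat.eq_zero_of_not_dvd hRq] at h3
  exact Int.natCast_dvd_natCast.mp ⟨_, by simpa using h3⟩

theorem infinite_splits_of_hasDirectLogarithm {k₁ k₂ : ℕ} (h12 : k₁ ≤ k₂) (hk : 3 ≤ k₁ + k₂)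
    {k' : ℕ} (hk' : 0 < k') (h : HasDirectLogarithm (Iset k₁ k₂) k') :
    {p : ℕ | p.Prime ∧ Splits (Iset k₁ k₂) p}.Infinite := by
  classical
  obtain ⟨f, -, hf, B, hB⟩ := h
  have : NeZero k' := ⟨hk'.ne'⟩
  have hN : 0 < 8 * k' := by omega
  have : NeZero (8 * k') := ⟨hN.ne'⟩
  have hf1 : f 1 = 0 := by
    have h1 : (1 : ℤ) ∈ Iset k₁ k₂ := mem_Iset.mpr (by omega)
    simpa using hf 1 h1 1 h1 (by simpa using h1)
  set α : ZMod k' := if k₁ = 0 then 0 else f (-1) with hα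
  have hα2 : α + α = 0 := by
    rw [hα]
    split_ifs with h0
    · simp
    have h1 : (-1 : ℤ) ∈ Iset k₁ k₂ := mem_Iset.mpr (by omega)
    have := hf (-1) h1 (-1) h1 (mem_Iset.mpr (by omega))
    rw [← this]
    simpa using hf1
  set s : Finset ℕ := (Finset.range (k₂ + 1)).filter Nat.Prime with hs
  have hsp (q : ℕ) (hq : q ∈ s) : q.Prime := (Finset.mem_filter.mp hq).2
  let t : Option s → ℤ := fun o ↦ o.elim (-1) fun q ↦ (q : ℕ)
  let a : Option s → ℕ := fun o ↦ o.elim (8 * α.val) fun q ↦ 8 * (f (q : ℕ)).val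
  have ht (i : Option s) : t i ≠ 0 := by
    rcases i with _ | q
    · simp [t]
    · simpa [t] using (hsp q q.2).ne_zero
  have hrel (e : Option s → ℕ) (y : ℚ) (h : ∏ i, (t i : ℚ) ^ e i = y ^ (8 * k' / 2)) :
      8 * k' ∣ ∑ i, a i * e i := by
    rw [show 8 * k' / 2 = 4 * k' by omega, Fintype.prod_option] at h
    simp only [t, Option.elim_none, Option.elim_some, Int.cast_neg, Int.cast_one,
      Int.cast_natCast] at h
    obtain ⟨hc, hq⟩ := dvd_of_prod_primes_pow_eq_pow hsp (fun q ↦ e (some q)) ⟨2 * k', by ring⟩ h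
    rw [Fintype.sum_option]
    refine dvd_add ?_ (Finset.dvd_sum fun q _ ↦ ?_)
    · simp only [a, Option.elim_none]
      obtain ⟨c, hc⟩ := hc
      rw [hc, show 8 * α.val * (c + c) = 8 * ((α.val + α.val) * c) by ring]
      refine mul_dvd_mul_left 8 (Dvd.dvd.mul_right ?_ c)
      rw [← ZMod.natCast_eq_zero_iff]
      simpa using hα2
    · simp only [a, Option.elim_some]
      obtain ⟨d, hd⟩ := hq q
      rw [hd]
      exact ⟨4 * (f (q : ℕ)).val * d, by ring⟩
  rw [Set.infinite_iff_exists_gt]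
  intro n
  obtain ⟨p, hp, hnp, l, hl, hlt⟩ := exists_prime_log (dvd_mul_right 8 k') hN ht a hrel (n + k₂)
  have : Fact p.Prime := ⟨hp⟩
  refine ⟨p, ⟨hp, ?_⟩, by omega⟩
  let θ : ZMod k' → ZMod (8 * k') := fun c ↦ (8 * c.val : ℕ)
  let π : ZMod (8 * k') → ZMod k' := fun u ↦ (u.val / 8 : ℕ)
  have hθ (c d : ZMod k') : θ (c + d) = θ c + θ d := by
    simp only [θ]
    rw [← Nat.cast_add, ZMod.natCast_eq_natCast_iff, ← mul_add, ZMod.val_add]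
    exact (Nat.mod_modEq _ _).mul_left' 8
  have hπ (u : ZMod (8 * k')) (c : ZMod k') : π (θ c + u) = c + π u := by
    simp only [π, θ]
    rw [ZMod.val_add, ZMod.val_natCast, Nat.mod_add_mod, Nat.mod_mul_right_div_self,
      Nat.mul_add_div (by norm_num), ZMod.natCast_mod, Nat.cast_add, ZMod.natCast_zmod_val]
  have hM (m : ℤ) (hm : m ∈ Iset k₁ k₂) : (m : ZMod p) ≠ 0 :=
    ZMod.intCast_ne_zero_of_mem_Iset h12 (by omega) hm
  have hl1 : l 1 = 0 := by
    simpa using hl 1 1 one_ne_zero one_ne_zero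
  have hpos (x : ℕ) (hx0 : 0 < x) (hx : x ≤ k₂) : l ((x : ℤ) : ZMod p) = θ (f x) := by
    induction x using Nat.strong_induction_on with
    | _ x ih =>
      rcases Nat.lt_or_ge 1 x with h1 | h1
      · have hq : x.minFac.Prime := Nat.minFac_prime h1.ne'
        obtain ⟨y, hy⟩ := Nat.minFac_dvd x
        have hy0 : 0 < y := Nat.pos_of_ne_zero fun h ↦ by rw [h] at hy; omega
        have hyx : y < x := by
          calc y < x.minFac * y := (Nat.lt_mul_iff_one_lt_left hy0).mpr hq.one_lt
            _ = x := hy.symm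
        have hqx : x.minFac ≤ x := Nat.minFac_le hx0
        have hq0 := hq.pos
        have hqI : (x.minFac : ℤ) ∈ Iset k₁ k₂ := mem_Iset.mpr (by omega)
        have hyI : (y : ℤ) ∈ Iset k₁ k₂ := mem_Iset.mpr (by omega)
        have hxe : (x : ℤ) = x.minFac * y := by exact_mod_cast hy
        have hxI : (x.minFac : ℤ) * y ∈ Iset k₁ k₂ := hxe ▸ mem_Iset.mpr (by omega)
        have hqs : x.minFac ∈ s := Finset.mem_filter.mpr ⟨Finset.mem_range.mpr (by omega), hq⟩
        have h2 := hlt (some ⟨x.minFac, hqs⟩)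
        simp only [t, a, Option.elim_some] at h2
        rw [hxe, hf _ hqI _ hyI hxI, hθ, ← ih y hyx hy0 (by omega), Int.cast_mul,
          hl _ _ (hM _ hqI) (hM _ hyI), h2]
      · obtain rfl : x = 1 := by omega
        simp [hl1, hf1, θ]
  refine splits_of_log hM hB hl hπ fun m hm ↦ ?_
  obtain ⟨⟨h1, h2⟩, h0⟩ := mem_Iset.mp hm
  rcases lt_or_gt_of_ne h0 with hneg | hpos'
  · obtain ⟨x, hx⟩ := Int.eq_ofNat_of_zero_le (a := -m) (by omega)
    have hmx : m = -1 * (x : ℤ) := by omega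
    have hI1 : (-1 : ℤ) ∈ Iset k₁ k₂ := mem_Iset.mpr (by omega)
    have hI2 : (x : ℤ) ∈ Iset k₁ k₂ := mem_Iset.mpr (by omega)
    have h3 := hlt none
    have hα' : α = f (-1) := by rw [hα, if_neg (by omega)]
    simp only [t, a, Option.elim_none, hα'] at h3
    rw [hmx, hf _ hI1 _ hI2 (hmx ▸ hm), hθ, ← hpos x (by omega) (by omega), Int.cast_mul,
      hl _ _ (hM _ hI1) (hM _ hI2), h3]
  · obtain ⟨x, rfl⟩ := Int.eq_ofNat_of_zero_le hpos'.le
    exact hpos x (by omega) (by omega)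

end

section

lemma ZMod.exists_log (p : ℕ) [Fact p.Prime] :
    ∃ l : ZMod p → ZMod (p - 1), (∀ x y, x ≠ 0 → y ≠ 0 → l (x * y) = l x + l y) ∧
      Set.BijOn l {0}ᶜ Set.univ := by
  classical
  have hcard : Nat.card (ZMod p)ˣ = p - 1 := by
    rw [Nat.card_eq_fintype_card, ZMod.card_units]
  let e : Multiplicative (ZMod (p - 1)) ≃* (ZMod p)ˣ :=
    hcard ▸ zmodCyclicMulEquiv (G := (ZMod p)ˣ) inferInstance
  let l : ZMod p → ZMod (p - 1) := fun x ↦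
    if h : x = 0 then 0 else (e.symm (Units.mk0 x h)).toAdd
  have hl (x : ZMod p) (h : x ≠ 0) : l x = (e.symm (Units.mk0 x h)).toAdd := dif_neg h
  refine ⟨l, fun x y hx hy ↦ ?_, fun _ _ ↦ Set.mem_univ _, fun x hx y hy h ↦ ?_, fun g _ ↦ ?_⟩
  · rw [hl _ hx, hl _ hy, hl _ (mul_ne_zero hx hy), Units.mk0_mul, map_mul, toAdd_mul]
  · rw [hl _ hx, hl _ hy] at h
    exact congrArg Units.val (e.symm.injective (Multiplicative.toAdd.injective h))
  · refine ⟨e (.ofAdd g), (e _).ne_zero, ?_⟩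
    rw [hl _ (e _).ne_zero, Units.mk0_val, MulEquiv.symm_apply_apply, toAdd_ofAdd]

lemma hasDirectLogarithm_of_splits {k₁ k₂ p : ℕ} (h12 : k₁ ≤ k₂) (hk : 3 ≤ k₁ + k₂)
    [hp : Fact p.Prime] (hpk : k₁ + k₂ < p) (h : Splits (Iset k₁ k₂) p) :
    HasDirectLogarithm (Iset k₁ k₂) (p - 1) := by
  obtain ⟨S, hS, hS0⟩ := h
  obtain ⟨l, hl, -, hinj, hsurj⟩ := ZMod.exists_log p
  have hM (m : ℤ) (hm : m ∈ Iset k₁ k₂) : (m : ZMod p) ≠ 0 :=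
    ZMod.intCast_ne_zero_of_mem_Iset h12 (by omega) hm
  have hSne (s : ZMod p) (hs : s ∈ S) : s ≠ 0 := by
    rintro rfl
    exact hS0 ⟨1, mem_Iset.mpr (by omega), 0, hs, mul_zero _⟩
  refine ⟨fun m ↦ l m, fun x hx y hy hxy ↦ ?_, fun x hx y hy _ ↦ ?_, l '' S, fun g ↦ ?_⟩
  · have h1 : (x : ZMod p) = y := hinj (hM x hx) (hM y hy) hxy
    rw [ZMod.intCast_eq_intCast_iff_dvd_sub] at h1
    obtain ⟨⟨hx1, hx2⟩, -⟩ := mem_Iset.mp hx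
    obtain ⟨⟨hy1, hy2⟩, -⟩ := mem_Iset.mp hy
    have := Int.eq_zero_of_abs_lt_dvd h1 (by rw [abs_lt]; omega)
    omega
  · simp only [Int.cast_mul, hl _ _ (hM x hx) (hM y hy)]
  · obtain ⟨x, hx, rfl⟩ := hsurj (Set.mem_univ g)
    obtain ⟨⟨m, s⟩, ⟨hm, hs, hms⟩, huniq⟩ := hS x hx
    refine ⟨(m, l s), ⟨hm, ⟨s, hs, rfl⟩, ?_⟩, ?_⟩
    · rw [← hms]
      exact (hl _ _ (hM m hm) (hSne s hs)).symm
    · rintro ⟨m', _⟩ ⟨hm', ⟨s', hs', rfl⟩, h⟩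
      have h1 : (m' : ZMod p) * s' = x := by
        refine hinj (mul_ne_zero (hM m' hm') (hSne s' hs')) hx ?_
        rw [hl _ _ (hM m' hm') (hSne s' hs')]
        exact h
      have := huniq (m', s') ⟨hm', hs', h1⟩
      exact congrArg (fun ms : ℤ × ZMod p ↦ (ms.1, l ms.2)) this

lemma card_Iset (k₁ k₂ : ℕ) : Nat.card (Iset k₁ k₂) = k₁ + k₂ := by
  have : Iset k₁ k₂ = ((Finset.Icc (-(k₁ : ℤ)) k₂).erase 0 : Finset ℤ) := by
    rw [Finset.coe_erase, Finset.coe_Icc]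
    rfl
  rw [this, Nat.card_eq_card_toFinset, Finset.toFinset_coe, Finset.card_erase_of_mem (by simp),
    Int.card_Icc]
  omega

lemma mod_eq_one_of_splits {k₁ k₂ p : ℕ} (hk : 3 ≤ k₁ + k₂) [hp : Fact p.Prime]
    (h : Splits (Iset k₁ k₂) p) : p % (k₁ + k₂) = 1 := by
  obtain ⟨S, hS, hS0⟩ := h
  let F : Iset k₁ k₂ × S → {g : ZMod p // g ≠ 0} := fun x ↦
    ⟨((x.1 : ℤ) : ZMod p) * x.2, fun h ↦ hS0 ⟨x.1, x.1.2, x.2, x.2.2, h⟩⟩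
  have hF : Function.Bijective F := by
    refine ⟨fun x y hxy ↦ ?_, fun ⟨g, hg⟩ ↦ ?_⟩
    · have h1 : ((x.1 : ℤ) : ZMod p) * x.2 = ((y.1 : ℤ) : ZMod p) * y.2 := congrArg Subtype.val hxy
      have := (hS _ (F y).2).unique (y₁ := (x.1, x.2)) (y₂ := (y.1, y.2)) ⟨x.1.2, x.2.2, h1⟩
        ⟨y.1.2, y.2.2, rfl⟩
      rw [Prod.mk.injEq] at this
      exact Prod.ext (Subtype.ext this.1) (Subtype.ext this.2)
    · obtain ⟨⟨m, s⟩, ⟨hm, hs, hms⟩, -⟩ := hS g hg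
      exact ⟨(⟨m, hm⟩, ⟨s, hs⟩), Subtype.ext hms⟩
  have hcard := Nat.card_congr (Equiv.ofBijective F hF)
  rw [Nat.card_prod, card_Iset, Nat.card_congr (unitsEquivNeZero (G₀ := ZMod p)).symm,
    Nat.card_eq_fintype_card (α := (ZMod p)ˣ), ZMod.card_units] at hcard
  have hp1 := hp.out.one_lt
  rw [show p = (k₁ + k₂) * Nat.card S + 1 by omega, Nat.mul_add_mod, Nat.mod_eq_of_lt (by omega)]

end

end

/-- For `M = [-k₁,k₂]*` with `k₁ ≤ k₂` and `k₁ + k₂ = k ≥ 3`, the following are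
equivalent: (a) `M` splits `ℤ_p` for some prime `p ≡ 1 (mod k)`;
(b) `M` splits `ℤ_p` for infinitely many primes `p`;
(c) there is a direct logarithm from `M` to `ℤ_{k'}` for some `k'` with `k ∣ k'`. -/
theorem splits_tfae (k₁ k₂ : ℕ) (h12 : k₁ ≤ k₂) (hk : 3 ≤ k₁ + k₂) :
    ((∃ p : ℕ, p.Prime ∧ p % (k₁ + k₂) = 1 ∧ Splits (Iset k₁ k₂) p) ↔
      {p : ℕ | p.Prime ∧ Splits (Iset k₁ k₂) p}.Infinite) ∧
    ({p : ℕ | p.Prime ∧ Splits (Iset k₁ k₂) p}.Infinite ↔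
      ∃ k' : ℕ, 0 < k' ∧ (k₁ + k₂) ∣ k' ∧ HasDirectLogarithm (Iset k₁ k₂) k') := by
  have hba (h : {p : ℕ | p.Prime ∧ Splits (Iset k₁ k₂) p}.Infinite) :
      ∃ p : ℕ, p.Prime ∧ p % (k₁ + k₂) = 1 ∧ Splits (Iset k₁ k₂) p := by
    obtain ⟨p, hp, hs⟩ := h.nonempty
    have : Fact p.Prime := ⟨hp⟩
    exact ⟨p, hp, mod_eq_one_of_splits hk hs, hs⟩
  have hac (h : ∃ p : ℕ, p.Prime ∧ p % (k₁ + k₂) = 1 ∧ Splits (Iset k₁ k₂) p) :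
      ∃ k' : ℕ, 0 < k' ∧ (k₁ + k₂) ∣ k' ∧ HasDirectLogarithm (Iset k₁ k₂) k' := by
    obtain ⟨p, hp, hpk, hs⟩ := h
    have : Fact p.Prime := ⟨hp⟩
    have hp1 := hp.one_lt
    have hlt : k₁ + k₂ < p := by
      rcases lt_trichotomy p (k₁ + k₂) with h | h | h
      · rw [Nat.mod_eq_of_lt h] at hpk
        omega
      · rw [h, Nat.mod_self] at hpk
        omega
      · exact h
    exact ⟨p - 1, by omega, (Nat.modEq_iff_dvd' hp1.le).mp (by
      rw [Nat.ModEq, hpk, Nat.mod_eq_of_lt (by omega)]), hasDirectLogarithm_of_splits h12 hk hlt hs⟩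
  have hcb (h : ∃ k' : ℕ, 0 < k' ∧ (k₁ + k₂) ∣ k' ∧ HasDirectLogarithm (Iset k₁ k₂) k') :
      {p : ℕ | p.Prime ∧ Splits (Iset k₁ k₂) p}.Infinite := by
    obtain ⟨k', hk', -, h⟩ := h
    exact infinite_splits_of_hasDirectLogarithm h12 hk hk' h
  exact ⟨⟨fun h ↦ hcb (hac h), hba⟩, ⟨fun h ↦ hac (hba h), hcb⟩⟩
end

section
/- Let k₁ and k₂ be non-negative integers with k₁ ≤ k₂ and k₁ + k₂ ≥ 3. If k₁ + k₂ + 1 is a prime, then there are infinitely many primes p such that [-k₁,k₂]* splits Z_p. -/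
section DegreeOnePrimes

open Filter Topology

theorem abs_log_one_add_sub_self_le {u : ℝ} (hu : 0 ≤ u) : |Real.log (1 + u) - u| ≤ u ^ 2 := by
  rw [abs_le]
  constructor
  · have h := Real.one_sub_inv_le_log_of_pos (x := 1 + u) (by positivity)
    have h2 : 1 - (1 + u)⁻¹ - u = - (u ^ 2 / (1 + u)) := by field_simp; ring
    have h3 : u ^ 2 / (1 + u) ≤ u ^ 2 := div_le_self (by positivity) (by linarith)
    linarith
  · have h := Real.log_le_sub_one_of_pos (x := 1 + u) (by positivity)
    nlinarith [sq_nonneg u]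

/-- Uniform bounds for the local factor at `p` of a Dirichlet series whose coefficients at prime
powers are dominated by a polynomial in the exponent. -/
theorem exists_local_factor_bound (D : ℕ) : ∃ C : ℝ, 0 ≤ C ∧ ∀ (a : ℕ → ℝ) (p : ℕ) (s : ℝ),
    2 ≤ p → 1 ≤ s → a 0 = 1 → (∀ k, 0 ≤ a k) → (∀ k, a k ≤ ((k : ℝ) + 1) ^ D) →
    |Real.log (∑' k, a k * ((p ^ k : ℕ) : ℝ) ^ (-s)) - a 1 * (p : ℝ) ^ (-s)| ≤
      C * (1 / (p : ℝ) ^ 2) ∧ 1 ≤ ∑' k, a k * ((p ^ k : ℕ) : ℝ) ^ (-s) := by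
  have hS (j : ℕ) : Summable fun k : ℕ ↦ (((k + j : ℕ) : ℝ) + 1) ^ D * (1 / 2 : ℝ) ^ k := by
    have h := (summable_nat_add_iff (j + 1)).2
      (summable_pow_mul_geometric_of_norm_lt_one (R := ℝ) D (r := 1 / 2) (by norm_num))
    refine (h.mul_left (2 ^ (j + 1))).congr fun k ↦ ?_
    rw [pow_add (1 / 2 : ℝ) k]
    push_cast
    have : (2 : ℝ) ^ (j + 1) * (1 / 2) ^ (j + 1) = 1 := by rw [← mul_pow]; norm_num
    calc _ = ((k : ℝ) + (j + 1)) ^ D * (1 / 2) ^ k * (2 ^ (j + 1) * (1 / 2) ^ (j + 1)) := by ring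
      _ = _ := by rw [this]; ring
  set B : ℕ → ℝ := fun j ↦ ∑' k : ℕ, (((k + j : ℕ) : ℝ) + 1) ^ D * (1 / 2 : ℝ) ^ k with hB
  have hB0 (j : ℕ) : 0 ≤ B j := tsum_nonneg fun k ↦ by positivity
  refine ⟨B 1 ^ 2 + B 2, by have := hB0 2; positivity, fun a p s hp hs ha0 ha haD ↦ ?_⟩
  have hp' : (2 : ℝ) ≤ p := by exact_mod_cast hp
  have hterm (j k : ℕ) : a (k + j) * ((p ^ (k + j) : ℕ) : ℝ) ^ (-s) ≤
      (1 / (p : ℝ) ^ j) * ((((k + j : ℕ) : ℝ) + 1) ^ D * (1 / 2 : ℝ) ^ k) := by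
    have h1 : ((p ^ (k + j) : ℕ) : ℝ) ^ (-s) ≤ ((p : ℝ) ^ (k + j))⁻¹ := by
      rw [← Real.rpow_neg_one]
      push_cast
      exact Real.rpow_le_rpow_of_exponent_le (one_le_pow₀ (by linarith)) (by linarith)
    have h2 : ((p : ℝ) ^ (k + j))⁻¹ ≤ (1 / (p : ℝ) ^ j) * (1 / 2 : ℝ) ^ k := by
      rw [pow_add, mul_inv, mul_comm, one_div]
      gcongr
      rw [one_div, inv_pow]
      gcongr
    calc _ ≤ (((k + j : ℕ) : ℝ) + 1) ^ D * ((1 / (p : ℝ) ^ j) * (1 / 2 : ℝ) ^ k) := by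
          gcongr
          · exact haD _
          · exact h1.trans h2
      _ = _ := by ring
  have hnn (k : ℕ) : 0 ≤ a k * ((p ^ k : ℕ) : ℝ) ^ (-s) := mul_nonneg (ha k) (by positivity)
  have hsum : Summable fun k ↦ a k * ((p ^ k : ℕ) : ℝ) ^ (-s) :=
    Summable.of_nonneg_of_le hnn (hterm 0) ((hS 0).mul_left _)
  have hle (j : ℕ) : ∑' k, a (k + j) * ((p ^ (k + j) : ℕ) : ℝ) ^ (-s) ≤ B j / (p : ℝ) ^ j := by
    refine (((summable_nat_add_iff j).2 hsum).tsum_le_tsum (hterm j) ((hS j).mul_left _)).trans ?_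
    rw [tsum_mul_left, one_div, hB, inv_mul_eq_div]
  set u := ∑' k, a (k + 1) * ((p ^ (k + 1) : ℕ) : ℝ) ^ (-s) with hu
  set R := ∑' k, a (k + 2) * ((p ^ (k + 2) : ℕ) : ℝ) ^ (-s) with hR
  have hu0 : 0 ≤ u := tsum_nonneg fun k ↦ hnn _
  have hR0 : 0 ≤ R := tsum_nonneg fun k ↦ hnn _
  have e1 : ∑' k, a k * ((p ^ k : ℕ) : ℝ) ^ (-s) = 1 + u := by
    rw [hsum.tsum_eq_zero_add]; simp [ha0, hu]
  have e2 : u = a 1 * (p : ℝ) ^ (-s) + R := by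
    rw [hu, ((summable_nat_add_iff 1).2 hsum).tsum_eq_zero_add]; simp [hR]
  rw [e1]
  refine ⟨?_, by linarith⟩
  have hu1 : u ≤ B 1 / (p : ℝ) := by simpa only [pow_one] using hle 1
  have hR1 := hle 2
  have hu2 : u ^ 2 ≤ B 1 ^ 2 / (p : ℝ) ^ 2 := by
    rw [← div_pow]
    gcongr
  have key := abs_log_one_add_sub_self_le hu0
  have : (B 1 ^ 2 + B 2) * (1 / (p : ℝ) ^ 2) = B 1 ^ 2 / (p : ℝ) ^ 2 + B 2 / (p : ℝ) ^ 2 := by ring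
  rw [this]
  have e3 : Real.log (1 + u) - a 1 * (p : ℝ) ^ (-s) = (Real.log (1 + u) - u) + R := by
    rw [e2]; ring
  rw [e3]
  calc _ ≤ |Real.log (1 + u) - u| + |R| := abs_add_le _ _
    _ ≤ _ := by rw [abs_of_nonneg hR0]; linarith

/-- A nonnegative multiplicative function whose values at prime powers are polynomially bounded in
the exponent, and whose Dirichlet series has a simple pole at `1`, satisfies
`∑ f(p) p⁻ˢ = log (1 / (s - 1)) + O(1)` as `s → 1⁺`. -/
theorem exists_abs_tsum_primes_add_log_le {f : ℕ → ℝ} {D : ℕ} {c : ℝ} (hf : ∀ n, 0 ≤ f n)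
    (hf1 : f 1 = 1) (hmul : ∀ {m n : ℕ}, m.Coprime n → f (m * n) = f m * f n)
    (hD : ∀ p k : ℕ, p.Prime → f (p ^ k) ≤ ((k : ℝ) + 1) ^ D) (hc : 0 < c)
    (hlim : Tendsto (fun s : ℝ ↦ (s - 1) * ∑' n : ℕ, f n * (n : ℝ) ^ (-s)) (𝓝[>] 1) (𝓝 c)) :
    ∃ C : ℝ, ∀ᶠ s in 𝓝[>] (1 : ℝ), Summable (fun p : Nat.Primes ↦ f p * (p : ℝ) ^ (-s)) ∧
      |(∑' p : Nat.Primes, f p * (p : ℝ) ^ (-s)) + Real.log (s - 1)| ≤ C := by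
  obtain ⟨C, -, hC⟩ := exists_local_factor_bound D
  have hsq : Summable fun p : Nat.Primes ↦ C * (1 / (p : ℝ) ^ 2) :=
    (((Real.summable_one_div_nat_pow (p := 2)).2 (by norm_num)).comp_injective
      Subtype.val_injective).mul_left C
  refine ⟨(|Real.log c| + 1) + ∑' p : Nat.Primes, C * (1 / (p : ℝ) ^ 2), ?_⟩
  have hlog := (hlim.log hc.ne').eventually (Metric.ball_mem_nhds _ one_pos)
  filter_upwards [self_mem_nhdsWithin, hlim.eventually (lt_mem_nhds hc), hlog] with s hs hpos hball
  have hs1 : 1 < s := hs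
  have hs0 : 0 < s - 1 := by linarith
  set Z := ∑' n : ℕ, f n * (n : ℝ) ^ (-s) with hZ
  have hZpos : 0 < Z := pos_of_mul_pos_right hpos hs0.le
  have hsum : Summable fun n : ℕ ↦ f n * (n : ℝ) ^ (-s) := by
    by_contra h
    exact hZpos.ne' (tsum_eq_zero_of_not_summable h)
  have hprod := EulerProduct.eulerProduct_hasProd (f := fun n : ℕ ↦ f n * (n : ℝ) ^ (-s))
    (by simp [hf1]) (fun {m n} h ↦ by
      simp only [hmul h, Nat.cast_mul]
      rw [Real.mul_rpow (by positivity) (by positivity)]; ring) hsum.norm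
    (by simp [Real.zero_rpow (by linarith : -s ≠ 0)])
  set T : Nat.Primes → ℝ := fun p ↦ ∑' e, f (p ^ e) * (((p : ℕ) ^ e : ℕ) : ℝ) ^ (-s) with hT
  have hb (p : Nat.Primes) := hC (fun k ↦ f (p ^ k)) p s p.2.two_le hs1.le (by simpa using hf1)
    (fun k ↦ hf _) (fun k ↦ hD _ _ p.2)
  have hlogsum : HasSum (fun p ↦ Real.log (T p)) (Real.log Z) := by
    have h : Tendsto (fun t : Finset Nat.Primes ↦ Real.log (∏ p ∈ t, T p)) atTop (𝓝 (Real.log Z)) :=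
      Filter.Tendsto.log hprod hZpos.ne'
    refine h.congr fun t ↦ Real.log_prod fun p _ ↦ ?_
    exact (zero_lt_one.trans_le (hb p).2).ne'
  have hsp : Summable fun p : Nat.Primes ↦ f p * (p : ℝ) ^ (-s) :=
    hsum.comp_injective Subtype.val_injective
  refine ⟨hsp, ?_⟩
  have hdiff : |Real.log Z - ∑' p : Nat.Primes, f p * (p : ℝ) ^ (-s)| ≤
      ∑' p : Nat.Primes, C * (1 / (p : ℝ) ^ 2) := by
    rw [← hlogsum.tsum_eq, ← hlogsum.summable.tsum_sub hsp, ← Real.norm_eq_abs]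
    refine tsum_of_norm_bounded hsq.hasSum fun p ↦ ?_
    have h := (hb p).1
    simp only [pow_one] at h
    exact h
  have hZlog : Real.log ((s - 1) * Z) = Real.log (s - 1) + Real.log Z :=
    Real.log_mul hs0.ne' hZpos.ne'
  rw [Real.dist_eq, hZlog] at hball
  have h1 := abs_le.1 hdiff
  have h2 := abs_lt.1 hball
  have h3 := abs_le.1 (le_refl |Real.log c|)
  rw [abs_le]
  constructor <;> linarith [h1.1, h1.2, h2.1, h2.2, h3.1, h3.2]

section IdealCount

open Ideal UniqueFactorizationMonoid

variable {S : Type*} [CommRing S] [IsDedekindDomain S] [Module.Free ℤ S]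

theorem Ideal.sup_span_mul_sup_span_of_absNorm_eq {I : Ideal S} {m n : ℕ} (h : m.Coprime n)
    (hI : absNorm I = m * n) : (I ⊔ span {(m : S)}) * (I ⊔ span {(n : S)}) = I := by
  have htop : span {(m : S)} ⊔ span {(n : S)} = ⊤ :=
    (isCoprime_span_singleton_iff _ _).2 h.cast |>.sup_eq
  apply le_antisymm
  · rw [Ideal.mul_sup, Ideal.sup_mul, Ideal.sup_mul, span_singleton_mul_span_singleton]
    refine sup_le (sup_le mul_le_left mul_le_right) (sup_le mul_le_left ?_)
    rw [span_singleton_le_iff_mem, ← Nat.cast_mul, ← hI]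
    exact absNorm_mem I
  · calc I = I * (span {(m : S)} ⊔ span {(n : S)}) := by rw [htop, mul_top]
      _ ≤ _ := by
        rw [Ideal.mul_sup]
        refine sup_le ?_ (Ideal.mul_mono le_sup_left le_sup_right)
        rw [mul_comm]
        exact Ideal.mul_mono le_sup_right le_sup_left

theorem Ideal.mul_sup_span_of_absNorm_eq {I J : Ideal S} {m n : ℕ} (h : m.Coprime n)
    (hI : absNorm I = m) (hJ : absNorm J = n) : I * J ⊔ span {(m : S)} = I := by
  have hm : (m : S) ∈ I := hI ▸ absNorm_mem I
  have hn : (n : S) ∈ J := hJ ▸ absNorm_mem J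
  have htop : J ⊔ span {(m : S)} = ⊤ := by
    rw [eq_top_iff, ← (isCoprime_span_singleton_iff (n : S) (m : S)).2 h.symm.cast |>.sup_eq]
    exact sup_le_sup_right ((span_singleton_le_iff_mem _).2 hn) _
  apply le_antisymm
  · exact sup_le mul_le_left ((span_singleton_le_iff_mem _).2 hm)
  · calc I = I * (J ⊔ span {(m : S)}) := by rw [htop, mul_top]
      _ ≤ _ := by
        rw [Ideal.mul_sup]
        exact sup_le_sup_left mul_le_right _

theorem Ideal.absNorm_sup_span_of_absNorm_eq [Module.Finite ℤ S] {I : Ideal S} {m n : ℕ}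
    (h : m.Coprime n) (hI : absNorm I = m * n) :
    absNorm (I ⊔ span {(m : S)}) = m ∧ absNorm (I ⊔ span {(n : S)}) = n := by
  have hmul : absNorm (I ⊔ span {(m : S)}) * absNorm (I ⊔ span {(n : S)}) = m * n := by
    rw [← map_mul, sup_span_mul_sup_span_of_absNorm_eq h hI, hI]
  have hdvd (k : ℕ) : absNorm (I ⊔ span {(k : S)}) ∣ k ^ Module.finrank ℤ S := by
    rw [← absNorm_span_natCast]
    exact absNorm_dvd_absNorm_of_le le_sup_right
  have h1 : absNorm (I ⊔ span {(m : S)}) ∣ m :=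
    ((h.pow_left _).coprime_dvd_left (hdvd m)).dvd_of_dvd_mul_right (hmul ▸ dvd_mul_right _ _)
  have h2 : absNorm (I ⊔ span {(n : S)}) ∣ n :=
    ((h.symm.pow_left _).coprime_dvd_left (hdvd n)).dvd_of_dvd_mul_left (hmul ▸ dvd_mul_left _ _)
  refine ⟨Nat.dvd_antisymm h1 ?_, Nat.dvd_antisymm h2 ?_⟩
  · exact (h.coprime_dvd_right h2).dvd_of_dvd_mul_right (hmul ▸ dvd_mul_right _ _)
  · exact (h.symm.coprime_dvd_right h1).dvd_of_dvd_mul_left (hmul ▸ dvd_mul_left _ _)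

theorem Ideal.card_absNorm_eq_mul [Module.Finite ℤ S] {m n : ℕ} (h : m.Coprime n) :
    Nat.card {I : Ideal S // absNorm I = m * n} =
      Nat.card {I : Ideal S // absNorm I = m} * Nat.card {I : Ideal S // absNorm I = n} := by
  rw [← Nat.card_prod]
  refine Nat.card_congr
    { toFun I := ⟨⟨I ⊔ span {(m : S)}, (absNorm_sup_span_of_absNorm_eq h I.2).1⟩,
        ⟨I ⊔ span {(n : S)}, (absNorm_sup_span_of_absNorm_eq h I.2).2⟩⟩
      invFun P := ⟨P.1 * P.2, by rw [map_mul, P.1.2, P.2.2]⟩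
      left_inv I := Subtype.ext (sup_span_mul_sup_span_of_absNorm_eq h I.2)
      right_inv P := Prod.ext (Subtype.ext (mul_sup_span_of_absNorm_eq h P.1.2 P.2.2))
        (Subtype.ext ?_) }
  change P.1.1 * P.2.1 ⊔ _ = _
  rw [mul_comm]
  exact mul_sup_span_of_absNorm_eq h.symm P.2.2 P.1.2

theorem Ideal.card_absNorm_eq_one : Nat.card {I : Ideal S // absNorm I = 1} = 1 := by
  simp [absNorm_eq_one_iff]

theorem Ideal.dvd_absNorm_of_dvd_absNorm_pow {p k : ℕ} (hp : p.Prime) {P : Ideal S} (hP : P ≠ ⊤)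
    (h : absNorm P ∣ p ^ k) : p ∣ absNorm P := by
  obtain ⟨j, -, hj⟩ := (Nat.dvd_prime_pow hp).1 h
  rcases j with _ | j
  · exact absurd (absNorm_eq_one_iff.1 (by simpa using hj)) hP
  · exact hj ▸ dvd_pow_self p j.succ_ne_zero

open Classical in
theorem Ideal.card_normalizedFactors_span_le [Module.Finite ℤ S] [CharZero S] {p : ℕ}
    (hp : p.Prime) :
    (normalizedFactors (span {(p : S)})).toFinset.card ≤ Module.finrank ℤ S := by
  have hp0 : span {(p : S)} ≠ ⊥ := by simpa using hp.ne_zero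
  refine (Multiset.toFinset_card_le _).trans ?_
  have hprod : ((normalizedFactors (span {(p : S)})).map absNorm).prod =
      p ^ Module.finrank ℤ S := by
    rw [← map_multiset_prod, prod_normalizedFactors_eq_self hp0, absNorm_span_natCast]
  have hle : p ^ Multiset.card (normalizedFactors (span {(p : S)})) ∣ p ^ Module.finrank ℤ S := by
    rw [← hprod, ← Multiset.prod_replicate, ← Multiset.map_const']
    refine Multiset.prod_dvd_prod_of_dvd _ _ fun P hP ↦ ?_
    refine dvd_absNorm_of_dvd_absNorm_pow hp
      ((mem_normalizedFactors_iff hp0).1 hP).1.ne_top (k := Module.finrank ℤ S) ?_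
    rw [← absNorm_span_natCast]
    exact absNorm_dvd_absNorm_of_le ((mem_normalizedFactors_iff hp0).1 hP).2
  exact (Nat.pow_dvd_pow_iff_le_right hp.one_lt).1 hle

open Classical in
theorem Ideal.card_absNorm_eq_prime_pow_le [Module.Finite ℤ S] [CharZero S] {p : ℕ}
    (hp : p.Prime) (k : ℕ) :
    Nat.card {I : Ideal S // absNorm I = p ^ k} ≤ (k + 1) ^ Module.finrank ℤ S := by
  have hp0 : span {(p : S)} ≠ ⊥ := by simpa using hp.ne_zero
  set T := (normalizedFactors (span {(p : S)})).toFinset with hT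
  have hne (I : {I : Ideal S // absNorm I = p ^ k}) : I.1 ≠ ⊥ := by
    intro h
    have := I.2
    rw [h, absNorm_bot] at this
    exact (pow_ne_zero k hp.ne_zero) this.symm
  have hmem (I : {I : Ideal S // absNorm I = p ^ k}) (P : Ideal S)
      (hP : P ∈ normalizedFactors I.1) : P ∈ T := by
    have h := (mem_normalizedFactors_iff (hne I)).1 hP
    rw [hT, Multiset.mem_toFinset, mem_normalizedFactors_iff hp0]
    refine ⟨h.1, (span_singleton_le_iff_mem _).2 (h.1.mem_of_pow_mem k ?_)⟩
    have := absNorm_mem I.1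
    rw [I.2] at this
    exact h.2 (by exact_mod_cast this)
  have hcount (I : {I : Ideal S // absNorm I = p ^ k}) (P : Ideal S) :
      (normalizedFactors I.1).count P < k + 1 := by
    by_cases hP : P ∈ normalizedFactors I.1
    · rw [Nat.lt_succ_iff]
      have hdvd : P ^ (normalizedFactors I.1).count P ∣ I.1 := by
        conv_rhs => rw [← prod_normalizedFactors_eq_self (hne I)]
        rw [← Multiset.prod_replicate]
        exact Multiset.prod_dvd_prod_of_le (Multiset.le_count_iff_replicate_le.1 le_rfl)
      have h1 : absNorm P ∣ p ^ k := I.2 ▸ map_dvd absNorm (dvd_of_mem_normalizedFactors hP)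
      have h2 : absNorm P ^ (normalizedFactors I.1).count P ∣ p ^ k := by
        rw [← map_pow]
        exact (map_dvd absNorm hdvd).trans I.2.dvd
      have h3 := dvd_absNorm_of_dvd_absNorm_pow hp
        ((mem_normalizedFactors_iff (hne I)).1 hP).1.ne_top h1
      exact (Nat.pow_dvd_pow_iff_le_right hp.one_lt).1 ((pow_dvd_pow_of_dvd h3 _).trans h2)
    · rw [Multiset.count_eq_zero_of_notMem hP]
      exact k.succ_pos
  let F : {I : Ideal S // absNorm I = p ^ k} → (T → Fin (k + 1)) :=
    fun I P ↦ ⟨(normalizedFactors I.1).count P.1, hcount I P.1⟩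
  have hF : Function.Injective F := by
    intro I J hIJ
    apply Subtype.ext
    rw [← prod_normalizedFactors_eq_self (hne I), ← prod_normalizedFactors_eq_self (hne J)]
    congr 1
    ext P
    by_cases hP : P ∈ T
    · exact congrArg Fin.val (congrFun hIJ ⟨P, hP⟩)
    · rw [Multiset.count_eq_zero_of_notMem fun h ↦ hP (hmem I P h),
        Multiset.count_eq_zero_of_notMem fun h ↦ hP (hmem J P h)]
  calc _ ≤ Nat.card (T → Fin (k + 1)) := Nat.card_le_card_of_injective F hF
    _ = (k + 1) ^ T.card := by simp
    _ ≤ _ := Nat.pow_le_pow_right k.succ_pos (card_normalizedFactors_span_le hp)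

theorem Ideal.card_absNorm_eq_prime {p : ℕ} (hp : p.Prime) :
    Nat.card {I : Ideal S // absNorm I = p} = Nat.card (S →+* ZMod p) := by
  have : Fact p.Prime := ⟨hp⟩
  have hker (φ : S →+* ZMod p) : absNorm (RingHom.ker φ) = p := by
    rw [absNorm_apply, Submodule.cardQuot_apply]
    have e := RingHom.quotientKerEquivOfSurjective (ZMod.ringHom_surjective φ)
    exact (Nat.card_congr e.toEquiv).trans (Nat.card_zmod p)
  symm
  refine Nat.card_congr (Equiv.ofBijective (fun φ ↦ ⟨RingHom.ker φ, hker φ⟩) ⟨?_, ?_⟩)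
  · intro φ ψ h
    have hk : RingHom.ker φ = RingHom.ker ψ := congrArg Subtype.val h
    ext x
    obtain ⟨z, hz⟩ := ZMod.intCast_surjective (φ x)
    have h1 : x - (z : S) ∈ RingHom.ker φ := by
      rw [RingHom.mem_ker, map_sub, map_intCast, hz, sub_self]
    rw [hk, RingHom.mem_ker, map_sub, map_intCast, sub_eq_zero] at h1
    rw [h1, hz]
  · rintro ⟨I, hI⟩
    have hcard : Nat.card (S ⧸ I) = p := by
      rw [← hI, absNorm_apply, Submodule.cardQuot_apply]
    have hfin : Finite (S ⧸ I) := Nat.finite_of_card_ne_zero (hcard ▸ hp.ne_zero)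
    have := Fintype.ofFinite (S ⧸ I)
    let e := ZMod.ringEquivOfPrime (S ⧸ I) hp (by rw [← Nat.card_eq_fintype_card, hcard])
    refine ⟨(e.symm : (S ⧸ I) →+* ZMod p).comp (Ideal.Quotient.mk I), Subtype.ext ?_⟩
    ext x
    simp [RingHom.mem_ker, Ideal.Quotient.eq_zero_iff_mem]

end IdealCount

section NumberField

open NumberField Ideal

theorem NumberField.dedekindZeta_ofReal (K : Type*) [Field K] [NumberField K] {s : ℝ}
    (hs : s ≠ 0) : dedekindZeta K s =
      ((∑' n : ℕ, (Nat.card {I : Ideal (𝓞 K) // absNorm I = n} : ℝ) * (n : ℝ) ^ (-s) : ℝ) : ℂ) := by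
  rw [dedekindZeta, LSeries, Complex.ofReal_tsum]
  refine tsum_congr fun n ↦ ?_
  rcases eq_or_ne n 0 with rfl | hn
  · simp [Real.zero_rpow (neg_ne_zero.2 hs)]
  · rw [LSeries.term_of_ne_zero hn, Real.rpow_neg n.cast_nonneg, div_eq_mul_inv]
    push_cast
    rw [Complex.ofReal_cpow n.cast_nonneg]
    simp

/-- The primes `p`, weighted by the number of primes of degree one of `K` above `p`, have the
logarithmic singularity of the Dedekind zeta function of `K`. -/
theorem NumberField.exists_abs_tsum_card_ringHom_add_log_le (K : Type*) [Field K]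
    [NumberField K] : ∃ C : ℝ, ∀ᶠ s in 𝓝[>] (1 : ℝ),
      Summable (fun p : Nat.Primes ↦ (Nat.card (𝓞 K →+* ZMod p) : ℝ) * (p : ℝ) ^ (-s)) ∧
      |(∑' p : Nat.Primes, (Nat.card (𝓞 K →+* ZMod p) : ℝ) * (p : ℝ) ^ (-s)) +
        Real.log (s - 1)| ≤ C := by
  simp_rw [← fun p : Nat.Primes ↦ card_absNorm_eq_prime (S := 𝓞 K) p.2]
  refine exists_abs_tsum_primes_add_log_le
    (f := fun n ↦ (Nat.card {I : Ideal (𝓞 K) // absNorm I = n} : ℝ))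
    (D := Module.finrank ℤ (𝓞 K)) (c := dedekindZeta_residue K) (fun n ↦ Nat.cast_nonneg _)
    (by exact_mod_cast card_absNorm_eq_one) (fun h ↦ by exact_mod_cast card_absNorm_eq_mul h)
    (fun p k hp ↦ by exact_mod_cast card_absNorm_eq_prime_pow_le hp k)
    (dedekindZeta_residue_pos K) ?_
  have h := (Complex.continuous_re.tendsto _).comp (tendsto_sub_one_mul_dedekindZeta_nhdsGT K)
  refine (h.congr' ?_).trans (by simp)
  filter_upwards [self_mem_nhdsWithin] with s hs
  have hs0 : s ≠ 0 := (zero_lt_one.trans hs).ne'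
  rw [Function.comp_apply, dedekindZeta_ofReal K hs0, ← Complex.ofReal_one, ← Complex.ofReal_sub,
    ← Complex.ofReal_mul, Complex.ofReal_re]

/-- A linear combination, with positive sum of the coefficients, of the numbers of degree one primes
above `p` in finitely many number fields is nonzero for infinitely many primes `p`. -/
theorem NumberField.infinite_setOf_prime_sum_card_ringHom_ne_zero {ι : Type*} (t : Finset ι)
    (K : ι → Type*) [∀ i, Field (K i)] [∀ i, NumberField (K i)] (c : ι → ℝ)
    (hc : 0 < ∑ i ∈ t, c i) :
    {p : ℕ | p.Prime ∧ ∑ i ∈ t, c i * (Nat.card (𝓞 (K i) →+* ZMod p) : ℝ) ≠ 0}.Infinite := by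
  intro hfin
  choose C hC using fun i ↦ exists_abs_tsum_card_ringHom_add_log_le (K i)
  let v : ℕ → ℝ := fun p ↦ ∑ i ∈ t, c i * (Nat.card (𝓞 (K i) →+* ZMod p) : ℝ)
  have hfin' : {p : Nat.Primes | v p ≠ 0}.Finite := by
    refine Set.Finite.of_finite_image (hfin.subset ?_) (Subtype.val_injective.injOn)
    rintro _ ⟨p, hp, rfl⟩
    exact ⟨p.2, hp⟩
  have hall : ∀ᶠ s in 𝓝[>] (1 : ℝ), ∀ i ∈ t,
      Summable (fun p : Nat.Primes ↦ (Nat.card (𝓞 (K i) →+* ZMod p) : ℝ) * (p : ℝ) ^ (-s)) ∧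
      |(∑' p : Nat.Primes, (Nat.card (𝓞 (K i) →+* ZMod p) : ℝ) * (p : ℝ) ^ (-s)) +
        Real.log (s - 1)| ≤ C i := (eventually_all_finset t).2 fun i _ ↦ hC i
  have hbound : ∀ᶠ s in 𝓝[>] (1 : ℝ), -((∑ i ∈ t, c i) * Real.log (s - 1)) ≤
      ∑ p ∈ hfin'.toFinset, |v p| + ∑ i ∈ t, |c i| * C i := by
    filter_upwards [hall, self_mem_nhdsWithin] with s hs hs1
    have hs1 : 1 < s := hs1
    have hsum : ∑ i ∈ t, c i * ∑' p : Nat.Primes,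
        (Nat.card (𝓞 (K i) →+* ZMod p) : ℝ) * (p : ℝ) ^ (-s) =
        ∑ p ∈ hfin'.toFinset, v p * (p : ℝ) ^ (-s) := by
      simp_rw [← tsum_mul_left]
      rw [← Summable.tsum_finsetSum fun i hi ↦ (hs i hi).1.mul_left _]
      rw [← tsum_eq_sum (L := .unconditional _) (f := fun p : Nat.Primes ↦ v p * (p : ℝ) ^ (-s))]
      · refine tsum_congr fun p ↦ ?_
        rw [Finset.sum_mul]
        exact Finset.sum_congr rfl fun i _ ↦ by ring
      · intro p hp
        have : v p = 0 := by simpa using hp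
        rw [this, zero_mul]
    have h1 : ∑ p ∈ hfin'.toFinset, v p * (p : ℝ) ^ (-s) ≤ ∑ p ∈ hfin'.toFinset, |v p| := by
      refine Finset.sum_le_sum fun p _ ↦ ?_
      have hp1 : (1 : ℝ) ≤ p := by exact_mod_cast p.2.one_le
      calc v p * (p : ℝ) ^ (-s) ≤ |v p| * (p : ℝ) ^ (-s) := by
            gcongr
            exact le_abs_self _
        _ ≤ |v p| * 1 := by
            gcongr
            exact Real.rpow_le_one_of_one_le_of_nonpos hp1 (by linarith)
        _ = |v p| := mul_one _
    have h2 : ∑ i ∈ t, (-(c i) * ((∑' p : Nat.Primes,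
        (Nat.card (𝓞 (K i) →+* ZMod p) : ℝ) * (p : ℝ) ^ (-s)) + Real.log (s - 1))) ≤
        ∑ i ∈ t, |c i| * C i := by
      refine Finset.sum_le_sum fun i hi ↦ ?_
      refine (le_abs_self _).trans ?_
      rw [abs_mul, abs_neg]
      exact mul_le_mul_of_nonneg_left (hs i hi).2 (abs_nonneg _)
    have h3 : ∑ i ∈ t, (-(c i) * ((∑' p : Nat.Primes,
        (Nat.card (𝓞 (K i) →+* ZMod p) : ℝ) * (p : ℝ) ^ (-s)) + Real.log (s - 1))) =
        -(∑ p ∈ hfin'.toFinset, v p * (p : ℝ) ^ (-s)) - (∑ i ∈ t, c i) * Real.log (s - 1) := by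
      rw [← hsum, Finset.sum_mul, ← Finset.sum_neg_distrib, ← Finset.sum_sub_distrib]
      exact Finset.sum_congr rfl fun i _ ↦ by ring
    linarith
  have htend : Tendsto (fun s : ℝ ↦ -((∑ i ∈ t, c i) * Real.log (s - 1))) (𝓝[>] 1) atTop := by
    refine tendsto_neg_atBot_atTop.comp (Tendsto.const_mul_atBot hc ?_)
    refine Real.tendsto_log_nhdsGT_zero.comp (tendsto_nhdsWithin_iff.2 ⟨?_, ?_⟩)
    · exact ((continuous_sub_right (1 : ℝ)).tendsto' 1 0 (sub_self 1)).mono_left nhdsWithin_le_nhds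
    · filter_upwards [self_mem_nhdsWithin] with s hs
      exact sub_pos.2 (Set.mem_Ioi.1 hs)
  obtain ⟨s, h1, h2⟩ := (hbound.and (htend.eventually_gt_atTop _)).exists
  exact absurd h1 (not_le.2 h2)

end NumberField

end DegreeOnePrimes

section Frobenius

theorem RingHom.apply_eq_self_of_pow_eq_intCast {R F : Type*} [CommRing R] [IsDomain R] [CommRing F]
    [IsDomain F] {n : ℕ} [CharP F (n + 1)] (σ : R →+* R) (f : R →+* F)
    (hf : ∀ x, f (σ x) = f x ^ (n + 1)) {x : R} {a : ℤ} (hx : x ^ n = a)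
    (ha : (a : ZMod (n + 1)) = 1) : σ x = x := by
  have hfa : f x ^ n = 1 := by
    have h := congrArg (ZMod.castHom dvd_rfl F) ha
    rw [map_one, map_intCast] at h
    rw [← map_pow, hx, map_intCast, h]
  have hfx : f (σ x) = f x := by rw [hf, pow_succ, hfa, one_mul]
  by_contra hne
  have h0 : (σ x - x) * ∑ i ∈ Finset.range n, σ x ^ i * x ^ (n - 1 - i) = 0 := by
    rw [mul_comm, geom_sum₂_mul, ← map_pow, hx, map_intCast, sub_self]
  have h1 := congrArg f ((mul_eq_zero.1 h0).resolve_left (sub_ne_zero.2 hne))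
  simp only [map_sum, map_mul, map_pow, hfx, map_zero] at h1
  rw [geom_sum₂_self] at h1
  have hn : (n : F) = -1 := by
    have := CharP.cast_eq_zero F (n + 1)
    rw [Nat.cast_add, Nat.cast_one] at this
    exact eq_neg_of_add_eq_zero_left this
  rw [hn, neg_one_mul, neg_eq_zero] at h1
  rcases Nat.eq_zero_or_pos n with rfl | hn0
  · simp at hn
  · rw [← Nat.sub_add_cancel hn0, pow_succ, h1, zero_mul] at hfa
    exact zero_ne_one hfa

theorem RingHom.dvd_of_apply_eq_self {R F : Type*} [CommRing R] [CommRing F]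
    [IsDomain F] {n : ℕ} [CharP F (n + 1)] (σ : R →+* R) (f : R →+* F)
    (hf : ∀ x, f (σ x) = f x ^ (n + 1)) {g d k : ℕ} (hn : 0 < n)
    (hg : orderOf (g : ZMod (n + 1)) = n)
    (hd : d ∣ n) {c : R} (hσ : σ c = c) (hc : c ^ d = g ^ k) : d ∣ k := by
  obtain ⟨e, rfl⟩ := hd
  have hinj : Function.Injective (ZMod.castHom dvd_rfl F : ZMod (d * e + 1) →+* F) :=
    ZMod.castHom_injective F
  have hfc : f c ^ d = g ^ k := by rw [← map_pow, hc, map_pow, map_natCast]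
  have hd0 : d ≠ 0 := by rintro rfl; simp at hn
  have he0 : 0 < e := Nat.pos_of_ne_zero (by rintro rfl; simp at hn)
  have hgF : (g : F) ^ (d * e) = 1 := by
    have h := congrArg (ZMod.castHom dvd_rfl F) (pow_orderOf_eq_one (g : ZMod (d * e + 1)))
    rwa [hg, map_pow, map_natCast, map_one] at h
  have hgu : (g : F) ≠ 0 := by
    intro h
    rw [h, zero_pow hn.ne'] at hgF
    exact zero_ne_one hgF
  have hfc0 : f c ≠ 0 := by
    intro h
    rw [h, zero_pow hd0] at hfc
    exact pow_ne_zero k hgu hfc.symm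
  have h1 : f c ^ (d * e) = 1 := by
    have := hf c
    rw [hσ, pow_succ] at this
    exact mul_right_cancel₀ hfc0 (by rw [← this, one_mul])
  rw [pow_mul, hfc, ← pow_mul] at h1
  have h2 : (g : ZMod (d * e + 1)) ^ (k * e) = 1 := hinj (by
    rw [map_pow, map_natCast, map_one, h1])
  have h3 := orderOf_dvd_of_pow_eq_one h2
  rw [hg] at h3
  exact Nat.dvd_of_mul_dvd_mul_right he0 h3

open NumberField

theorem NumberField.exists_frobenius (K : Type*) [Field K] [NumberField K] [IsGalois ℚ K] (q : ℕ)
    [hq : Fact q.Prime] : ∃ (σ : Gal(K/ℚ)) (Q : Ideal (𝓞 K)), Q.IsPrime ∧ CharP (𝓞 K ⧸ Q) q ∧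
      ∀ x : 𝓞 K, Ideal.Quotient.mk Q (σ • x) = Ideal.Quotient.mk Q x ^ q := by
  have hP : (Ideal.span {(q : ℤ)}).IsMaximal :=
    PrincipalIdealRing.isMaximal_of_irreducible (Nat.prime_iff_prime_int.1 hq.out).irreducible
  obtain ⟨Q, hQ, hQP⟩ := Ideal.exists_maximal_ideal_liesOver_of_isIntegral
    (S := 𝓞 K) (Ideal.span {(q : ℤ)})
  have hQ0 : Q ≠ ⊥ := Ideal.ne_bot_of_liesOver_of_ne_bot
    (by simpa using hq.out.ne_zero : Ideal.span {(q : ℤ)} ≠ ⊥) Q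
  have := Q.finiteQuotientOfFreeOfNeBot hQ0
  obtain ⟨σ, hσ⟩ := IsArithFrobAt.exists_of_isInvariant ℤ Gal(K/ℚ) Q
  have hunder : Q.under ℤ = Ideal.span {(q : ℤ)} := hQP.over.symm
  refine ⟨σ, Q, hQ.isPrime, ?_, fun x ↦ ?_⟩
  · refine ⟨fun x ↦ ?_⟩
    rw [← map_natCast (Ideal.Quotient.mk Q), Ideal.Quotient.eq_zero_iff_mem,
      ← Int.natCast_dvd_natCast, ← Ideal.mem_span_singleton, ← hunder, Ideal.mem_comap, map_natCast]
  · have := hσ.mk_apply x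
    rw [hunder, Int.card_ideal_quot] at this
    exact this

theorem IntermediateField.exists_isGalois_forall_mem (k Ω : Type*) [Field k] [Field Ω] [CharZero k]
    [Algebra k Ω] [Normal k Ω] (s : Finset Ω) :
    ∃ K : IntermediateField k Ω, FiniteDimensional k K ∧ IsGalois k K ∧ ∀ x ∈ s, x ∈ K := by
  let L := IntermediateField.adjoin k (s : Set Ω)
  have : FiniteDimensional k L :=
    IntermediateField.finiteDimensional_adjoin fun x _ ↦ Normal.isIntegral ‹_› x
  exact ⟨IntermediateField.normalClosure k L Ω, normalClosure.is_finiteDimensional .., ⟨⟩,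
    fun x hx ↦ L.le_normalClosure (IntermediateField.subset_adjoin k _ hx)⟩

theorem NumberField.exists_isGalois_forall_mem (s : Finset (AlgebraicClosure ℚ)) :
    ∃ K : Subfield (AlgebraicClosure ℚ), ∃ _ : NumberField K, IsGalois ℚ K ∧ ∀ x ∈ s, x ∈ K := by
  let : Algebra ℚ (AlgebraicClosure ℚ) := AlgebraicClosure.instAlgebra ℚ
  have : Normal ℚ (AlgebraicClosure ℚ) := IsAlgClosure.normal ..
  obtain ⟨K, hf, hG, hs⟩ := IntermediateField.exists_isGalois_forall_mem ℚ (AlgebraicClosure ℚ) s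
  have h : K.algebra' = (DivisionRing.toRatAlgebra : Algebra ℚ K) := Subsingleton.elim _ _
  have hf : @FiniteDimensional ℚ K _ _ K.algebra'.toModule := hf
  rw [h] at hG hf
  exact ⟨K.toSubfield, { to_finiteDimensional := hf }, hG, hs⟩

/-- There is a number field `L` where each `m ∈ M`, up to multiplication by a power of `g`, is an
`n`-th power, but no power of `g` is a `d`-th power with `d ∣ n` unless `d` divides the exponent. -/
theorem NumberField.exists_pow_eq_mul_pow {n : ℕ} (hn : 0 < n) (hq : (n + 1).Prime) {g : ℕ}
    (hg : orderOf (g : ZMod (n + 1)) = n) (M : Finset ℤ)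
    (hM : ∀ m ∈ M, (m : ZMod (n + 1)) ≠ 0) :
    ∃ (L : Type) (_ : Field L) (_ : NumberField L), (∃ ζ : L, IsPrimitiveRoot ζ n) ∧
      (∀ m ∈ M, ∃ (e : ℕ) (β : 𝓞 L), (m : ZMod (n + 1)) * g ^ e = 1 ∧ β ^ n = m * g ^ e) ∧
      ∀ d k : ℕ, d ∣ n → ∀ c : L, c ^ d = g ^ k → d ∣ k := by
  have : Fact (n + 1).Prime := ⟨hq⟩
  have : NeZero n := ⟨hn.ne'⟩
  choose r hr using fun m : ℤ ↦ IsAlgClosed.exists_pow_nat_eq (m : AlgebraicClosure ℚ) hn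
  obtain ⟨z, hz⟩ := HasEnoughRootsOfUnity.exists_primitiveRoot (AlgebraicClosure ℚ) n
  classical
  obtain ⟨K, hK, hKG, hKs⟩ := exists_isGalois_forall_mem
    (insert z (insert (r g) (M.image r)))
  obtain ⟨σ, Q, hQ, hQn, hσ⟩ := exists_frobenius K (n + 1)
  let L := IntermediateField.fixedField (Subgroup.zpowers σ)
  have hL {x : K} (hx : σ x = x) : x ∈ L := by
    rintro ⟨τ, hτ⟩
    have h : Subgroup.zpowers σ ≤ MulAction.stabilizer Gal(K/ℚ) x := by
      rw [Subgroup.zpowers_le]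
      exact hx
    exact h hτ
  have hL' (x : L) : σ x = x := x.2 ⟨σ, Subgroup.mem_zpowers σ⟩
  have key {x : K} {a : ℤ} (hx : x ^ n = a) (ha : (a : ZMod (n + 1)) = 1) : x ∈ L := by
    let y : 𝓞 K := ⟨x, IsIntegral.of_pow hn (hx ▸ isIntegral_intCast a)⟩
    have h := RingHom.apply_eq_self_of_pow_eq_intCast (MulSemiringAction.toRingHom _ (𝓞 K) σ)
      (Ideal.Quotient.mk Q) hσ (x := y) (a := a)
      (RingOfIntegers.coe_injective (by rw [map_pow, map_intCast]; exact hx)) ha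
    exact hL (congrArg (algebraMap (𝓞 K) K) h)
  refine ⟨L, inferInstance, inferInstance, ?_, fun m hm ↦ ?_, fun d k hd c hc ↦ ?_⟩
  · let z' : K := ⟨z, hKs z (by simp)⟩
    have hz' : IsPrimitiveRoot z' n := IsPrimitiveRoot.coe_submonoidClass_iff.1 hz
    have : z' ∈ L := key (a := 1) (by rw [hz'.pow_eq_one, Int.cast_one]) (Int.cast_one)
    exact ⟨⟨z', this⟩, IsPrimitiveRoot.coe_submonoidClass_iff.1 hz'⟩
  · obtain ⟨e, he⟩ : ∃ e : ℕ, (m : ZMod (n + 1)) * g ^ e = 1 := by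
      have hg0 : (g : ZMod (n + 1)) ≠ 0 := by
        intro h
        have := pow_orderOf_eq_one (g : ZMod (n + 1))
        rw [hg, h, zero_pow hn.ne'] at this
        exact zero_ne_one this
      have hgu := IsPrimitiveRoot.orderOf (g : ZMod (n + 1))
      rw [hg] at hgu
      obtain ⟨e, -, he⟩ := hgu.eq_pow_of_pow_eq_one (ξ := (m : ZMod (n + 1))⁻¹) (by
        rw [inv_pow, inv_eq_one]
        simpa using ZMod.pow_card_sub_one_eq_one (hM m hm))
      exact ⟨e, by rw [he, mul_inv_cancel₀ (hM m hm)]⟩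
    let α : K := ⟨r m, hKs _ (Finset.mem_insert_of_mem
      (Finset.mem_insert_of_mem (Finset.mem_image_of_mem r hm)))⟩
    let γ : K := ⟨r g, hKs _ (Finset.mem_insert_of_mem (Finset.mem_insert_self _ _))⟩
    have hβ : (α * γ ^ e) ^ n = ((m * g ^ e : ℤ) : K) := Subtype.ext (by
      push_cast
      rw [mul_pow, hr, ← pow_mul, mul_comm e, pow_mul, hr, Int.cast_natCast])
    obtain ⟨β, hβ⟩ : ∃ β : L, β ^ n = ((m * g ^ e : ℤ) : L) :=
      ⟨⟨α * γ ^ e, key hβ (by push_cast; exact he)⟩, Subtype.ext hβ⟩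
    let β' : 𝓞 L := ⟨β, IsIntegral.of_pow hn (hβ ▸ isIntegral_intCast _)⟩
    refine ⟨e, β', he, RingOfIntegers.coe_injective ?_⟩
    rw [map_pow, map_mul, map_intCast, map_pow, map_natCast]
    exact hβ.trans (by push_cast; rfl)
  · let c' : 𝓞 L := ⟨c, IsIntegral.of_pow (Nat.pos_of_dvd_of_pos hd hn)
      (hc ▸ (isIntegral_natCast g).pow k)⟩
    refine RingHom.dvd_of_apply_eq_self (MulSemiringAction.toRingHom _ (𝓞 K) σ)
      (Ideal.Quotient.mk Q) hσ hn hg hd (c := algebraMap (𝓞 L) (𝓞 K) c') ?_ ?_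
    · exact RingOfIntegers.coe_injective (hL' c)
    · have : c' ^ d = (g : 𝓞 L) ^ k :=
        RingOfIntegers.coe_injective (by rw [map_pow, map_pow, map_natCast]; exact hc)
      rw [← map_pow, this, map_pow, map_natCast]

open Polynomial in
theorem Polynomial.irreducible_X_pow_sub_C_of_forall_dvd {F : Type*} [Field F] {d : ℕ}
    (hd : 0 < d) {a : F} (h : ∀ k : ℕ, ∀ c : F, c ^ d = a ^ k → d ∣ k) :
    Irreducible (X ^ d - C a) := by
  obtain ⟨p, hp, hpi, hpd⟩ := exists_monic_irreducible_factor (X ^ d - C a) (fun hu ↦ by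
    have := natDegree_eq_zero_of_isUnit hu
    rw [natDegree_X_pow_sub_C] at this
    exact hd.ne' this)
  have : Fact (Irreducible p) := ⟨hpi⟩
  have hroot : AdjoinRoot.root p ^ d = AdjoinRoot.of p a := by
    have := (AdjoinRoot.mk_eq_zero (f := p)).2 hpd
    simpa [sub_eq_zero] using this
  have hdvd : d ∣ p.natDegree := h _ (Algebra.norm F (AdjoinRoot.root p)) (by
    rw [← map_pow, hroot, ← AdjoinRoot.algebraMap_eq, Algebra.norm_algebraMap,
      (AdjoinRoot.powerBasis hpi.ne_zero).finrank, AdjoinRoot.powerBasis_dim])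
  have hle := Nat.le_of_dvd hpi.natDegree_pos hdvd
  have := eq_of_monic_of_dvd_of_natDegree_le hp (monic_X_pow_sub_C a hd.ne') hpd
    (by rwa [natDegree_X_pow_sub_C])
  rwa [this]

end Frobenius

section Kummer

open NumberField Polynomial

theorem RingHom.exists_comp_eq_of_natCast_mul_mem_range {R B F : Type*} [CommRing R] [CommRing B]
    [Field F] (j : R →+* B) (φ : R →+* F) (hker : RingHom.ker j ≤ RingHom.ker φ) {N : ℕ}
    (hN : (N : F) ≠ 0) (h : ∀ b, ∃ r, j r = N * b) : ∃ ψ : B →+* F, ψ.comp j = φ := by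
  choose r hr using h
  have hφ {x y : R} (hxy : j x = j y) : φ x = φ y := by
    have : x - y ∈ RingHom.ker j := by rw [RingHom.mem_ker, map_sub, hxy, sub_self]
    exact sub_eq_zero.1 (by rw [← map_sub]; exact hker this)
  refine ⟨⟨⟨⟨fun b ↦ φ (r b) / N, ?_⟩, fun x y ↦ ?_⟩, ?_, fun x y ↦ ?_⟩, ?_⟩
  · rw [hφ (y := (N : R)) (by rw [hr, mul_one, map_natCast]), map_natCast, div_self hN]
  · have : φ (r (x * y)) * N = φ (r x) * φ (r y) := by
      rw [← map_natCast φ, ← map_mul, ← map_mul]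
      refine hφ ?_
      simp only [map_mul, hr, map_natCast]
      ring
    change φ (r (x * y)) / N = φ (r x) / N * (φ (r y) / N)
    field_simp
    exact this
  · change φ (r 0) / N = 0
    rw [hφ (y := 0) (by rw [hr, mul_zero, map_zero]), map_zero, zero_div]
  · change φ (r (x + y)) / N = φ (r x) / N + φ (r y) / N
    rw [← add_div, ← map_add, hφ (y := r x + r y)]
    simp only [map_add, hr]
    ring
  · ext x
    change φ (r (j x)) / N = φ x
    rw [hφ (y := N * x) (by rw [hr, map_mul, map_natCast]), map_mul, map_natCast,
      mul_div_cancel_left₀ _ hN]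

theorem IsPrimitiveRoot.map_of_natCast_ne_zero {R F : Type*} [CommRing R] [IsDomain R] [Field F]
    (φ : R →+* F) {ζ : R} {d : ℕ} (hζ : IsPrimitiveRoot ζ d) (hd : (d : F) ≠ 0) :
    IsPrimitiveRoot (φ ζ) d := by
  have : NeZero (d : F) := ⟨hd⟩
  have : NeZero (d : R) := ⟨fun h ↦ hd (by rw [← map_natCast φ, h, map_zero])⟩
  rw [← isRoot_cyclotomic_iff] at hζ ⊢
  rw [← map_cyclotomic d φ]
  exact hζ.map

theorem IsPrimitiveRoot.natCard_pow_eq {F : Type*} [Field F] {ζ a : F} {d : ℕ} (hd : 0 < d)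
    (hζ : IsPrimitiveRoot ζ d) (ha : a ≠ 0) [Decidable (∃ x : F, x ^ d = a)] :
    Nat.card {x : F // x ^ d = a} = if ∃ x : F, x ^ d = a then d else 0 := by
  classical
  have e : {x : F | x ^ d = a} = ((nthRoots d a).toFinset : Set F) := by
    ext x
    simp [mem_nthRoots hd]
  calc Nat.card {x : F // x ^ d = a} = Set.ncard {x : F | x ^ d = a} := rfl
    _ = (nthRoots d a).toFinset.card := by rw [e, Set.ncard_coe_finset]
    _ = (nthRoots d a).card := Multiset.toFinset_card_of_nodup (hζ.nthRoots_nodup ha)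
    _ = _ := by rw [hζ.card_nthRoots]; congr

section PowerBasis

variable {L E : Type*} [Field L] [NumberField L] [Field E] [NumberField E] [Algebra L E]

theorem NumberField.exists_natCast_mul_eq_aeval (B : PowerBasis L E) (γ : 𝓞 E)
    (hγ : (γ : E) = B.gen) :
    ∃ N : ℕ, N ≠ 0 ∧ ∀ z : 𝓞 E, ∃ P : (𝓞 L)[X], aeval γ P = (N : 𝓞 E) * z := by
  have hint : IsIntegral (𝓞 L) B.gen := hγ ▸ (RingOfIntegers.isIntegral_coe γ).tower_top
  obtain ⟨D, hD⟩ : ∃ D : 𝓞 L, (D : L) = Algebra.discr L B.basis := by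
    have h := Algebra.discr_isIntegral L (R := 𝓞 L) (b := B.basis) fun i ↦ by
      rw [B.coe_basis]; exact hint.pow _
    exact IsIntegrallyClosed.isIntegral_iff.1 h
  have hD0 : D ≠ 0 := by
    rintro rfl
    exact Algebra.discr_not_zero_of_basis L B.basis (hD.symm.trans (map_zero (algebraMap (𝓞 L) L)))
  obtain ⟨D', hD'⟩ := Ideal.mem_span_singleton.1 (Ideal.absNorm_mem (Ideal.span {D}))
  refine ⟨Ideal.absNorm (Ideal.span {D}), by simpa [Ideal.absNorm_eq_zero_iff] using hD0,
    fun z ↦ ?_⟩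
  have hz := Algebra.discr_mul_isIntegral_mem_adjoin L hint (z := (z : E))
    (RingOfIntegers.isIntegral_coe z).tower_top
  rw [Algebra.adjoin_singleton_eq_range_aeval] at hz
  obtain ⟨P, hP⟩ := hz
  refine ⟨C D' * P, RingOfIntegers.coe_injective ?_⟩
  have h1 : ((aeval γ P : 𝓞 E) : E) = Algebra.discr L B.basis • (z : E) := by
    rw [← hP, ← hγ]
    exact (aeval_algebraMap_apply E γ P).symm
  have h2 : ((Ideal.absNorm (Ideal.span {D}) : ℕ) : 𝓞 E) =
      algebraMap (𝓞 L) (𝓞 E) D' * algebraMap (𝓞 L) (𝓞 E) D := by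
    rw [← map_mul, mul_comm, ← hD', map_natCast]
  have h3 : algebraMap (𝓞 E) E (algebraMap (𝓞 L) (𝓞 E) D) = algebraMap L E (D : L) := rfl
  calc algebraMap (𝓞 E) E (aeval γ (C D' * P))
      = algebraMap (𝓞 E) E (algebraMap (𝓞 L) (𝓞 E) D') *
          (algebraMap L E (D : L) * algebraMap (𝓞 E) E z) := by
        rw [map_mul, aeval_C, map_mul, hD]
        exact congrArg _ (h1.trans (Algebra.smul_def _ _))
    _ = _ := by rw [h2, map_mul, map_mul, h3, mul_assoc]

open Classical in
/-- For all but finitely many primes `p`, the degree one primes above `p` of a Kummer extension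
`L(g^{1/d})`, `g` a natural number, are counted by those of `L` and the `d`-th roots of `g`
mod `p`. -/
theorem NumberField.exists_card_ringHom_eq_of_minpoly_eq {d g : ℕ} (hd : 0 < d) (hg : g ≠ 0)
    {ζ : L} (hζ : IsPrimitiveRoot ζ d) (B : PowerBasis L E)
    (hB : minpoly L B.gen = X ^ d - C (g : L)) :
    ∃ N : ℕ, N ≠ 0 ∧ ∀ p : ℕ, p.Prime → ¬ p ∣ N → Nat.card (𝓞 E →+* ZMod p) =
      Nat.card (𝓞 L →+* ZMod p) * if ∃ x : ZMod p, x ^ d = g then d else 0 := by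
  have : NeZero d := ⟨hd.ne'⟩
  have hgen : B.gen ^ d = g := by
    have := minpoly.aeval L B.gen
    rw [hB] at this
    simpa [sub_eq_zero] using this
  obtain ⟨γ, hγ⟩ : ∃ γ : 𝓞 E, (γ : E) = B.gen :=
    ⟨⟨B.gen, IsIntegral.of_pow hd (hgen ▸ isIntegral_natCast g)⟩, rfl⟩
  have hγd : γ ^ d = g := RingOfIntegers.coe_injective (by
    rw [map_pow, map_natCast]; exact (congrArg (· ^ d) hγ).trans hgen)
  obtain ⟨N, hN, hNz⟩ := exists_natCast_mul_eq_aeval B γ hγ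
  refine ⟨d * g * N, by positivity, fun p hp hpN ↦ ?_⟩
  have : Fact p.Prime := ⟨hp⟩
  have hne {k : ℕ} (hk : k ∣ d * g * N) : (k : ZMod p) ≠ 0 := fun h ↦
    hpN (((ZMod.natCast_eq_zero_iff _ _).1 h).trans hk)
  have hd0 : (d : ZMod p) ≠ 0 := hne (Dvd.intro _ (mul_assoc _ _ _).symm)
  have hg0 : (g : ZMod p) ≠ 0 := hne (Dvd.intro_left _ rfl |>.mul_right _)
  have hN0 : (N : ZMod p) ≠ 0 := hne (Dvd.intro_left _ rfl)
  have hker (P : (𝓞 L)[X]) (hP : aeval γ P = 0) : (X ^ d - C (g : 𝓞 L)) ∣ P := by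
    rw [← map_dvd_map (algebraMap (𝓞 L) L) (RingOfIntegers.coe_injective)
      (monic_X_pow_sub_C _ hd.ne')]
    have h : (X ^ d - C (g : 𝓞 L)).map (algebraMap (𝓞 L) L) = minpoly L B.gen := by
      rw [hB]; simp
    rw [h]
    refine minpoly.dvd _ _ ?_
    rw [aeval_map_algebraMap, ← hγ]
    exact (aeval_algebraMap_apply E γ P).trans (by rw [hP, map_zero])
  let F : (𝓞 E →+* ZMod p) → (𝓞 L →+* ZMod p) × {x : ZMod p // x ^ d = g} := fun ψ ↦
    ⟨ψ.comp (algebraMap (𝓞 L) (𝓞 E)), ⟨ψ γ, by rw [← map_pow, hγd, map_natCast]⟩⟩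
  have hF : Function.Bijective F := by
    constructor
    · intro ψ₁ ψ₂ h
      have h1 : ψ₁.comp (algebraMap (𝓞 L) (𝓞 E)) = ψ₂.comp (algebraMap (𝓞 L) (𝓞 E)) :=
        congrArg Prod.fst h
      have h2 : ψ₁ γ = ψ₂ γ := congrArg Subtype.val (congrArg Prod.snd h)
      ext z
      obtain ⟨P, hP⟩ := hNz z
      have h3 (ψ : 𝓞 E →+* ZMod p) : (N : ZMod p) * ψ z =
          P.eval₂ (ψ.comp (algebraMap (𝓞 L) (𝓞 E))) (ψ γ) := by
        rw [← hom_eval₂, ← aeval_def, hP, map_mul, map_natCast]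
      exact mul_left_cancel₀ hN0 (by rw [h3, h3, h1, h2])
    · rintro ⟨φ, x, hx⟩
      obtain ⟨ψ, hψ⟩ := RingHom.exists_comp_eq_of_natCast_mul_mem_range
        (aeval γ : (𝓞 L)[X] →ₐ[𝓞 L] 𝓞 E).toRingHom (eval₂RingHom φ x)
        (fun P hP ↦ by
          obtain ⟨Q, rfl⟩ := hker P hP
          simp [RingHom.mem_ker, hx]) hN0 hNz
      refine ⟨ψ, Prod.ext ?_ (Subtype.ext ?_)⟩
      · ext y
        have := congrArg (fun f : (𝓞 L)[X] →+* ZMod p ↦ f (C y)) hψ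
        simp at this
        exact this
      · have := congrArg (fun f : (𝓞 L)[X] →+* ZMod p ↦ f X) hψ
        simpa using this
  rw [Nat.card_congr (Equiv.ofBijective F hF), Nat.card_prod]
  rcases isEmpty_or_nonempty (𝓞 L →+* ZMod p) with h | ⟨⟨φ⟩⟩
  · simp
  · rw [(hζ.toInteger_isPrimitiveRoot.map_of_natCast_ne_zero φ hd0).natCard_pow_eq hd hg0]
    congr

end PowerBasis

universe u

variable {L : Type u} [Field L] [NumberField L]

open Classical in
theorem NumberField.exists_card_ringHom_eq {d g : ℕ} (hd : 0 < d) (hg : g ≠ 0)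
    {ζ : L} (hζ : IsPrimitiveRoot ζ d) (h : ∀ k : ℕ, ∀ c : L, c ^ d = (g : L) ^ k → d ∣ k) :
    ∃ (E : Type u) (_ : Field E) (_ : NumberField E) (N : ℕ), N ≠ 0 ∧
      ∀ p : ℕ, p.Prime → ¬ p ∣ N → Nat.card (𝓞 E →+* ZMod p) =
        Nat.card (𝓞 L →+* ZMod p) * if ∃ x : ZMod p, x ^ d = g then d else 0 := by
  have hirr : Fact (Irreducible (X ^ d - C (g : L))) := ⟨irreducible_X_pow_sub_C_of_forall_dvd hd h⟩
  let B := AdjoinRoot.powerBasis hirr.out.ne_zero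
  have : FiniteDimensional L (AdjoinRoot (X ^ d - C (g : L))) := B.finite
  have : NumberField (AdjoinRoot (X ^ d - C (g : L))) := .of_module_finite L _
  exact ⟨AdjoinRoot (X ^ d - C (g : L)), inferInstance, this,
    exists_card_ringHom_eq_of_minpoly_eq hd hg hζ B
      (AdjoinRoot.minpoly_powerBasis_gen_of_monic (f := X ^ d - C (g : L))
        (monic_X_pow_sub_C _ hd.ne') _)⟩

open ArithmeticFunction ArithmeticFunction.Moebius

theorem ArithmeticFunction.sum_moebius_div_pos {n : ℕ} (hn : 0 < n) :
    0 < ∑ d ∈ n.divisors, (μ d : ℝ) / d := by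
  have hn0 : (n : ℝ) ≠ 0 := by exact_mod_cast hn.ne'
  have h := (sum_eq_iff_sum_mul_moebius_eq (R := ℝ) (f := fun n ↦ (n.totient : ℝ))
    (g := fun n ↦ (n : ℝ))).1 (fun n _ ↦ by exact_mod_cast n.sum_totient) n hn
  have h' : ∑ d ∈ n.divisors, (μ d : ℝ) / d = n.totient / n := by
    rw [← h, Finset.sum_div,
      Nat.sum_divisorsAntidiagonal (f := fun a b : ℕ ↦ (μ a : ℝ) * b / n)]
    refine Finset.sum_congr rfl fun d hd ↦ ?_
    have hd0 : (d : ℝ) ≠ 0 := by exact_mod_cast (Nat.pos_of_mem_divisors hd).ne'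
    rw [Nat.cast_div (Nat.dvd_of_mem_divisors hd) hd0]
    field_simp
  rw [h']
  have := Nat.totient_pos.2 hn
  positivity

theorem ArithmeticFunction.coprime_of_sum_moebius_ne_zero {n k : ℕ} (hn : n ≠ 0)
    (h : ∑ d ∈ n.divisors with d ∣ k, μ d ≠ 0) : n.Coprime k := by
  have hgcd : {d ∈ n.divisors | d ∣ k} = (n.gcd k).divisors := by
    ext d
    simp [Nat.dvd_gcd_iff, hn]
  rw [hgcd, ← coe_mul_zeta_apply, moebius_mul_coe_zeta] at h
  by_contra hne
  exact h (one_apply_ne hne)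

open Classical in
theorem NumberField.infinite_setOf_prime_sum_moebius_ne_zero {n g : ℕ} (hn : 0 < n) (hg : g ≠ 0)
    {ζ : L} (hζ : IsPrimitiveRoot ζ n)
    (h : ∀ d k : ℕ, d ∣ n → ∀ c : L, c ^ d = (g : L) ^ k → d ∣ k) :
    {p : ℕ | p.Prime ∧ Nonempty (𝓞 L →+* ZMod p) ∧
      ∑ d ∈ n.divisors with ∃ x : ZMod p, x ^ d = g, μ d ≠ 0}.Infinite := by
  have hE (d : n.divisors) := exists_card_ringHom_eq (d := d)
    (Nat.pos_of_mem_divisors d.2) hg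
    (hζ.pow hn (Nat.div_mul_cancel (Nat.dvd_of_mem_divisors d.2)).symm)
    fun k ↦ h d k (Nat.dvd_of_mem_divisors d.2)
  choose E hEf hEn N hN hcard using hE
  have hinf := infinite_setOf_prime_sum_card_ringHom_ne_zero Finset.univ E
    (fun d ↦ (μ d : ℝ) / d) (by
      rw [Finset.sum_coe_sort n.divisors fun d ↦ (μ d : ℝ) / d]
      exact sum_moebius_div_pos hn)
  refine (hinf.sdiff (Set.finite_Iic (∏ d, N d))).mono ?_
  rintro p ⟨⟨hp, hsum⟩, hpN⟩
  have hpd (d : n.divisors) : ¬ p ∣ N d := fun hd ↦ hpN (Nat.le_of_dvd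
    (Finset.prod_pos fun d _ ↦ Nat.pos_of_ne_zero (hN d))
    (hd.trans (Finset.dvd_prod_of_mem _ (Finset.mem_univ d))))
  have hsum' : ∑ d : n.divisors, (μ d : ℝ) / (d : ℕ) * (Nat.card (𝓞 (E d) →+* ZMod p) : ℝ) =
      Nat.card (𝓞 L →+* ZMod p) *
        ((∑ d ∈ n.divisors with ∃ x : ZMod p, x ^ d = g, μ d : ℤ) : ℝ) := by
    rw [Finset.sum_filter, ← Finset.sum_coe_sort n.divisors, Int.cast_sum, Finset.mul_sum]
    refine Finset.sum_congr rfl fun d _ ↦ ?_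
    have hd0 : ((d : ℕ) : ℝ) ≠ 0 := by
      exact_mod_cast (Nat.pos_of_mem_divisors d.2).ne'
    rw [hcard d p hp (hpd d)]
    split_ifs
    · push_cast
      field_simp
    · simp
  rw [hsum'] at hsum
  refine ⟨hp, ?_, fun h0 ↦ right_ne_zero_of_mul hsum (by rw [h0, Int.cast_zero])⟩
  have := left_ne_zero_of_mul hsum
  exact (Nat.card_ne_zero.1 (by exact_mod_cast this)).1

end Kummer

section Splitting

open ArithmeticFunction.Moebius

theorem ZMod.orderOf_pow_eq_of_sum_moebius_ne_zero {p n t : ℕ} [hp : Fact p.Prime]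
    (hpn : p - 1 = n * t) {a : ZMod p} (ha : a ≠ 0)
    [DecidablePred fun d : ℕ ↦ ∃ x : ZMod p, x ^ d = a]
    (h : ∑ d ∈ n.divisors with ∃ x : ZMod p, x ^ d = a, μ d ≠ 0) : orderOf (a ^ t) = n := by
  have hp1 : 0 < p - 1 := Nat.sub_pos_of_lt hp.out.one_lt
  have hn : n ≠ 0 := by rintro rfl; omega
  have ht : 0 < t := Nat.pos_of_ne_zero (by rintro rfl; omega)
  obtain ⟨w, hw⟩ := IsCyclic.exists_generator (α := (ZMod p)ˣ)
  have hord : orderOf w = p - 1 := by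
    rw [orderOf_eq_card_of_forall_mem_zpowers hw, Nat.card_eq_fintype_card, ZMod.card_units]
  have hpow (x : ZMod p) (hx : x ≠ 0) : ∃ j : ℕ, (w : ZMod p) ^ j = x := by
    obtain ⟨j, hj⟩ := (mem_powers_iff_mem_zpowers.2 (hw (Units.mk0 x hx)))
    exact ⟨j, by simpa using congrArg Units.val hj⟩
  obtain ⟨k, rfl⟩ := hpow a ha
  have hdvd (d : ℕ) (hd : d ∈ n.divisors) : (∃ x : ZMod p, x ^ d = (w : ZMod p) ^ k) ↔ d ∣ k := by
    have hdn := Nat.dvd_of_mem_divisors hd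
    refine ⟨?_, ?_⟩
    · rintro ⟨x, hx⟩
      have hx0 : x ≠ 0 := by
        rintro rfl
        rw [zero_pow (Nat.pos_of_mem_divisors hd).ne'] at hx
        exact ha hx.symm
      obtain ⟨j, rfl⟩ := hpow x hx0
      rw [← pow_mul, ← Units.val_pow_eq_pow_val, ← Units.val_pow_eq_pow_val, Units.val_inj,
        pow_eq_pow_iff_modEq, hord] at hx
      exact (hx.dvd_iff (hpn ▸ hdn.mul_right t)).1 (dvd_mul_left d j)
    · rintro ⟨j, rfl⟩
      exact ⟨(w : ZMod p) ^ j, by rw [← pow_mul, mul_comm]⟩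
  rw [Finset.filter_congr hdvd] at h
  have hcop := ArithmeticFunction.coprime_of_sum_moebius_ne_zero hn h
  rw [← pow_mul, ← Units.val_pow_eq_pow_val, orderOf_units, orderOf_pow, hord, hpn,
    Nat.gcd_mul_right, hcop.gcd_eq_one, one_mul, Nat.mul_div_cancel _ ht]

theorem splits_of_pow {M : Finset ℤ} {p n t : ℕ} [hp : Fact p.Prime] (hpn : p - 1 = n * t)
    (hcard : M.card = n) (hM : ∀ m ∈ M, (m : ZMod p) ≠ 0)
    (hinj : ∀ m₁ ∈ M, ∀ m₂ ∈ M, (m₁ : ZMod p) ^ t = (m₂ : ZMod p) ^ t → m₁ = m₂) :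
    Splits M p := by
  have hp1 : 0 < p - 1 := Nat.sub_pos_of_lt hp.out.one_lt
  have hn : 0 < n := Nat.pos_of_ne_zero (by rintro rfl; omega)
  have ht : t ≠ 0 := by rintro rfl; omega
  have hpow {x : ZMod p} (hx : x ≠ 0) : x ^ t ∈ Polynomial.nthRootsFinset n (1 : ZMod p) := by
    rw [Polynomial.mem_nthRootsFinset hn, ← pow_mul, mul_comm, ← hpn]
    exact ZMod.pow_card_sub_one_eq_one hx
  have himage : M.image (fun m : ℤ ↦ (m : ZMod p) ^ t) =
      Polynomial.nthRootsFinset n (1 : ZMod p) := by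
    refine Finset.eq_of_subset_of_card_le (Finset.image_subset_iff.2 fun m hm ↦ hpow (hM m hm)) ?_
    rw [Finset.card_image_of_injOn fun m₁ h₁ m₂ h₂ ↦ hinj m₁ h₁ m₂ h₂, hcard,
      Polynomial.nthRootsFinset_def]
    exact (Multiset.toFinset_card_le _).trans (Polynomial.card_nthRoots n 1)
  have hs0 {s : ZMod p} (hs : s ^ t = 1) : s ≠ 0 := by
    rintro rfl
    rw [zero_pow ht] at hs
    exact zero_ne_one hs
  refine ⟨{s | s ^ t = 1}, fun x hx ↦ ?_, ?_⟩
  · obtain ⟨m, hm, hmx⟩ := Finset.mem_image.1 (himage ▸ hpow hx)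
    refine ⟨(m, x / m), ⟨hm, ?_, mul_div_cancel₀ _ (hM m hm)⟩, ?_⟩
    · change (x / m) ^ t = 1
      rw [div_pow, ← hmx, div_self (pow_ne_zero t (hM m hm))]
    · rintro ⟨m', s⟩ ⟨hm', hs, hms⟩
      change s ^ t = 1 at hs
      change (m' : ZMod p) * s = x at hms
      have : m' = m := hinj m' hm' m hm (by
        rw [hmx, ← hms, mul_pow, hs, mul_one])
      subst this
      rw [← hms, mul_div_cancel_left₀ _ (hM m' hm)]
  · rintro ⟨m, hm, s, hs, hms⟩
    exact mul_ne_zero (hM m hm) (hs0 hs) hms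

open NumberField in
theorem infinite_setOf_prime_splits {M : Finset ℤ} {n : ℕ} (hn : 0 < n) (hq : (n + 1).Prime)
    (hcard : M.card = n) (hM0 : ∀ m ∈ M, (m : ZMod (n + 1)) ≠ 0)
    (hinj : ∀ m₁ ∈ M, ∀ m₂ ∈ M, (m₁ : ZMod (n + 1)) = m₂ → m₁ = m₂) :
    {p : ℕ | p.Prime ∧ Splits M p}.Infinite := by
  classical
  have : Fact (n + 1).Prime := ⟨hq⟩
  have : NeZero n := ⟨hn.ne'⟩
  obtain ⟨g, hg⟩ : ∃ g : ℕ, orderOf (g : ZMod (n + 1)) = n := by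
    obtain ⟨w, hw⟩ := IsCyclic.exists_generator (α := (ZMod (n + 1))ˣ)
    refine ⟨(w : ZMod (n + 1)).val, ?_⟩
    rw [ZMod.natCast_zmod_val, orderOf_units, orderOf_eq_card_of_forall_mem_zpowers hw,
      Nat.card_eq_fintype_card, ZMod.card_units, Nat.add_sub_cancel]
  have hg0 : g ≠ 0 := by
    rintro rfl
    have := pow_orderOf_eq_one ((0 : ℕ) : ZMod (n + 1))
    rw [hg, Nat.cast_zero, zero_pow hn.ne'] at this
    exact zero_ne_one this
  obtain ⟨L, _, _, ⟨ζ, hζ⟩, hβ, hd⟩ := exists_pow_eq_mul_pow hn hq hg M hM0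
  have hM {m : ℤ} (hm : m ∈ M) : m ≠ 0 := by
    rintro rfl
    exact hM0 0 hm Int.cast_zero
  let N := n * g * ∏ m ∈ M, m.natAbs
  have hN : 0 < N := Nat.mul_pos (Nat.mul_pos hn (Nat.pos_of_ne_zero hg0))
    (Finset.prod_pos fun m hm ↦ Int.natAbs_pos.2 (hM hm))
  refine ((infinite_setOf_prime_sum_moebius_ne_zero hn hg0 hζ hd).sdiff (Set.finite_Iic N)).mono ?_
  rintro p ⟨⟨hp, ⟨φ⟩, hsum⟩, hpN⟩
  refine ⟨hp, ?_⟩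
  have : Fact p.Prime := ⟨hp⟩
  have hne {k : ℕ} (hk : k ∣ N) : (k : ZMod p) ≠ 0 := fun h ↦
    hpN (Nat.le_of_dvd hN (((ZMod.natCast_eq_zero_iff _ _).1 h).trans hk))
  have hgp : (g : ZMod p) ≠ 0 := hne ((dvd_mul_left g n).mul_right _)
  have hMp : ∀ m ∈ M, (m : ZMod p) ≠ 0 := fun m hm h ↦ by
    refine hne ((Finset.dvd_prod_of_mem Int.natAbs hm).mul_left _) ?_
    rw [ZMod.natCast_eq_zero_iff, ← Int.natCast_dvd]
    exact (ZMod.intCast_zmod_eq_zero_iff_dvd m p).1 h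
  have hζp := hζ.toInteger_isPrimitiveRoot.map_of_natCast_ne_zero φ
    (hne ((dvd_mul_right n g).mul_right _))
  obtain ⟨t, ht⟩ := hζp.dvd_of_pow_eq_one _ (ZMod.pow_card_sub_one_eq_one (hζp.ne_zero hn.ne'))
  have hord := ZMod.orderOf_pow_eq_of_sum_moebius_ne_zero ht hgp (by convert hsum)
  have hχ : ∀ m ∈ M, ∃ e : ℕ, (m : ZMod (n + 1)) * g ^ e = 1 ∧
      (m : ZMod p) ^ t * ((g : ZMod p) ^ t) ^ e = 1 := fun m hm ↦ by
    obtain ⟨e, β, he, hβ⟩ := hβ m hm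
    have hφ : φ β ^ n = m * (g : ZMod p) ^ e := by
      rw [← map_pow, hβ, map_mul, map_pow, map_intCast, map_natCast]
    have hφ0 : φ β ≠ 0 := fun h ↦ by
      rw [h, zero_pow hn.ne'] at hφ
      exact mul_ne_zero (hMp m hm) (pow_ne_zero e hgp) hφ.symm
    refine ⟨e, he, ?_⟩
    rw [← pow_mul, mul_comm t, pow_mul, ← mul_pow, ← hφ, ← pow_mul, ← ht,
      ZMod.pow_card_sub_one_eq_one hφ0]
  refine splits_of_pow ht hcard hMp fun m₁ h₁ m₂ h₂ h ↦ hinj m₁ h₁ m₂ h₂ ?_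
  obtain ⟨e₁, hq₁, hp₁⟩ := hχ m₁ h₁
  obtain ⟨e₂, hq₂, hp₂⟩ := hχ m₂ h₂
  have hmod : e₁ ≡ e₂ [MOD n] := by
    have := mul_left_cancel₀ (pow_ne_zero t (hMp m₁ h₁)) (hp₁.trans (h ▸ hp₂).symm)
    rwa [IsOfFinOrder.pow_eq_pow_iff_modEq (orderOf_pos_iff.1 (hord ▸ hn)), hord] at this
  have hge : (g : ZMod (n + 1)) ^ e₁ = g ^ e₂ :=
    pow_eq_pow_of_modEq hmod (orderOf_dvd_iff_pow_eq_one.1 hg.dvd)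
  exact mul_right_cancel₀ (right_ne_zero_of_mul_eq_one hq₁) (hq₁.trans (hge ▸ hq₂).symm)

end Splitting

/-- If `k₁ + k₂ + 1` is prime (with `k₁ ≤ k₂`, `k₁ + k₂ ≥ 3`), then there are
infinitely many primes `p` such that `[-k₁,k₂]*` splits `ℤ_p`. -/
theorem infinitely_many_split_primes_of_succ_prime
    (k₁ k₂ : ℕ) (h12 : k₁ ≤ k₂) (hk : 3 ≤ k₁ + k₂)
    (hprime : (k₁ + k₂ + 1).Prime) :
    {p : ℕ | p.Prime ∧ Splits (Iset k₁ k₂) p}.Infinite := by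
  have hI : Iset k₁ k₂ = ((Finset.Icc (-(k₁ : ℤ)) k₂).erase 0 : Finset ℤ) := by
    ext m
    simp [Iset, and_comm]
  have hinj {m₁ m₂ : ℤ} (h₁ : m₁ ∈ Finset.Icc (-(k₁ : ℤ)) k₂)
      (h₂ : m₂ ∈ Finset.Icc (-(k₁ : ℤ)) k₂)
      (h : (m₁ : ZMod (k₁ + k₂ + 1)) = (m₂ : ZMod (k₁ + k₂ + 1))) : m₁ = m₂ := by
    rw [Finset.mem_Icc] at h₁ h₂
    have hdvd := (ZMod.intCast_eq_intCast_iff_dvd_sub _ _ _).1 h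
    have := Int.eq_zero_of_abs_lt_dvd hdvd (by rw [abs_lt]; push_cast; omega)
    omega
  rw [hI]
  refine infinite_setOf_prime_splits (by omega) hprime ?_ (fun m hm h ↦ ?_)
    fun m₁ h₁ m₂ h₂ ↦ hinj (Finset.mem_of_mem_erase h₁) (Finset.mem_of_mem_erase h₂)
  · rw [Finset.card_erase_of_mem (by simp), Int.card_Icc]
    omega
  · exact Finset.ne_of_mem_erase hm (hinj (Finset.mem_of_mem_erase hm) (by simp) (by simpa using h))
end
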